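/- arXiv:2506.21391 — 2 statements merged into one kernel-verified Lean document; each statement's English description precedes it below -/
import Mathlib

section
/- Let n ≥ 5, let uv and f be two disjoint edges of Q_n, and let x, y, w, z be distinct vertices of Q_n (distinct also from u, v) with p(x) ≠ p(y) and p(w) ≠ p(z). Then Q_n − f contains a spanning 3-path P_{uv} + P_{xy} + P_{wz}. -/
open SimpleGraph Finset
open scoped Classical

/-- The `n`-dimensional hypercube graph: vertices are `Fin n → Bool`,
adjacent iff they differ in exactly one coordinate. -/
def Q (n : ℕ) : SimpleGraph (Fin n → Bool) :=
  SimpleGraph.fromRel fun x y => (Finset.univ.filter fun i => x i ≠ y i).card = 1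

/-- Parity of a vertex of the hypercube: sum of coordinates mod 2. -/
def qparity {n : ℕ} (x : Fin n → Bool) : ZMod 2 :=
  ∑ i, if x i then 1 else 0

/-! ### Covers by disjoint paths with prescribed ends -/

section Cover

variable {V W : Type*}

/-- `l` is the vertex list of a walk joining the two components of `q`. -/
def Route (G : SimpleGraph V) (q : V × V) (l : List V) : Prop :=
  ∃ w : G.Walk q.1 q.2, w.support = l

/-- The list of all prescribed ends. -/
def ends (L : List (V × V)) : List V := L.flatMap fun q => [q.1, q.2]

/-- Vertex-disjoint paths joining the pairs in `L` and covering all vertices. -/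
def HasCover (G : SimpleGraph V) (L : List (V × V)) : Prop :=
  ∃ P : List (List V), List.Forall₂ (Route G) L P ∧ P.flatten.Nodup ∧ ∀ a, a ∈ P.flatten

@[simp] lemma ends_nil : ends ([] : List (V × V)) = [] := rfl

@[simp] lemma ends_cons (q : V × V) (L : List (V × V)) :
    ends (q :: L) = q.1 :: q.2 :: ends L := rfl

lemma ends_map (g : V → W) (L : List (V × V)) :
    ends (L.map (Prod.map g g)) = (ends L).map g := by
  induction L <;> simp_all

lemma Route.map {G : SimpleGraph V} {H : SimpleGraph W} {g : V → W}
    (hg : ∀ a b, G.Adj a b → H.Adj (g a) (g b)) {q : V × V} {l : List V} (h : Route G q l) :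
    Route H (g q.1, g q.2) (l.map g) := by
  obtain ⟨w, rfl⟩ := h
  exact ⟨w.map ⟨g, fun {a b} => hg a b⟩, by simp⟩

lemma forall₂_route_map {G : SimpleGraph V} {H : SimpleGraph W} {g : V → W}
    (hg : ∀ a b, G.Adj a b → H.Adj (g a) (g b)) {L : List (V × V)} {P : List (List V)}
    (h : List.Forall₂ (Route G) L P) :
    List.Forall₂ (Route H) (L.map (Prod.map g g)) (P.map (List.map g)) := by
  induction h with
  | nil => exact .nil
  | cons h _ ih => exact .cons (h.map hg) ih

lemma Route.append {G : SimpleGraph V} {s a b t : V} {l l' : List V} (h : Route G (s, a) l)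
    (hab : G.Adj a b) (h' : Route G (b, t) l') : Route G (s, t) (l ++ l') := by
  obtain ⟨w, rfl⟩ := h
  obtain ⟨w', rfl⟩ := h'
  exact ⟨w.append (.cons hab w'), by simp [Walk.support_append]⟩

lemma HasCover.mono {G H : SimpleGraph V} (hGH : G ≤ H) {L : List (V × V)} (h : HasCover G L) :
    HasCover H L := by
  obtain ⟨P, hP, h⟩ := h
  exact ⟨P, hP.imp fun q l hq => by simpa using hq.map (g := id) (fun a b hab => hGH hab), h⟩

lemma HasCover.perm {G : SimpleGraph V} {L L' : List (V × V)} (hL : L.Perm L')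
    (h : HasCover G L) : HasCover G L' := by
  obtain ⟨P, hP, hn, hc⟩ := h
  obtain ⟨P', hP', hperm⟩ := List.perm_comp_forall₂ hL.symm hP
  exact ⟨P', hP', (hperm.flatten.nodup_iff).2 hn, fun a => hperm.flatten.mem_iff.2 (hc a)⟩

lemma HasCover.swap {G : SimpleGraph V} {s t : V} {L : List (V × V)}
    (h : HasCover G ((s, t) :: L)) : HasCover G ((t, s) :: L) := by
  obtain ⟨P, hP, hn, hc⟩ := h
  obtain ⟨l, P, ⟨w, rfl⟩, hP', rfl⟩ := List.forall₂_cons_left_iff.1 hP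
  have hperm : (w.support.reverse :: P).flatten.Perm (w.support :: P).flatten := by
    simpa only [List.flatten_cons] using w.support.reverse_perm.append_right _
  exact ⟨w.support.reverse :: P, .cons ⟨w.reverse, by simp⟩ hP', hperm.nodup_iff.2 hn,
    fun a => hperm.mem_iff.2 (hc a)⟩

lemma HasCover.swap_append {G : SimpleGraph V} {s t : V} {A B : List (V × V)}
    (h : HasCover G (A ++ (s, t) :: B)) : HasCover G (A ++ (t, s) :: B) :=
  (h.perm List.perm_middle).swap.perm List.perm_middle.symm

lemma HasCover.of_map_iso {G : SimpleGraph V} {H : SimpleGraph W} (e : G ≃g H)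
    {L : List (V × V)} (h : HasCover H (L.map (Prod.map e e))) : HasCover G L := by
  obtain ⟨P, hP, hn, hc⟩ := h
  refine ⟨P.map (List.map e.symm), ?_, ?_, fun a => ?_⟩
  · simpa [Function.comp_def, Prod.map] using
      forall₂_route_map (g := e.symm) (fun a b => (e.symm.map_adj_iff).2) hP
  · rw [← List.map_flatten]
    exact hn.map e.symm.injective
  · rw [← List.map_flatten, List.mem_map]
    exact ⟨e a, hc _, by simp⟩

end Cover

/-! ### Gluing covers of two copies of a graph -/

section Split

variable {V W : Type*} (p : V → ZMod 2) (i j : V → W)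

/-- A division of the pairs in `L` along two copies `i`, `j` of `V`: pairs with ends in different
copies are routed through `i a` and `j a` for the vertices `a` in `C`. -/
inductive Split : List (W × W) → List (V × V) → List (V × V) → List V → Prop
  | nil : Split [] [] [] []
  | left {L L₀ L₁ C} (s t : V) (h : p s ≠ p t) : Split L L₀ L₁ C →
      Split ((i s, i t) :: L) ((s, t) :: L₀) L₁ C
  | right {L L₀ L₁ C} (s t : V) (h : p s ≠ p t) : Split L L₀ L₁ C →
      Split ((j s, j t) :: L) L₀ ((s, t) :: L₁) C
  | cross {L L₀ L₁ C} (s t a : V) (hs : p a ≠ p s) (ht : p a ≠ p t) : Split L L₀ L₁ C →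
      Split ((i s, j t) :: L) ((s, a) :: L₀) ((a, t) :: L₁) (a :: C)
  | cross' {L L₀ L₁ C} (s t a : V) (hs : p a ≠ p s) (ht : p a ≠ p t) : Split L L₀ L₁ C →
      Split ((j s, i t) :: L) ((a, t) :: L₀) ((s, a) :: L₁) (a :: C)

namespace Split

variable {p i j} {L : List (W × W)} {L₀ L₁ : List (V × V)} {C : List V}

lemma ends_perm (h : Split p i j L L₀ L₁ C) :
    (ends L ++ (C.map i ++ C.map j)).Perm ((ends L₀).map i ++ (ends L₁).map j) := by
  classical
  rw [List.perm_iff_count]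
  intro x
  induction h <;> simp_all [List.count_cons] <;> omega

lemma opposite (h : Split p i j L L₀ L₁ C) :
    (∀ q ∈ L₀, p q.1 ≠ p q.2) ∧ ∀ q ∈ L₁, p q.1 ≠ p q.2 := by
  induction h with
  | nil => simp
  | left s t h _ ih => simpa [h] using ih
  | right s t h _ ih => simpa [h] using ih
  | cross s t a hs ht _ ih => simpa [hs.symm, ht] using ih
  | cross' s t a hs ht _ ih => simpa [hs.symm, ht] using ih

lemma length_add (h : Split p i j L L₀ L₁ C) : L₀.length + L₁.length = L.length + C.length := by
  induction h <;> simp_all <;> omega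

lemma length_le (h : Split p i j L L₀ L₁ C) : L₀.length ≤ L.length ∧ L₁.length ≤ L.length := by
  induction h <;> simp_all <;> omega

lemma eq_map (h : Split p i j L L₀ L₁ C) (hL₁ : L₁ = []) : L = L₀.map (Prod.map i i) := by
  induction h <;> simp_all

lemma countP_le {r : W → V} (hi : ∀ a, r (i a) = a) (hj : ∀ a, r (j a) = a)
    (h : Split p i j L L₀ L₁ C) (π : ZMod 2) :
    ((ends L).map r ++ C).countP (fun a => p a = π) ≤ 2 * L.length := by
  induction h with
  | nil => simp
  | left s t h _ ih | right s t h _ ih =>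
    simp only [ends_cons, List.map_cons, hi, hj, List.cons_append, List.countP_cons,
      decide_eq_true_eq, List.length_cons, List.countP_append] at ih ⊢
    split_ifs <;> omega
  | cross s t a hs ht _ ih | cross' s t a hs ht _ ih =>
    simp only [ends_cons, List.map_cons, hi, hj, List.cons_append, List.countP_cons,
      decide_eq_true_eq, List.length_cons, List.countP_append] at ih ⊢
    split_ifs <;> first | omega | simp_all

/-- Covers of the two copies join to paths for the original pairs. -/
lemma glue {G : SimpleGraph V} {H : SimpleGraph W} (hi : ∀ a b, G.Adj a b → H.Adj (i a) (i b))
    (hj : ∀ a b, G.Adj a b → H.Adj (j a) (j b)) (h : Split p i j L L₀ L₁ C)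
    (hC : ∀ a ∈ C, H.Adj (i a) (j a)) {P₀ P₁ : List (List V)}
    (h₀ : List.Forall₂ (Route G) L₀ P₀) (h₁ : List.Forall₂ (Route G) L₁ P₁) :
    ∃ P, List.Forall₂ (Route H) L P ∧
      P.flatten.Perm (P₀.flatten.map i ++ P₁.flatten.map j) := by
  classical
  simp only [List.perm_iff_count]
  induction h generalizing P₀ P₁ with
  | nil =>
    cases h₀; cases h₁
    exact ⟨[], .nil, by simp⟩
  | left s t _ _ ih =>
    obtain ⟨l, P₀, hl, h₀', rfl⟩ := List.forall₂_cons_left_iff.1 h₀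
    obtain ⟨P, hP, hperm⟩ := ih hC h₀' h₁
    exact ⟨l.map i :: P, .cons (hl.map hi) hP, fun x => by simp [hperm]⟩
  | right s t _ _ ih =>
    obtain ⟨l, P₁, hl, h₁', rfl⟩ := List.forall₂_cons_left_iff.1 h₁
    obtain ⟨P, hP, hperm⟩ := ih hC h₀ h₁'
    exact ⟨l.map j :: P, .cons (hl.map hj) hP, fun x => by simp [hperm]; omega⟩
  | cross s t a _ _ _ ih =>
    obtain ⟨l, P₀, hl, h₀', rfl⟩ := List.forall₂_cons_left_iff.1 h₀
    obtain ⟨l', P₁, hl', h₁', rfl⟩ := List.forall₂_cons_left_iff.1 h₁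
    obtain ⟨P, hP, hperm⟩ := ih (fun a ha => hC a (by simp [ha])) h₀' h₁'
    exact ⟨(l.map i ++ l'.map j) :: P,
      .cons ((hl.map hi).append (hC a (by simp)) (hl'.map hj)) hP,
      fun x => by simp [hperm]; omega⟩
  | cross' s t a _ _ _ ih =>
    obtain ⟨l, P₀, hl, h₀', rfl⟩ := List.forall₂_cons_left_iff.1 h₀
    obtain ⟨l', P₁, hl', h₁', rfl⟩ := List.forall₂_cons_left_iff.1 h₁
    obtain ⟨P, hP, hperm⟩ := ih (fun a ha => hC a (by simp [ha])) h₀' h₁'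
    exact ⟨(l'.map j ++ l.map i) :: P,
      .cons ((hl'.map hj).append (hC a (by simp)).symm (hl.map hi)) hP,
      fun x => by simp [hperm]; omega⟩

end Split

/-- If all ends lie in the copy `i`, one of the paths can be rerouted through the copy `j`. -/
lemma exists_detour {i j : V → W} {G : SimpleGraph V} {H : SimpleGraph W}
    (hi : ∀ a b, G.Adj a b → H.Adj (i a) (i b)) (hj : ∀ a b, G.Adj a b → H.Adj (j a) (j b))
    {c : V} (hc : ∀ a, a ≠ c → H.Adj (i a) (j a))
    (ham : ∀ a b, G.Adj a b → ∃ l, Route G (a, b) l ∧ l.Nodup ∧ ∀ x, x ∈ l)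
    {L : List (V × V)} {P : List (List V)} (h : List.Forall₂ (Route G) L P)
    (hn : P.flatten.Nodup) (hlen : 3 * P.length < P.flatten.length) :
    ∃ P', List.Forall₂ (Route H) (L.map (Prod.map i i)) P' ∧
      ∃ l : List V, l.Nodup ∧ (∀ x, x ∈ l) ∧ P'.flatten.Perm (P.flatten.map i ++ l.map j) := by
  classical
  simp only [List.perm_iff_count]
  induction h with
  | nil => simp at hlen
  | @cons q l L P hl hP ih =>
    by_cases h4 : l.length ≤ 3
    · simp only [List.flatten_cons, List.nodup_append] at hn
      obtain ⟨P', hP', l', hl', hl'', hperm⟩ := ih hn.2.1 (by simp at hlen ⊢; omega)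
      exact ⟨l.map i :: P', .cons (hl.map hi) hP', l', hl', hl'', fun x => by
        simp [hperm]⟩
    · have reroute {s a b t : V} {l l' : List V} (hl : Route G (s, a) l) (hab : G.Adj a b)
          (hl' : Route G (b, t) l') (ha : a ≠ c) (hb : b ≠ c) :
          ∃ m, Route H (i s, i t) m ∧ ∃ k : List V, k.Nodup ∧ (∀ x, x ∈ k) ∧
            ∀ x, m.count x = ((l ++ l').map i ++ k.map j).count x := by
        obtain ⟨k, hk, hk', hk''⟩ := ham a b hab
        exact ⟨_, (hl.map hi).append (hc a ha) ((hk.map hj).append (hc b hb).symm (hl'.map hi)),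
          k, hk', hk'', fun x => by simp; omega⟩
      suffices h : ∃ m, Route H (i q.1, i q.2) m ∧ ∃ k : List V, k.Nodup ∧ (∀ x, x ∈ k) ∧
          ∀ x, m.count x = (l.map i ++ k.map j).count x by
        obtain ⟨m, hm, k, hk, hk', hperm⟩ := h
        exact ⟨m :: P.map (List.map i), .cons hm (forall₂_route_map hi hP), k, hk, hk',
          fun x => by simp [hperm, List.map_flatten]; omega⟩
      have hln : l.Nodup := by
        rw [List.flatten_cons, List.nodup_append] at hn
        exact hn.1
      obtain ⟨s, t⟩ := q
      obtain ⟨w, rfl⟩ : ∃ w : G.Walk s t, w.support = l := hl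
      rcases w with _ | ⟨h₁, _ | ⟨h₂, _ | ⟨h₃, w⟩⟩⟩
      · simp at h4
      · simp at h4
      · simp at h4
      rename_i a b d
      by_cases hfst : s ≠ c ∧ a ≠ c
      · simpa using reroute (s := s) (a := s) (b := a) (t := t) ⟨.nil, rfl⟩ h₁
          ⟨.cons h₂ (.cons h₃ w), rfl⟩ hfst.1 hfst.2
      · have hbd : b ≠ c ∧ d ≠ c := by
          simp only [Walk.support_cons, List.nodup_cons, List.mem_cons, not_or] at hln
          have hsd : s ≠ d := fun e => hln.1.2.2 (e ▸ w.start_mem_support)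
          have had : a ≠ d := fun e => hln.2.1.2 (e ▸ w.start_mem_support)
          constructor <;> rintro rfl <;> simp_all
        simpa using reroute (s := s) (a := b) (b := d) (t := t) ⟨.cons h₁ (.cons h₂ .nil), rfl⟩ h₃
          ⟨w, rfl⟩ hbd.1 hbd.2

end Split

/-! ### Hypercubes -/

section Hypercube

variable {n : ℕ}

/-- The vertex of `Q (n + 1)` over `a` whose `d`-th coordinate is `b`. -/
def ins (d : Fin (n + 1)) (b : Bool) (a : Fin n → Bool) : Fin (n + 1) → Bool :=
  d.insertNth (α := fun _ => Bool) b a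

@[simp] lemma ins_same (d : Fin (n + 1)) (b : Bool) (a : Fin n → Bool) : ins d b a d = b := by
  simp [ins]

@[simp] lemma ins_succAbove (d : Fin (n + 1)) (b : Bool) (a : Fin n → Bool) (k : Fin n) :
    ins d b a (d.succAbove k) = a k := by
  simp [ins]

@[simp] lemma removeNth_ins (d : Fin (n + 1)) (b : Bool) (a : Fin n → Bool) :
    d.removeNth (ins d b a) = a := by
  simp [ins]

lemma ins_removeNth (d : Fin (n + 1)) (x : Fin (n + 1) → Bool) :
    ins d (x d) (d.removeNth x) = x := by
  simp [ins]

lemma exists_eq_ins (d : Fin (n + 1)) (b : Bool) (x : Fin (n + 1) → Bool) :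
    ∃ a, x = ins d b a ∨ x = ins d (!b) a := by
  refine ⟨d.removeNth x, ?_⟩
  by_cases h : x d = b
  · exact .inl (h ▸ (ins_removeNth d x).symm)
  · exact .inr (by rw [← Bool.eq_not_of_ne h, ins_removeNth])

lemma ins_injective (d : Fin (n + 1)) (b : Bool) : Function.Injective (ins d b) := fun a a' h => by
  simpa using congrArg d.removeNth h

lemma ins_ne_ins_not (d : Fin (n + 1)) (b : Bool) (a a' : Fin n → Bool) :
    ins d b a ≠ ins d (!b) a' := fun h => by
  simpa using congrFun h d

lemma Q_adj {x y : Fin n → Bool} : (Q n).Adj x y ↔ ∃ i, ∀ k, x k ≠ y k ↔ k = i := by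
  have h : (Q n).Adj x y ↔ (univ.filter fun i => x i ≠ y i).card = 1 := by
    rw [Q, SimpleGraph.fromRel_adj]
    simp only [ne_comm (a := y _), or_self, and_iff_right_iff_imp]
    rintro h rfl
    simp at h
  simp only [h, Finset.card_eq_one, Finset.ext_iff, mem_filter, mem_univ, true_and, mem_singleton]

lemma Q_adj_ins {d : Fin (n + 1)} {b : Bool} {a a' : Fin n → Bool} :
    (Q (n + 1)).Adj (ins d b a) (ins d b a') ↔ (Q n).Adj a a' := by
  simp only [Q_adj]
  constructor
  · rintro ⟨i, hi⟩
    obtain rfl | ⟨i, rfl⟩ := d.eq_self_or_eq_succAbove i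
    · simpa using hi i
    · exact ⟨i, fun k => by simpa using hi (d.succAbove k)⟩
  · rintro ⟨i, hi⟩
    refine ⟨d.succAbove i, fun k => ?_⟩
    obtain rfl | ⟨k, rfl⟩ := d.eq_self_or_eq_succAbove k
    · simp [(Fin.succAbove_ne _ _).symm]
    · simpa using hi k

lemma Q_adj_ins_not (d : Fin (n + 1)) (b : Bool) (a : Fin n → Bool) :
    (Q (n + 1)).Adj (ins d b a) (ins d (!b) a) := by
  refine Q_adj.2 ⟨d, fun k => ?_⟩
  obtain rfl | ⟨k, rfl⟩ := d.eq_self_or_eq_succAbove k <;> simp [Fin.succAbove_ne]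

lemma exists_eq_ins_of_adj {x y : Fin (n + 1) → Bool} (h : (Q (n + 1)).Adj x y) :
    ∃ d c, s(x, y) = s(ins d false c, ins d true c) := by
  obtain ⟨d, hd⟩ := Q_adj.1 h
  have hxy : d.removeNth x = d.removeNth y := by
    funext k
    by_contra hk
    exact Fin.succAbove_ne d k ((hd _).1 hk)
  refine ⟨d, d.removeNth x, ?_⟩
  have hx := ins_removeNth d x
  have hy := ins_removeNth d y
  rw [← hxy] at hy
  have hne : x d ≠ y d := (hd d).2 rfl
  cases hxd : x d <;> cases hyd : y d <;> simp_all

lemma qparity_ins (d : Fin (n + 1)) (b : Bool) (a : Fin n → Bool) :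
    qparity (ins d b a) = (if b then 1 else 0) + qparity a := by
  simp [qparity, Fin.sum_univ_succAbove _ d]

lemma qparity_ne_of_adj {x y : Fin n → Bool} (h : (Q n).Adj x y) : qparity x ≠ qparity y := by
  cases n with
  | zero => exact absurd (Subsingleton.elim x y) h.ne
  | succ n =>
    obtain ⟨d, c, h⟩ := exists_eq_ins_of_adj h
    rcases Sym2.eq_iff.1 h with ⟨rfl, rfl⟩ | ⟨rfl, rfl⟩ <;> simp [qparity_ins]

lemma card_qparity (π : ZMod 2) :
    (univ.filter fun x : Fin (n + 1) → Bool => qparity x = π).card = 2 ^ n := by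
  have h : (univ.filter fun x : Fin (n + 1) → Bool => qparity x = π) =
      univ.image fun a : Fin n → Bool => ins 0 (decide (qparity a ≠ π)) a := by
    ext x
    obtain ⟨a, ha⟩ := exists_eq_ins 0 true x
    simp only [mem_filter, mem_univ, true_and, mem_image]
    have key : ∀ u v : ZMod 2, 1 + u = v ↔ ¬ u = v := by decide
    constructor
    · intro hx
      refine ⟨a, ?_⟩
      rcases ha with rfl | rfl <;> simp_all [qparity_ins]
    · rintro ⟨a, rfl⟩
      by_cases h : qparity a = π <;> simp [qparity_ins, h, key]
  rw [h, card_image_of_injective]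
  · simp
  · intro a a' h
    simpa using congrArg (Fin.removeNth 0) h

/-- A list with fewer than eight vertices of parity `π` misses such a vertex. -/
lemma exists_qparity_eq_notMem (hn : 4 ≤ n) (π : ZMod 2) (F : List (Fin n → Bool))
    (hF : F.countP (fun a => qparity a = π) < 8) : ∃ a, qparity a = π ∧ a ∉ F := by
  obtain ⟨n, rfl⟩ : ∃ m, n = m + 1 := ⟨n - 1, by omega⟩
  by_contra! h
  have hsub : (univ.filter fun x : Fin (n + 1) → Bool => qparity x = π) ⊆
      (F.filter fun a => qparity a = π).toFinset := fun a ha => by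
    have ha : qparity a = π := by simpa using ha
    simpa [ha] using h a ha
  have hle := (card_le_card hsub).trans (List.toFinset_card_le _)
  rw [card_qparity, ← List.countP_eq_length_filter] at hle
  have := Nat.pow_le_pow_right (n := 2) (by norm_num) (show 3 ≤ n by omega)
  omega

/-- The coordinates in which `x` and `y` differ. -/
def diff (x y : Fin n → Bool) : Fin n → Bool := fun k => x k ^^ y k

lemma diff_ins (d : Fin (n + 1)) (b : Bool) (x y : Fin n → Bool) :
    diff (ins d b x) (ins d b y) = ins d false (diff x y) := by
  funext k
  obtain rfl | ⟨k, rfl⟩ := d.eq_self_or_eq_succAbove k <;> simp [diff]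

lemma diff_comm (x y : Fin n → Bool) : diff x y = diff y x := by
  funext k
  simp [diff, Bool.xor_comm]

lemma diff_diff (x y : Fin n → Bool) : diff x (diff x y) = y := by
  funext k
  simp [diff]

/-- Distinct ends, with the ends of each pair of opposite parity. -/
def Admissible (L : List ((Fin n → Bool) × (Fin n → Bool))) : Prop :=
  (ends L).Nodup ∧ ∀ q ∈ L, qparity q.1 ≠ qparity q.2

/-- Three pairs are nondegenerate unless they are parallel and nonadjacent. -/
def Nondegenerate (L : List ((Fin n → Bool) × (Fin n → Bool))) : Prop :=
  L.length ≤ 2 ∨ (∃ q ∈ L, (Q n).Adj q.1 q.2) ∨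
    ∃ q ∈ L, ∃ q' ∈ L, diff q.1 q.2 ≠ diff q'.1 q'.2

lemma nondegenerate_of_map_ins {d : Fin (n + 1)} {b : Bool}
    {L : List ((Fin n → Bool) × (Fin n → Bool))}
    (h : Nondegenerate (L.map (Prod.map (ins d b) (ins d b)))) : Nondegenerate L := by
  simpa [Nondegenerate, Q_adj_ins, diff_ins, (ins_injective d false).eq_iff,
    List.mem_map, -Prod.forall, -Prod.exists] using h

/-- All vertices `a` for which `(s, a)` is parallel to the first pair of `L`. -/
def parallel (s : Fin n → Bool) : List ((Fin n → Bool) × (Fin n → Bool)) → List (Fin n → Bool)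
  | [] => []
  | q :: _ => [diff s (diff q.1 q.2)]

lemma length_parallel_le (s : Fin n → Bool) (L : List ((Fin n → Bool) × (Fin n → Bool))) :
    (parallel s L).length ≤ 1 := by
  cases L <;> simp [parallel]

lemma nondegenerate_cons {s a : Fin n → Bool} {L : List ((Fin n → Bool) × (Fin n → Bool))}
    (h : a ∉ parallel s L) : Nondegenerate ((s, a) :: L) := by
  cases L with
  | nil => exact .inl (by simp)
  | cons q L =>
    refine .inr (.inr ⟨_, List.mem_cons_self, q, by simp, fun e => h ?_⟩)
    simp [parallel, ← e, diff_diff]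

lemma nondegenerate_cons' {t a : Fin n → Bool} {L : List ((Fin n → Bool) × (Fin n → Bool))}
    (h : a ∉ parallel t L) : Nondegenerate ((a, t) :: L) := by
  cases L with
  | nil => exact .inl (by simp)
  | cons q L =>
    refine .inr (.inr ⟨_, List.mem_cons_self, q, by simp, fun e => h ?_⟩)
    simp [parallel, ← e, diff_comm a t, diff_diff]

end Hypercube

/-! ### The induction step -/

section Step

variable {n : ℕ} {d : Fin (n + 1)} {b : Bool}

/-- A division of `L` along the `d`-th coordinate whose crossing vertices are distinct and avoid
`F` and the given ends. -/
def GoodSplit (d : Fin (n + 1)) (b : Bool) (F : List (Fin n → Bool))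
    (L : List ((Fin (n + 1) → Bool) × (Fin (n + 1) → Bool)))
    (L₀ L₁ : List ((Fin n → Bool) × (Fin n → Bool))) (C : List (Fin n → Bool)) : Prop :=
  Split qparity (ins d b) (ins d !b) L L₀ L₁ C ∧ C.Nodup ∧
    ∀ a ∈ C, a ∉ F ∧ a ∉ (ends L).map d.removeNth

namespace GoodSplit

variable {F : List (Fin n → Bool)} {L : List ((Fin (n + 1) → Bool) × (Fin (n + 1) → Bool))}
  {L₀ L₁ : List ((Fin n → Bool) × (Fin n → Bool))} {C : List (Fin n → Bool)}

lemma cross {s t a : Fin n → Bool} (h : GoodSplit d b (s :: t :: F) L L₀ L₁ C)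
    (hs : qparity a ≠ qparity s) (ht : qparity a ≠ qparity t)
    (ha : a ∉ F ++ ((ends L).map d.removeNth ++ C)) :
    GoodSplit d b F ((ins d b s, ins d (!b) t) :: L) ((s, a) :: L₀) ((a, t) :: L₁) (a :: C) := by
  obtain ⟨h, hn, hC⟩ := h
  simp only [List.mem_append, not_or] at ha
  refine ⟨.cross s t a hs ht h, List.nodup_cons.2 ⟨ha.2.2, hn⟩, ?_⟩
  simp only [List.mem_cons, not_or, ends_cons, List.map_cons, removeNth_ins] at hC ⊢
  rintro x (rfl | hx)
  · exact ⟨ha.1, fun e => hs (e ▸ rfl), fun e => ht (e ▸ rfl), ha.2.1⟩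
  · have := hC x hx
    tauto

lemma cross' {s t a : Fin n → Bool} (h : GoodSplit d b (s :: t :: F) L L₀ L₁ C)
    (hs : qparity a ≠ qparity s) (ht : qparity a ≠ qparity t)
    (ha : a ∉ F ++ ((ends L).map d.removeNth ++ C)) :
    GoodSplit d b F ((ins d (!b) s, ins d b t) :: L) ((a, t) :: L₀) ((s, a) :: L₁) (a :: C) := by
  obtain ⟨h, hn, hC⟩ := h
  simp only [List.mem_append, not_or] at ha
  refine ⟨.cross' s t a hs ht h, List.nodup_cons.2 ⟨ha.2.2, hn⟩, ?_⟩
  simp only [List.mem_cons, not_or, ends_cons, List.map_cons, removeNth_ins] at hC ⊢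
  rintro x (rfl | hx)
  · exact ⟨ha.1, fun e => hs (e ▸ rfl), fun e => ht (e ▸ rfl), ha.2.1⟩
  · have := hC x hx
    tauto

lemma exists_notMem (hn : 4 ≤ n) {s t : Fin n → Bool} (h : GoodSplit d b (s :: t :: F) L L₀ L₁ C)
    (hst : qparity (ins d b s) ≠ qparity (ins d (!b) t)) (E : List (Fin n → Bool))
    (hlen : E.length + 2 * L.length < 8) :
    ∃ a, qparity a ≠ qparity s ∧ qparity a ≠ qparity t ∧
      a ∉ E ++ ((ends L).map d.removeNth ++ C) := by
  have hst' : qparity t = qparity s := by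
    have key : ∀ x y : ZMod 2, (1 + x ≠ y → y = x) ∧ (x ≠ 1 + y → y = x) := by decide
    cases b
    · exact (key _ _).2 (by simpa [qparity_ins] using hst)
    · exact (key _ _).1 (by simpa [qparity_ins] using hst)
  obtain ⟨a, ha, ha'⟩ := exists_qparity_eq_notMem hn (qparity s + 1)
    (E ++ ((ends L).map d.removeNth ++ C)) (by
      rw [List.countP_append]
      have h₁ := h.1.countP_le (removeNth_ins d b) (removeNth_ins d !b) (qparity s + 1)
      have h₂ := List.countP_le_length (p := fun a => decide (qparity a = qparity s + 1)) (l := E)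
      omega)
  exact ⟨a, by simp [ha], by simp [ha, hst'], ha'⟩

lemma admissible (h : GoodSplit d b F L L₀ L₁ C) (hL : (ends L).Nodup) :
    Admissible L₀ ∧ Admissible L₁ := by
  obtain ⟨h, hn, hC⟩ := h
  have hnodup : (ends L ++ (C.map (ins d b) ++ C.map (ins d !b))).Nodup := by
    rw [List.nodup_append', List.nodup_append', List.disjoint_append_right]
    refine ⟨hL, ⟨hn.map (ins_injective d b), hn.map (ins_injective d _), ?_⟩, ?_, ?_⟩ <;>
      intro x hx hx' <;> obtain ⟨a, ha, rfl⟩ := List.mem_map.1 hx'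
    · obtain ⟨a', -, e⟩ := List.mem_map.1 hx
      exact ins_ne_ins_not d b a' a e
    all_goals exact (hC a ha).2 (List.mem_map.2 ⟨_, hx, by simp⟩)
  have hnodup' := (List.nodup_append.1 (h.ends_perm.nodup_iff.1 hnodup))
  exact ⟨⟨hnodup'.1.of_map, h.opposite.1⟩, hnodup'.2.1.of_map, h.opposite.2⟩

end GoodSplit

lemma exists_goodSplit (hn : 4 ≤ n) (d : Fin (n + 1)) (b : Bool)
    (L : List ((Fin (n + 1) → Bool) × (Fin (n + 1) → Bool)))
    (hL : ∀ q ∈ L, qparity q.1 ≠ qparity q.2) (F : List (Fin n → Bool))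
    (hF : F.length + 2 * L.length ≤ 9) : ∃ L₀ L₁ C, GoodSplit d b F L L₀ L₁ C := by
  induction L generalizing F with
  | nil => exact ⟨[], [], [], .nil, by simp, by simp⟩
  | cons q L ih =>
    obtain ⟨x, y⟩ := q
    have hxy : qparity x ≠ qparity y := hL _ List.mem_cons_self
    obtain ⟨s, hs⟩ := exists_eq_ins d b x
    obtain ⟨t, ht⟩ := exists_eq_ins d b y
    simp only [List.length_cons] at hF
    obtain ⟨L₀, L₁, C, h⟩ := ih (fun q hq => hL q (List.mem_cons_of_mem _ hq)) (s :: t :: F)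
      (by simp; omega)
    have hC : ∀ a ∈ C, a ∉ F ∧ a ≠ s ∧ a ≠ t ∧ a ∉ (ends L).map d.removeNth := fun a ha => by
      have := h.2.2 a ha
      simp only [List.mem_cons, not_or] at this
      tauto
    rcases hs with rfl | rfl <;> rcases ht with rfl | rfl
    · refine ⟨_, _, C, .left s t (by simpa [qparity_ins] using hxy) h.1, h.2.1, fun a ha => ?_⟩
      simpa using hC a ha
    · obtain ⟨a, has, hat, ha⟩ := h.exists_notMem hn hxy F (by omega)
      exact ⟨_, _, _, h.cross has hat ha⟩
    · have h' : GoodSplit d b (t :: s :: F) L L₀ L₁ C := ⟨h.1, h.2.1, fun a ha => by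
        simpa [and_left_comm, and_assoc] using hC a ha⟩
      obtain ⟨a, hat, has, ha⟩ := h'.exists_notMem hn hxy.symm F (by omega)
      exact ⟨_, _, _, h.cross' has hat ha⟩
    · refine ⟨_, _, C, .right s t (by simpa [qparity_ins] using hxy) h.1, h.2.1, fun a ha => ?_⟩
      simpa using hC a ha

lemma exists_split_of_forall_eq (d : Fin (n + 1)) (b : Bool)
    (L : List ((Fin (n + 1) → Bool) × (Fin (n + 1) → Bool)))
    (hL : ∀ q ∈ L, qparity q.1 ≠ qparity q.2) (hd : ∀ q ∈ L, q.1 d = q.2 d) :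
    ∃ L₀ L₁, Split qparity (ins d b) (ins d !b) L L₀ L₁ [] ∧ (L₀ = [] → ∀ q ∈ L, q.1 d ≠ b) := by
  induction L with
  | nil => exact ⟨[], [], .nil, by simp⟩
  | cons q L ih =>
    obtain ⟨x, y⟩ := q
    have hxy : qparity x ≠ qparity y := hL _ List.mem_cons_self
    have hd' : x d = y d := hd _ List.mem_cons_self
    obtain ⟨s, hs⟩ := exists_eq_ins d b x
    obtain ⟨t, ht⟩ := exists_eq_ins d b y
    obtain ⟨L₀, L₁, h, h'⟩ := ih (fun q hq => hL q (List.mem_cons_of_mem _ hq))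
      (fun q hq => hd q (List.mem_cons_of_mem _ hq))
    rcases hs with rfl | rfl <;> rcases ht with rfl | rfl
    · exact ⟨_, _, .left s t (by simpa [qparity_ins] using hxy) h, by simp⟩
    · simp at hd'
    · simp at hd'
    · exact ⟨_, _, .right s t (by simpa [qparity_ins] using hxy) h, by simpa using h'⟩

/-- A cover from covers of the two halves. -/
lemma hasCover_of_perm {G : SimpleGraph (Fin (n + 1) → Bool)}
    {L : List ((Fin (n + 1) → Bool) × (Fin (n + 1) → Bool))} {P : List (List (Fin (n + 1) → Bool))}
    (hP : List.Forall₂ (Route G) L P) {l₀ l₁ : List (Fin n → Bool)}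
    (h : P.flatten.Perm (l₀.map (ins d b) ++ l₁.map (ins d !b)))
    (h₀ : l₀.Nodup) (h₁ : l₁.Nodup) (h₀' : ∀ a, a ∈ l₀) (h₁' : ∀ a, a ∈ l₁) : HasCover G L := by
  refine ⟨P, hP, h.nodup_iff.2 ?_, fun x => h.mem_iff.2 ?_⟩
  · rw [List.nodup_append']
    refine ⟨h₀.map (ins_injective d b), h₁.map (ins_injective d _), fun x hx hx' => ?_⟩
    obtain ⟨a, -, rfl⟩ := List.mem_map.1 hx
    obtain ⟨a', -, e⟩ := List.mem_map.1 hx'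
    exact ins_ne_ins_not d b a a' e.symm
  · obtain ⟨a, rfl | rfl⟩ := exists_eq_ins d b x <;> simp [h₀', h₁']

/-- Every nondegenerate admissible family of at most three pairs has a cover in `Q n`. -/
def Coverable (n : ℕ) : Prop :=
  ∀ L : List ((Fin n → Bool) × (Fin n → Bool)), L ≠ [] → L.length ≤ 3 → Admissible L →
    Nondegenerate L → HasCover (Q n) L

lemma adj_deleteEdges_ins {c : Fin n → Bool} {a a' : Fin n → Bool} (h : (Q n).Adj a a')
    (b : Bool) : ((Q (n + 1)).deleteEdges {s(ins d false c, ins d true c)}).Adj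
      (ins d b a) (ins d b a') := by
  refine SimpleGraph.deleteEdges_adj.2 ⟨Q_adj_ins.2 h, fun e => ?_⟩
  rcases Sym2.eq_iff.1 e with ⟨h₁, h₂⟩ | ⟨h₁, h₂⟩ <;>
    · have h₁ := congrFun h₁ d
      have h₂ := congrFun h₂ d
      simp_all

lemma adj_deleteEdges_ins_not {c a : Fin n → Bool} (h : a ≠ c) (b : Bool) :
    ((Q (n + 1)).deleteEdges {s(ins d false c, ins d true c)}).Adj
      (ins d b a) (ins d (!b) a) := by
  refine SimpleGraph.deleteEdges_adj.2 ⟨Q_adj_ins_not d b a, fun e => h ?_⟩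
  rcases Sym2.eq_iff.1 e with ⟨h₁, -⟩ | ⟨h₁, -⟩ <;> simpa using congrArg d.removeNth h₁

/-- Three path covers survive the loss of one edge in the next dimension. -/
lemma Coverable.hasCover_deleteEdges (hn : 4 ≤ n) (ih : Coverable n) (d : Fin (n + 1))
    (c : Fin n → Bool) {L : List ((Fin (n + 1) → Bool) × (Fin (n + 1) → Bool))} (hL : L ≠ [])
    (hlen : L.length ≤ 3) (hadm : Admissible L) (hnd : Nondegenerate L) :
    HasCover ((Q (n + 1)).deleteEdges {s(ins d false c, ins d true c)}) L := by
  have glue {b : Bool} {L L₀ L₁ C F} (h : GoodSplit d b (c :: F) L L₀ L₁ C) (hL : (ends L).Nodup)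
      (hlen : L.length ≤ 3) (h₀ : L₀ ≠ []) (h₁ : L₁ ≠ []) (h₀' : Nondegenerate L₀)
      (h₁' : Nondegenerate L₁) :
      HasCover ((Q (n + 1)).deleteEdges {s(ins d false c, ins d true c)}) L := by
    have hle := h.1.length_le
    obtain ⟨P₀, hP₀, hn₀, hc₀⟩ := ih L₀ h₀ (by omega) (h.admissible hL).1 h₀'
    obtain ⟨P₁, hP₁, hn₁, hc₁⟩ := ih L₁ h₁ (by omega) (h.admissible hL).2 h₁'
    obtain ⟨P, hP, hperm⟩ := h.1.glue (fun a a' h => adj_deleteEdges_ins h _)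
      (fun a a' h => adj_deleteEdges_ins h _)
      (fun a ha => adj_deleteEdges_ins_not (fun e : a = c => (h.2.2 a ha).1 (by simp [e])) _)
      hP₀ hP₁
    exact hasCover_of_perm hP hperm hn₀ hn₁ hc₀ hc₁
  by_cases hcross : ∃ q ∈ L, q.1 d ≠ q.2 d
  · obtain ⟨q, hq, hqd⟩ := hcross
    obtain ⟨R, hR⟩ : ∃ R, L.Perm (q :: R) := ⟨_, List.perm_cons_erase hq⟩
    refine HasCover.perm hR.symm ?_
    have hRlen : R.length ≤ 2 := by
      simpa [hR.length_eq, Nat.lt_succ_iff] using hlen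
    have hRnd : (ends (q :: R)).Nodup := (hR.flatMap_right _).nodup_iff.1 hadm.1
    have hRopp : ∀ q ∈ R, qparity q.1 ≠ qparity q.2 := fun q' hq' =>
      hadm.2 q' (hR.mem_iff.2 (by simp [hq']))
    have hqopp := hadm.2 q hq
    obtain ⟨x, y⟩ := q
    obtain ⟨s, hs⟩ : ∃ s, x = ins d (x d) s := ⟨_, (ins_removeNth d x).symm⟩
    obtain ⟨t, ht⟩ : ∃ t, y = ins d (!(x d)) t :=
      ⟨_, by rw [← Bool.eq_not_of_ne hqd.symm]; exact (ins_removeNth d y).symm⟩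
    generalize x d = b at hs ht
    subst hs ht
    obtain ⟨L₀, L₁, C, h⟩ := exists_goodSplit hn d b R hRopp [s, t, c] (by simp; omega)
    have h₀ := length_parallel_le s L₀
    have h₁ := length_parallel_le t L₁
    obtain ⟨a, has, hat, ha⟩ := h.exists_notMem hn hqopp (c :: (parallel s L₀ ++ parallel t L₁))
      (by simp; omega)
    simp only [List.mem_append, List.mem_cons, not_or] at ha
    refine glue (h.cross has hat (by simp [ha])) hRnd (by simpa [Nat.lt_succ_iff] using hRlen)
      (by simp) (by simp)
      (nondegenerate_cons ha.1.2.1) (nondegenerate_cons' ha.1.2.2)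
  · push Not at hcross
    obtain ⟨q, hq⟩ := List.exists_mem_of_ne_nil L hL
    obtain ⟨L₀, L₁, h, h'⟩ := exists_split_of_forall_eq d (q.1 d) L hadm.2 hcross
    have h₀ : L₀ ≠ [] := fun e => h' e q hq rfl
    clear h' hcross hq
    generalize q.1 d = b at h
    have hgood : GoodSplit d b [c] L L₀ L₁ [] := ⟨h, by simp, by simp⟩
    by_cases h₁ : L₁ = []
    · obtain rfl := h.eq_map h₁
      obtain ⟨P, hP, hn', hc'⟩ := ih L₀ h₀ (by simpa using hlen) (hgood.admissible hadm.1).1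
        (nondegenerate_of_map_ins hnd)
      have ham (a a' : Fin n → Bool) (h : (Q n).Adj a a') :
          ∃ l, Route (Q n) (a, a') l ∧ l.Nodup ∧ ∀ x, x ∈ l := by
        obtain ⟨P, hP, hn', hc'⟩ := ih [(a, a')] (by simp) (by simp)
          ⟨by simp [h.ne], by simpa using qparity_ne_of_adj h⟩ (.inl (by simp))
        obtain ⟨l, P, hl, hP', rfl⟩ := List.forall₂_cons_left_iff.1 hP
        obtain rfl := List.forall₂_nil_left_iff.1 hP'
        exact ⟨l, hl, by simpa using hn', by simpa using hc'⟩
      have hcard : P.flatten.length = 2 ^ n := by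
        have huniv : P.flatten.toFinset = univ :=
          eq_univ_of_forall fun a => List.mem_toFinset.2 (hc' a)
        rw [← List.toFinset_card_of_nodup hn', huniv]
        simp
      have hpow := Nat.pow_le_pow_right (n := 2) (by norm_num) hn
      have hPlen := hP.length_eq
      rw [List.length_map] at hlen
      obtain ⟨P', hP', l, hl, hl', hperm⟩ := exists_detour
        (fun a a' h => adj_deleteEdges_ins (d := d) (c := c) h b)
        (fun a a' h => adj_deleteEdges_ins h !b) (fun a ha => adj_deleteEdges_ins_not ha b)
        ham hP hn' (by omega)
      exact hasCover_of_perm hP' hperm hn' hl hc' hl'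
    · have hadd := h.length_add
      have h₀' := List.length_pos_iff.2 h₀
      have h₁' := List.length_pos_iff.2 h₁
      simp only [List.length_nil] at hadd
      exact glue hgood hadm.1 hlen h₀ h₁ (.inl (by omega)) (.inl (by omega))

lemma Coverable.succ (hn : 4 ≤ n) (ih : Coverable n) : Coverable (n + 1) :=
  fun _ hL hlen hadm hnd =>
    (ih.hasCover_deleteEdges hn 0 (fun _ => false) hL hlen hadm hnd).mono
      (SimpleGraph.deleteEdges_le _)

end Step

/-! ### Searching for covers of the four-dimensional cube -/

section Search

/-- `f n`, in a form that makes the kernel evaluate `n` first. -/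
def force {α : Type} (n : ℕ) (f : ℕ → α) : α := Nat.rec (f 0) (fun k _ => f (k + 1)) n

lemma force_eq {α : Type} (n : ℕ) (f : ℕ → α) : force n f = f n := by
  cases n <;> rfl

/-- Whether `k` is one of `1`, `2`, `4`, `8`. -/
def isStep (k : ℕ) : Bool := (278).testBit k

/-- Depth-first search with fuel `k`: extend a path at `c` with end `t`, then join the pairs in
`r`, using exactly the free vertices given by the binary digits of `m`. -/
def search : ℕ → ℕ → ℕ → ℕ → List (ℕ × ℕ) → Bool
  | 0, _, _, _, _ => false
  | k + 1, m, c, t, r =>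
    force m fun m => force c fun c =>
      (m.testBit (c ^^^ 1) && search k (m ^^^ (1 <<< (c ^^^ 1))) (c ^^^ 1) t r) ||
      (m.testBit (c ^^^ 2) && search k (m ^^^ (1 <<< (c ^^^ 2))) (c ^^^ 2) t r) ||
      (m.testBit (c ^^^ 4) && search k (m ^^^ (1 <<< (c ^^^ 4))) (c ^^^ 4) t r) ||
      (m.testBit (c ^^^ 8) && search k (m ^^^ (1 <<< (c ^^^ 8))) (c ^^^ 8) t r) ||
      (isStep (c ^^^ t) &&
        match r with
        | [] => m.beq 0
        | q :: r => search k m q.1 q.2 r)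

/-- The binary digits of the result give the numbers below `16` that are not ends. -/
def free (L : List (ℕ × ℕ)) : ℕ :=
  L.foldr (fun q m => m ^^^ (1 <<< q.1) ^^^ (1 <<< q.2)) 65535

/-- Search for a cover of the four-dimensional cube. -/
def solve : List (ℕ × ℕ) → Bool
  | [] => false
  | q :: r => search 16 (free (q :: r)) q.1 q.2 r

/-- The vertices other than `0` of even parity. -/
def evens : List ℕ := [3, 5, 6, 9, 10, 12, 15]

/-- The vertices of odd parity. -/
def odds : List ℕ := [1, 2, 4, 7, 8, 11, 13, 14]

/-- The search succeeds for all families in normal form. -/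
def checkAll : Bool :=
  [1, 7].all fun v => solve [(0, v)] && evens.all fun x => odds.all fun y =>
    y.beq v || (v.beq 7 && isStep (x ^^^ y)) || (solve [(0, v), (x, y)] &&
      evens.all fun w => w.ble x || odds.all fun z =>
        z.beq v || z.beq y || (v.beq 7 && (x ^^^ y).beq 7 && (w ^^^ z).beq 7) ||
          (v.beq 7 && isStep (w ^^^ z)) || solve [(0, v), (x, y), (w, z)])

lemma checkAll_eq_true : checkAll = true := by decide +kernel

/-- The vertex of `Q 4` with coordinates the binary digits of `k`. -/
def vert (k : ℕ) : Fin 4 → Bool := fun i => k.testBit i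

lemma isStep_iff {k : ℕ} : isStep k = true ↔ ∃ i : Fin 4, k = 2 ^ (i : ℕ) := by
  constructor
  · intro h
    have h' := Nat.ge_two_pow_of_testBit h
    have : k ≤ 8 := by
      by_contra! hk
      have := Nat.pow_le_pow_right (n := 2) (by norm_num) hk
      omega
    revert h
    clear h'
    revert k
    decide
  · rintro ⟨i, rfl⟩
    revert i
    decide

lemma diff_vert (a b : ℕ) : diff (vert a) (vert b) = vert (a ^^^ b) := by
  funext i
  simp [diff, vert]

lemma Q_adj_vert {a b : ℕ} (h : isStep (a ^^^ b) = true) : (Q 4).Adj (vert a) (vert b) := by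
  obtain ⟨i, hi⟩ := isStep_iff.1 h
  refine Q_adj.2 ⟨i, fun k => ?_⟩
  have hk := congrFun (diff_vert a b) k
  rw [hi] at hk
  rw [← bne_iff_ne, Bool.bne_eq_xor, show (vert a k ^^ vert b k) = _ from hk]
  simp [vert, Nat.testBit_two_pow, Fin.ext_iff, eq_comm]

lemma bitIndices_perm {m b : ℕ} (h : b ∈ m.bitIndices) :
    m.bitIndices.Perm (b :: (m ^^^ (1 <<< b)).bitIndices) := by
  rw [Nat.mem_bitIndices] at h
  refine (List.perm_ext_iff_of_nodup (by simp) ?_).2 fun a => ?_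
  · simp [Nat.one_shiftLeft, h]
  · by_cases hab : b = a
    · subst hab
      simp [h]
    · simp [Nat.one_shiftLeft, hab, Ne.symm hab]

/-- Vertex lists found by a successful search. -/
lemma exists_of_search {k m c t : ℕ} {r : List (ℕ × ℕ)} (h : search k m c t r = true) :
    ∃ P : List (List ℕ),
      List.Forall₂ (Route (Q 4)) (((c, t) :: r).map (Prod.map vert vert))
        (P.map (List.map vert)) ∧
      P.flatten.Perm (m.bitIndices ++ ends ((c, t) :: r)) := by
  induction k generalizing m c t r with
  | zero => simp [search] at h
  | succ k ih =>
    have extend {e : ℕ} (he : isStep e = true) (hb : m.testBit (c ^^^ e) = true)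
        (hs : search k (m ^^^ (1 <<< (c ^^^ e))) (c ^^^ e) t r = true) : ∃ P : List (List ℕ),
        List.Forall₂ (Route (Q 4)) (((c, t) :: r).map (Prod.map vert vert))
          (P.map (List.map vert)) ∧
        P.flatten.Perm (m.bitIndices ++ ends ((c, t) :: r)) := by
      obtain ⟨P, hP, hperm⟩ := ih hs
      have hadj : (Q 4).Adj (vert c) (vert (c ^^^ e)) :=
        Q_adj_vert (by rwa [Nat.xor_xor_cancel_left])
      have hbit := bitIndices_perm (Nat.mem_bitIndices.2 hb)
      cases P with
      | nil => simp at hP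
      | cons l P =>
        rw [List.map_cons, List.map_cons, List.forall₂_cons] at hP
        obtain ⟨⟨w, hw⟩, hP⟩ := hP
        refine ⟨(c :: l) :: P, .cons ⟨.cons hadj w, by simp [← hw]⟩ hP, ?_⟩
        rw [List.perm_iff_count] at *
        intro a
        have h₁ := hperm a
        have h₂ := hbit a
        simp only [List.flatten_cons, List.count_append, List.count_cons, ends_cons,
          List.cons_append] at h₁ h₂ ⊢
        omega
    simp only [search, force_eq, Bool.or_eq_true, Bool.and_eq_true] at h
    rcases h with (((⟨hb, hs⟩ | ⟨hb, hs⟩) | ⟨hb, hs⟩) | ⟨hb, hs⟩) | ⟨hst, h⟩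
    · exact extend (by decide) hb hs
    · exact extend (by decide) hb hs
    · exact extend (by decide) hb hs
    · exact extend (by decide) hb hs
    · have hct : Route (Q 4) (vert c, vert t) ([c, t].map vert) :=
        ⟨.cons (Q_adj_vert hst) .nil, rfl⟩
      cases r with
      | nil =>
        obtain rfl : m = 0 := Nat.eq_of_beq_eq_true h
        exact ⟨[[c, t]], .cons hct .nil, by simp⟩
      | cons q r =>
        obtain ⟨P, hP, hperm⟩ := ih h
        refine ⟨[c, t] :: P, .cons hct hP, ?_⟩
        rw [List.perm_iff_count] at *
        intro a
        have := hperm a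
        simp only [List.flatten_cons, List.count_append, List.count_cons, ends_cons,
          List.count_nil] at this ⊢
        omega

lemma bitIndices_free_perm {L : List (ℕ × ℕ)} (hL : (ends L).Nodup)
    (hlt : ∀ a ∈ ends L, a < 16) :
    ((free L).bitIndices ++ ends L).Perm (List.range 16) := by
  induction L with
  | nil =>
    refine (List.perm_ext_iff_of_nodup (by simp) List.nodup_range).2 fun a => ?_
    have : 65535 = 2 ^ 16 - 1 := by norm_num
    simp [free, this, -Nat.reducePow, -Nat.reduceSub]
  | cons q L ih =>
    obtain ⟨a, b⟩ := q
    simp only [ends_cons, List.nodup_cons, List.mem_cons, not_or, forall_eq_or_imp] at hL hlt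
    have ih := ih hL.2.2 hlt.2.2
    have ha : a ∈ (free L).bitIndices := by
      simpa [hL.1.2] using (ih.mem_iff (a := a)).2 (by simpa using hlt.1)
    have h₁ := bitIndices_perm ha
    have hb : b ∈ (free L ^^^ 1 <<< a).bitIndices := by
      have := (ih.mem_iff (a := b)).2 (by simpa using hlt.2.1)
      rw [List.mem_append, h₁.mem_iff] at this
      simpa [hL.2.1, Ne.symm hL.1.1] using this
    have h₂ := bitIndices_perm hb
    rw [List.perm_iff_count] at *
    intro x
    have h₁ := h₁ x
    have h₂ := h₂ x
    have ih := ih x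
    simp only [← ih, List.count_append, List.count_cons, ends_cons] at h₁ h₂ ⊢
    change List.count x ((free L ^^^ 1 <<< a) ^^^ 1 <<< b).bitIndices + _ = _
    omega

lemma vert_mem (x : Fin 4 → Bool) : ∃ k < 16, vert k = x := by
  revert x
  decide

lemma hasCover_of_solve {L : List (ℕ × ℕ)} (h : solve L = true) (hL : (ends L).Nodup)
    (hlt : ∀ a ∈ ends L, a < 16) : HasCover (Q 4) (L.map (Prod.map vert vert)) := by
  cases L with
  | nil => simp [solve] at h
  | cons q L =>
    obtain ⟨P, hP, hperm⟩ := exists_of_search (r := L) h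
    have hperm := (hperm.trans (bitIndices_free_perm hL hlt)).map vert
    rw [List.map_flatten] at hperm
    refine ⟨_, hP, hperm.nodup_iff.2 (by decide), fun x => hperm.mem_iff.2 ?_⟩
    obtain ⟨k, hk, rfl⟩ := vert_mem x
    exact List.mem_map_of_mem (List.mem_range.2 hk)

end Search

/-! ### The four-dimensional cube -/

section Base

variable {n : ℕ}

lemma qparity_diff (x y : Fin n → Bool) : qparity (diff x y) = qparity x + qparity y := by
  rw [qparity, qparity, qparity, ← sum_add_distrib]
  refine sum_congr rfl fun k _ => ?_
  rw [diff]
  cases x k <;> cases y k <;> decide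

lemma qparity_comp (σ : Equiv.Perm (Fin n)) (x : Fin n → Bool) : qparity (x ∘ σ) = qparity x :=
  Equiv.sum_comp σ fun k => if x k then (1 : ZMod 2) else 0

lemma qparity_ne_iff {x y : Fin n → Bool} : qparity x ≠ qparity y ↔ qparity (diff x y) ≠ 0 := by
  have key : ∀ a b : ZMod 2, a ≠ b ↔ a + b ≠ 0 := by decide
  rw [qparity_diff, key]

/-- The automorphism of the cube that moves `u` to the origin and permutes the coordinates. -/
def cubeIso (u : Fin n → Bool) (σ : Equiv.Perm (Fin n)) : Q n ≃g Q n where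
  toFun x := diff u x ∘ σ
  invFun y := diff u (y ∘ σ.symm)
  left_inv x := by simp [Function.comp_assoc, diff_diff]
  right_inv y := by simp [Function.comp_assoc, diff_diff]
  map_rel_iff' := by
    intro x y
    have h (k) : (diff u x ∘ σ) k ≠ (diff u y ∘ σ) k ↔ x (σ k) ≠ y (σ k) := by simp [diff]
    simp only [Equiv.coe_fn_mk, Q_adj, h]
    constructor
    · rintro ⟨i, hi⟩
      refine ⟨σ i, fun k => ?_⟩
      obtain ⟨k, rfl⟩ := σ.surjective k
      simp [hi]
    · rintro ⟨i, hi⟩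
      exact ⟨σ.symm i, fun k => by rw [hi, Equiv.eq_symm_apply]⟩

lemma diff_cubeIso (u : Fin n → Bool) (σ : Equiv.Perm (Fin n)) (x y : Fin n → Bool) :
    diff (cubeIso u σ x) (cubeIso u σ y) = diff x y ∘ σ := by
  funext k
  change ((u (σ k) ^^ x (σ k)) ^^ (u (σ k) ^^ y (σ k))) = (x (σ k) ^^ y (σ k))
  cases u (σ k) <;> simp

lemma Admissible.map_cubeIso {L : List ((Fin n → Bool) × (Fin n → Bool))} (h : Admissible L)
    (u : Fin n → Bool) (σ : Equiv.Perm (Fin n)) :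
    Admissible (L.map (Prod.map (cubeIso u σ) (cubeIso u σ))) := by
  refine ⟨?_, fun q hq => ?_⟩
  · rw [ends_map]
    exact h.1.map (cubeIso u σ).injective
  · obtain ⟨q, hqL, rfl⟩ := List.mem_map.1 hq
    simpa only [qparity_ne_iff, Prod.map_fst, Prod.map_snd, diff_cubeIso, qparity_comp] using
      h.2 q hqL

lemma Nondegenerate.map_cubeIso {L : List ((Fin n → Bool) × (Fin n → Bool))}
    (h : Nondegenerate L) (u : Fin n → Bool) (σ : Equiv.Perm (Fin n)) :
    Nondegenerate (L.map (Prod.map (cubeIso u σ) (cubeIso u σ))) := by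
  simpa only [Nondegenerate, List.length_map, List.mem_map, exists_exists_and_eq_and,
    Prod.map_fst, Prod.map_snd,
    SimpleGraph.Iso.map_adj_iff, diff_cubeIso, ne_eq,
    (σ.surjective.injective_comp_right (γ := Bool)).eq_iff] using h

lemma Admissible.perm {L L' : List ((Fin n → Bool) × (Fin n → Bool))} (h : Admissible L)
    (hL : L.Perm L') : Admissible L' :=
  ⟨(hL.flatMap_right _).nodup_iff.1 h.1, fun q hq => h.2 q (hL.mem_iff.2 hq)⟩

lemma Nondegenerate.perm {L L' : List ((Fin n → Bool) × (Fin n → Bool))} (h : Nondegenerate L)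
    (hL : L.Perm L') : Nondegenerate L' := by
  simpa only [Nondegenerate, hL.mem_iff, hL.length_eq] using h

lemma ends_vert_facts : ∀ k ∈ evens, ∀ l ∈ odds, k < 16 ∧ l < 16 ∧ 0 ≠ k ∧ 0 ≠ l ∧ k ≠ l := by
  decide

lemma odds_of_mem : ∀ {v}, v ∈ [1, 7] → v ∈ odds := by
  decide

lemma hasCover_vert_one {v : ℕ} (hv : v ∈ [1, 7]) :
    HasCover (Q 4) ([(0, v)].map (Prod.map vert vert)) := by
  have h := checkAll_eq_true
  simp only [checkAll, List.all_eq_true, Bool.and_eq_true] at h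
  exact hasCover_of_solve (h v hv).1 (by aesop) (by aesop)

lemma hasCover_vert_two {v k l : ℕ} (hv : v ∈ [1, 7]) (hk : k ∈ evens) (hl : l ∈ odds)
    (hvl : v ≠ l) (hstep : v = 7 → isStep (k ^^^ l) = false) :
    HasCover (Q 4) ([(0, v), (k, l)].map (Prod.map vert vert)) := by
  have h := checkAll_eq_true
  simp only [checkAll, List.all_eq_true, Bool.and_eq_true, Bool.or_eq_true, Nat.beq_eq] at h
  have hv' : v ∈ odds := odds_of_mem hv
  obtain ⟨h₁, h₈, h₂, h₃, h₄⟩ := ends_vert_facts k hk l hl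
  obtain ⟨-, h₅, -, h₆, h₇⟩ := ends_vert_facts k hk v hv'
  have := (h v hv).2 k hk l hl
  refine hasCover_of_solve (L := [(0, v), (k, l)]) ?_ ?_ ?_
  · grind
  · clear h this; simp; grind
  · clear h this; simp; grind

lemma hasCover_vert_three {v k l k' l' : ℕ} (hv : v ∈ [1, 7]) (hk : k ∈ evens) (hl : l ∈ odds)
    (hk' : k' ∈ evens) (hl' : l' ∈ odds) (hvl : v ≠ l) (hvl' : v ≠ l') (hll' : l ≠ l')
    (hkk' : k ≠ k') (hstep : v = 7 → isStep (k ^^^ l) = false)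
    (hstep' : v = 7 → isStep (k' ^^^ l') = false)
    (hpar : ¬ (v = 7 ∧ k ^^^ l = 7 ∧ k' ^^^ l' = 7)) :
    HasCover (Q 4) ([(0, v), (k, l), (k', l')].map (Prod.map vert vert)) := by
  wlog hlt : k < k' generalizing k l k' l'
  · exact (this hk' hl' hk hl hvl' hvl hll'.symm hkk'.symm hstep' hstep (by tauto)
      (by omega)).perm ((List.Perm.swap ..).cons _)
  have h := checkAll_eq_true
  simp only [checkAll, List.all_eq_true, Bool.and_eq_true, Bool.or_eq_true, Nat.beq_eq,
    Nat.ble_eq] at h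
  have hv' : v ∈ odds := odds_of_mem hv
  obtain ⟨h₁, h₈, h₂, h₃, h₄⟩ := ends_vert_facts k hk l hl
  obtain ⟨-, h₅, -, h₆, h₇⟩ := ends_vert_facts k hk v hv'
  obtain ⟨i₁, i₈, i₂, i₃, i₄⟩ := ends_vert_facts k' hk' l' hl'
  obtain ⟨-, i₅, -, i₆, i₇⟩ := ends_vert_facts k' hk' v hv'
  obtain ⟨-, -, -, -, j₁⟩ := ends_vert_facts k hk l' hl'
  obtain ⟨-, -, -, -, j₂⟩ := ends_vert_facts k' hk' l hl
  have := (h v hv).2 k hk l hl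
  refine hasCover_of_solve (L := [(0, v), (k, l), (k', l')]) ?_ ?_ ?_
  · grind
  · clear h this; simp; grind
  · clear h this; simp; grind

lemma exists_rotation : ∀ d : Fin 4 → Bool, qparity d ≠ 0 → ∃ k : Fin 4,
    d ∘ Equiv.addRight k = vert 1 ∨ d ∘ Equiv.addRight k = vert 7 := by
  decide

lemma exists_eq_vert : ∀ x : Fin 4 → Bool, x ≠ vert 0 →
    (qparity x = 0 ∧ ∃ k ∈ evens, x = vert k) ∨ (qparity x = 1 ∧ ∃ k ∈ odds, x = vert k) := by
  decide

lemma exists_pair_eq_vert {q : (Fin 4 → Bool) × (Fin 4 → Bool)} (hq : qparity q.1 ≠ qparity q.2)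
    (h₁ : q.1 ≠ vert 0) (h₂ : q.2 ≠ vert 0) :
    ∃ k ∈ evens, ∃ l ∈ odds, q = (vert k, vert l) ∨ q = (vert l, vert k) := by
  obtain ⟨x, y⟩ := q
  rcases exists_eq_vert x h₁ with ⟨hx, k, hk, rfl⟩ | ⟨hx, k, hk, rfl⟩ <;>
    rcases exists_eq_vert y h₂ with ⟨hy, l, hl, rfl⟩ | ⟨hy, l, hl, rfl⟩
  · simp [hx, hy] at hq
  · exact ⟨k, hk, l, hl, .inl rfl⟩
  · exact ⟨l, hl, k, hk, .inr rfl⟩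
  · simp [hx, hy] at hq

lemma hasCover_of_vert_cons {v : ℕ} (hv : v ∈ [1, 7])
    {L : List ((Fin 4 → Bool) × (Fin 4 → Bool))} (hlen : L.length ≤ 2)
    (hadm : Admissible ((vert 0, vert v) :: L)) (hnd : Nondegenerate ((vert 0, vert v) :: L))
    (hL : v = 7 → ∀ q ∈ L, ¬ (Q 4).Adj q.1 q.2) : HasCover (Q 4) ((vert 0, vert v) :: L) := by
  have hstep {k l : ℕ} (h : v = 7 → ¬ (Q 4).Adj (vert k) (vert l)) :
      v = 7 → isStep (k ^^^ l) = false := fun h7 => by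
    by_contra hs
    exact h h7 (Q_adj_vert (by simpa using hs))
  match L, hlen with
  | [], _ => exact hasCover_vert_one hv
  | [q], _ =>
    have hp := hadm.2 q (by simp)
    have hn := hadm.1
    simp only [ends_cons, ends_nil, List.nodup_cons, List.mem_cons, not_or] at hn
    obtain ⟨k, hk, l, hl, h⟩ := exists_pair_eq_vert hp (by grind) (by grind)
    have hc := hasCover_vert_two hv hk hl (by rintro rfl; grind)
      (hstep fun h7 h' => hL h7 q (by simp) (by rcases h with rfl | rfl; exacts [h', h'.symm]))
    rcases h with rfl | rfl
    · exact hc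
    · exact hc.swap_append (A := [_])
  | [q, q'], _ =>
    have hp := hadm.2 q (by simp)
    have hp' := hadm.2 q' (by simp)
    have hn := hadm.1
    simp only [ends_cons, ends_nil, List.nodup_cons, List.mem_cons, not_or] at hn
    obtain ⟨k, hk, l, hl, h⟩ := exists_pair_eq_vert hp (by grind) (by grind)
    obtain ⟨k', hk', l', hl', h'⟩ := exists_pair_eq_vert hp' (by grind) (by grind)
    have hd : diff q.1 q.2 = vert (k ^^^ l) := by
      rcases h with rfl | rfl <;> simp [diff_vert, Nat.xor_comm]
    have hd' : diff q'.1 q'.2 = vert (k' ^^^ l') := by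
      rcases h' with rfl | rfl <;> simp [diff_vert, Nat.xor_comm]
    have hc := hasCover_vert_three hv hk hl hk' hl' (by rintro rfl; grind) (by rintro rfl; grind)
      (by rintro rfl; grind) (by rintro rfl; grind)
      (hstep fun h7 h'' => hL h7 q (by simp) (by rcases h with rfl | rfl; exacts [h'', h''.symm]))
      (hstep fun h7 h'' => hL h7 q' (by simp)
        (by rcases h' with rfl | rfl; exacts [h'', h''.symm]))
      (by
        rintro ⟨rfl, e, e'⟩
        rw [e] at hd
        rw [e'] at hd'
        have hna : ¬ (Q 4).Adj (vert 0) (vert 7) := by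
          rw [Q_adj]
          decide
        have hd₀ : diff (vert 0) (vert 7) = vert 7 := diff_vert 0 7
        simp [Nondegenerate, hna, hd, hd', hd₀] at hnd hL
        tauto)
    rcases h with rfl | rfl <;> rcases h' with rfl | rfl
    · exact hc
    · exact hc.swap_append (A := [_, _])
    · exact hc.swap_append (A := [_])
    · exact (hc.swap_append (A := [_])).swap_append (A := [_, _])

lemma coverable_four : Coverable 4 := by
  intro L hL hlen hadm hnd
  obtain ⟨q, hq, hadj⟩ : ∃ q ∈ L, (Q 4).Adj q.1 q.2 ∨ ∀ q' ∈ L, ¬ (Q 4).Adj q'.1 q'.2 := by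
    by_cases h : ∃ q ∈ L, (Q 4).Adj q.1 q.2
    · obtain ⟨q, hq, h⟩ := h
      exact ⟨q, hq, .inl h⟩
    · obtain ⟨q, hq⟩ := List.exists_mem_of_ne_nil L hL
      exact ⟨q, hq, .inr fun q' hq' h' => h ⟨q', hq', h'⟩⟩
  have hperm := List.perm_cons_erase hq
  obtain ⟨k, hk⟩ := exists_rotation (diff q.1 q.2) (qparity_ne_iff.1 (hadm.2 q hq))
  set e := cubeIso q.1 (Equiv.addRight k) with he
  have h₀ : e q.1 = vert 0 := by
    funext i
    simp [he, cubeIso, diff, vert]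
  have hv : ∃ v ∈ [1, 7], e q.2 = vert v := by
    rcases hk with h | h
    exacts [⟨1, by simp, h⟩, ⟨7, by simp, h⟩]
  obtain ⟨v, hv, h₁⟩ := hv
  refine (HasCover.of_map_iso e ?_).perm hperm.symm
  have hadm := (hadm.perm hperm).map_cubeIso q.1 (Equiv.addRight k)
  have hnd := (hnd.perm hperm).map_cubeIso q.1 (Equiv.addRight k)
  rw [← he, List.map_cons, Prod.map_apply', h₀, h₁] at hadm hnd
  rw [List.map_cons, Prod.map_apply', h₀, h₁]
  refine hasCover_of_vert_cons hv ?_ hadm hnd ?_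
  · rw [List.length_map, List.length_erase_of_mem hq]
    omega
  · rintro rfl _ hmem
    obtain ⟨q', hq', rfl⟩ := List.mem_map.1 hmem
    simp only [Prod.map_fst, Prod.map_snd, SimpleGraph.Iso.map_adj_iff]
    rcases hadj with h | h
    · rw [← e.map_adj_iff, h₀, h₁, Q_adj] at h
      exact absurd h (by decide)
    · exact h q' (List.mem_of_mem_erase hq')

end Base

lemma coverable {n : ℕ} (hn : 4 ≤ n) : Coverable n := by
  induction n, hn using Nat.le_induction with
  | base => exact coverable_four
  | succ n hn ih => exact ih.succ hn

theorem spanning_three_path_one_fault (n : ℕ) (hn : 5 ≤ n)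
    (u v : Fin n → Bool) (huv : (Q n).Adj u v)
    (f : Sym2 (Fin n → Bool)) (hf : f ∈ (Q n).edgeSet)
    (hdisj : ∀ w ∈ f, w ≠ u ∧ w ≠ v)
    (x y w z : Fin n → Bool)
    (hdist : [u, v, x, y, w, z].Nodup)
    (hxy : qparity x ≠ qparity y) (hwz : qparity w ≠ qparity z) :
    ∃ (p : ((Q n).deleteEdges {f}).Walk u v)
      (q : ((Q n).deleteEdges {f}).Walk x y)
      (r : ((Q n).deleteEdges {f}).Walk w z),
      p.IsPath ∧ q.IsPath ∧ r.IsPath ∧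
      (∀ a, a ∈ p.support ∨ a ∈ q.support ∨ a ∈ r.support) ∧
      p.support.Disjoint q.support ∧ p.support.Disjoint r.support ∧
      q.support.Disjoint r.support := by
  obtain ⟨n, rfl⟩ : ∃ m, n = m + 1 := ⟨n - 1, by omega⟩
  obtain ⟨d, c, rfl⟩ : ∃ d c, f = s(ins d false c, ins d true c) := by
    induction f with
    | _ a b => exact exists_eq_ins_of_adj hf
  have hadm : Admissible [(u, v), (x, y), (w, z)] :=
    ⟨hdist, by simpa using ⟨qparity_ne_of_adj huv, hxy, hwz⟩⟩
  obtain ⟨P, hP, hn, hc⟩ := (coverable (by omega)).hasCover_deleteEdges (by omega) d c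
    (by simp) (by simp) hadm (.inr (.inl ⟨(u, v), by simp, huv⟩))
  obtain ⟨_, _, ⟨p, rfl⟩, hP₁, rfl⟩ := List.forall₂_cons_left_iff.1 hP
  obtain ⟨_, _, ⟨q, rfl⟩, hP₂, rfl⟩ := List.forall₂_cons_left_iff.1 hP₁
  obtain ⟨_, _, ⟨r, rfl⟩, hP₃, rfl⟩ := List.forall₂_cons_left_iff.1 hP₂
  obtain rfl := List.forall₂_nil_left_iff.1 hP₃
  simp only [List.flatten_cons, List.flatten_nil, List.append_nil, List.nodup_append',
    List.disjoint_append_right] at hn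
  exact ⟨p, q, r, .mk' hn.1, .mk' hn.2.1.1, .mk' hn.2.1.2.1, fun a => by simpa using hc a,
    hn.2.2.1, hn.2.2.2, hn.2.1.2.2⟩
end

section
/- Let n ≥ 4 and F ⊆ E(Q_n) with |F| ≤ 3n − 11. If every vertex of Q_n − F has degree at least 2 and at most one vertex of Q_n − F has degree exactly 2, then for any two vertices x, y of Q_n with opposite parity, Q_n − F contains a Hamiltonian path from x to y. -/
open SimpleGraph Finset
open scoped Classical

/-- Degree of a vertex after deleting the faulty edges. -/
noncomputable def faultyDeg {n : ℕ} (F : Finset (Sym2 (Fin n → Bool)))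
    (v : Fin n → Bool) : ℕ :=
  (((Q n).deleteEdges ↑F).neighborSet v).ncard

namespace Hypercube

section PathOn

variable {V W : Type*} {G H : SimpleGraph V} {S T U : Set V} {a b c d : V}

/-- `PathOn G S a b`: the graph `G` has a path from `a` to `b` whose vertex set is exactly `S`. -/
def PathOn (G : SimpleGraph V) (S : Set V) (a b : V) : Prop :=
  ∃ l : List V, l.IsChain G.Adj ∧ l.Nodup ∧ (∀ v, v ∈ l ↔ v ∈ S) ∧
    l.head? = some a ∧ l.getLast? = some b

theorem PathOn.single (G : SimpleGraph V) (a : V) : PathOn G {a} a a :=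
  ⟨[a], by simp, by simp, by simp, rfl, rfl⟩

theorem PathOn.symm (h : PathOn G S a b) : PathOn G S b a := by
  obtain ⟨l, hc, hn, hm, h1, h2⟩ := h
  refine ⟨l.reverse, ?_, by simpa using hn, by simpa using hm, by simpa using h2,
    by simpa using h1⟩
  rw [List.isChain_reverse]
  exact hc.imp fun _ _ h => h.symm

theorem PathOn.mono (h : PathOn G S a b) (hG : ∀ u v, u ∈ S → v ∈ S → G.Adj u v → H.Adj u v) :
    PathOn H S a b := by
  obtain ⟨l, hc, hn, hm, h1, h2⟩ := h
  refine ⟨l, ?_, hn, hm, h1, h2⟩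
  refine List.IsChain.imp_of_mem_imp (R := G.Adj) ?_ hc
  intro u v hu hv h
  exact hG u v ((hm u).1 hu) ((hm v).1 hv) h

theorem PathOn.congr (h : PathOn G S a b) (hS : ∀ v, v ∈ S ↔ v ∈ T) : PathOn G T a b :=
  (Set.ext hS : S = T) ▸ h

theorem PathOn.left_mem (h : PathOn G S a b) : a ∈ S := by
  obtain ⟨l, hc, hn, hm, h1, h2⟩ := h
  exact (hm a).1 (List.mem_of_mem_head? h1)

theorem PathOn.right_mem (h : PathOn G S a b) : b ∈ S := h.symm.left_mem

theorem PathOn.append (h : PathOn G S a b) (hbc : G.Adj b c) (h' : PathOn G T c d)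
    (hd : ∀ v, v ∈ S → v ∉ T) : PathOn G (S ∪ T) a d := by
  obtain ⟨l, hc, hn, hm, h1, h2⟩ := h
  obtain ⟨k, kc, kn, km, k1, k2⟩ := h'
  refine ⟨l ++ k, ?_, ?_, ?_, ?_, ?_⟩
  · rw [List.isChain_append]
    refine ⟨hc, kc, ?_⟩
    intro x hx y hy
    rw [h2] at hx
    rw [k1] at hy
    simp only [Option.mem_def, Option.some.injEq] at hx hy
    exact hx ▸ hy ▸ hbc
  · rw [List.nodup_append']
    refine ⟨hn, kn, ?_⟩
    intro v hv hv'
    exact hd v ((hm v).1 hv) ((km v).1 hv')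
  · intro v
    simp [hm, km]
  · simp [h1]
  · simp [k2]

theorem PathOn.map {G : SimpleGraph V} {H : SimpleGraph W} (f : V → W)
    (hf : Function.Injective f) (hG : ∀ u v, G.Adj u v → H.Adj (f u) (f v))
    (h : PathOn G S a b) : PathOn H (f '' S) (f a) (f b) := by
  obtain ⟨l, hc, hn, hm, h1, h2⟩ := h
  refine ⟨l.map f, ?_, hn.map hf, ?_, by simp [h1], by simp [h2]⟩
  · rw [List.isChain_map]
    exact hc.imp hG
  · intro w
    simp [hm]

theorem PathOn.eq_singleton (h : PathOn G S a a) : ∀ v, v ∈ S ↔ v = a := by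
  obtain ⟨l, hc, hn, hm, h1, h2⟩ := h
  match l, h1 with
  | [x], h1 => simp_all [eq_comm]
  | x :: y :: l, h1 =>
    exfalso
    simp only [List.head?_cons, Option.some.injEq] at h1
    have : a ∈ y :: l := by
      rw [List.getLast?_cons_cons] at h2
      exact List.mem_of_getLast? h2
    simp_all

/-- The path `h` passes from `u` directly to `v`, and splits there into `S₁` and `S₂`. -/
def PathOn.SplitAt (G : SimpleGraph V) (S : Set V) (a b u v : V) (S₁ S₂ : Set V) : Prop :=
  PathOn G S₁ a u ∧ G.Adj u v ∧ PathOn G S₂ v b ∧ (∀ z, z ∈ S ↔ z ∈ S₁ ∨ z ∈ S₂) ∧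
    ∀ z, z ∈ S₁ → z ∉ S₂

theorem splitAt_of_list {l₁ l₂ : List V} {u v : V}
    (hc : (l₁ ++ u :: v :: l₂).IsChain G.Adj) (hn : (l₁ ++ u :: v :: l₂).Nodup)
    (hm : ∀ z, z ∈ l₁ ++ u :: v :: l₂ ↔ z ∈ S) (h1 : (l₁ ++ u :: v :: l₂).head? = some a)
    (h2 : (l₁ ++ u :: v :: l₂).getLast? = some b) :
    PathOn.SplitAt G S a b u v {z | z ∈ l₁ ++ [u]} {z | z ∈ v :: l₂} := by
  have e : l₁ ++ u :: v :: l₂ = (l₁ ++ [u]) ++ (v :: l₂) := by simp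
  rw [e] at hc hn hm h1 h2
  rw [List.isChain_append] at hc
  rw [List.nodup_append'] at hn
  refine ⟨⟨l₁ ++ [u], hc.1, hn.1, fun _ => Iff.rfl, ?_, by simp⟩, ?_,
    ⟨v :: l₂, hc.2.1, hn.2.1, fun _ => Iff.rfl, rfl, ?_⟩, ?_, ?_⟩
  · rw [← h1]; cases l₁ <;> simp
  · exact hc.2.2 u (by simp) v (by simp)
  · rw [← h2, List.getLast?_append_of_ne_nil _ (by simp)]
  · intro z
    rw [← hm, List.mem_append]; rfl
  · intro z hz hz'
    exact hn.2.2 hz hz'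

private theorem length_le_of_no_pair (B : Finset V) :
    ∀ l : List V, (∀ l₁ u v l₂, l = l₁ ++ u :: v :: l₂ → u ∈ B ∨ v ∈ B) →
      l.length ≤ 2 * (l.filter (· ∈ B)).length + 1
  | [], _ => by simp
  | [x], _ => by simp
  | x :: y :: l, h => by
    by_cases hx : x ∈ B
    · have := length_le_of_no_pair B (y :: l) fun l₁ u v l₂ e => h (x :: l₁) u v l₂ (by simp [e])
      rw [List.filter_cons_of_pos (by simpa using hx)]
      simp only [List.length_cons] at this ⊢
      omega
    · have hy : y ∈ B := (h [] x y l rfl).resolve_left hx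
      have := length_le_of_no_pair B l fun l₁ u v l₂ e => h (x :: y :: l₁) u v l₂ (by simp [e])
      rw [List.filter_cons_of_neg (by simpa using hx), List.filter_cons_of_pos (by simpa using hy)]
      simp only [List.length_cons] at this ⊢
      omega

private theorem length_le_of_no_triple (B : Finset V) :
    ∀ l : List V, (∀ l₁ u v w l₂, l = l₁ ++ u :: v :: w :: l₂ → u ∈ B ∨ v ∈ B ∨ w ∈ B) →
      l.length ≤ 3 * (l.filter (· ∈ B)).length + 2
  | [], _ => by simp
  | [x], _ => by simp
  | [x, y], _ => by simp
  | x :: y :: z :: l, h => by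
    by_cases hx : x ∈ B
    · have := length_le_of_no_triple B (y :: z :: l)
        fun l₁ u v w l₂ e => h (x :: l₁) u v w l₂ (by simp [e])
      rw [List.filter_cons_of_pos (by simpa using hx)]
      simp only [List.length_cons] at this ⊢
      omega
    rw [List.filter_cons_of_neg (by simpa using hx)]
    by_cases hy : y ∈ B
    · have := length_le_of_no_triple B (z :: l)
        fun l₁ u v w l₂ e => h (x :: y :: l₁) u v w l₂ (by simp [e])
      rw [List.filter_cons_of_pos (by simpa using hy)]
      simp only [List.length_cons] at this ⊢
      omega
    have hz : z ∈ B := ((h [] x y z l rfl).resolve_left hx).resolve_left hy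
    have := length_le_of_no_triple B l
      fun l₁ u v w l₂ e => h (x :: y :: z :: l₁) u v w l₂ (by simp [e])
    rw [List.filter_cons_of_neg (by simpa using hy), List.filter_cons_of_pos (by simpa using hz)]
    simp only [List.length_cons] at this ⊢
    omega

private theorem filter_length_le (B : Finset V) {l : List V} (hn : l.Nodup) :
    (l.filter (· ∈ B)).length ≤ B.card := by
  rw [← List.toFinset_card_of_nodup (hn.filter _)]
  exact Finset.card_le_card fun x hx => by simpa using (List.mem_filter.1 (List.mem_toFinset.1 hx)).2

private theorem length_eq_ncard {l : List V} (hn : l.Nodup) (hm : ∀ z, z ∈ l ↔ z ∈ S) :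
    l.length = S.ncard := by
  rw [← List.toFinset_card_of_nodup hn, ← Set.ncard_coe_finset]
  congr 1
  ext z
  simp [hm]

/-- A path which is long compared to `B` has two consecutive vertices outside `B`. -/
theorem PathOn.exists_split (h : PathOn G S a b) (B : Finset V) (hB : 2 * B.card + 1 < S.ncard) :
    ∃ u v S₁ S₂, u ∉ B ∧ v ∉ B ∧ PathOn.SplitAt G S a b u v S₁ S₂ := by
  obtain ⟨l, hc, hn, hm, h1, h2⟩ := h
  by_contra hcon
  have := length_le_of_no_pair B l (by
    rintro l₁ u v l₂ rfl
    by_contra! huv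
    exact hcon ⟨u, v, _, _, huv.1, huv.2, splitAt_of_list hc hn hm h1 h2⟩)
  have := filter_length_le B hn
  have := length_eq_ncard hn hm
  omega

/-- A path which is long compared to `B` has three consecutive vertices outside `B`. -/
theorem PathOn.exists_split_triple (h : PathOn G S a b) (B : Finset V)
    (hB : 3 * B.card + 2 < S.ncard) :
    ∃ u v w, u ∉ B ∧ v ∉ B ∧ w ∉ B ∧ u ≠ w ∧ (∃ S₁ S₂, PathOn.SplitAt G S a b u v S₁ S₂) ∧
      ∃ S₁ S₂, PathOn.SplitAt G S a b v w S₁ S₂ := by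
  obtain ⟨l, hc, hn, hm, h1, h2⟩ := h
  by_contra hcon
  have := length_le_of_no_triple B l (by
    rintro l₁ u v w l₂ rfl
    by_contra! huv
    have e : l₁ ++ u :: v :: w :: l₂ = (l₁ ++ [u]) ++ v :: w :: l₂ := by simp
    refine hcon ⟨u, v, w, huv.1, huv.2.1, huv.2.2, ?_,
      ⟨_, _, splitAt_of_list hc hn hm h1 h2⟩, ?_⟩
    · rintro rfl
      simp [List.nodup_append'] at hn
    · rw [e] at hc hn hm h1 h2
      exact ⟨_, _, splitAt_of_list hc hn hm h1 h2⟩)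
  have := filter_length_le B hn
  have := length_eq_ncard hn hm
  omega

/-- A path of `G` either is a path of `H`, or passes through an edge of `G` missing in `H`. When
only one edge is missing, both parts of the path are paths of `H`. -/
theorem PathOn.heal {p q : V} (hGH : ∀ u v, G.Adj u v → H.Adj u v ∨ s(u, v) = s(p, q))
    (h : PathOn G S a b) :
    PathOn H S a b ∨ ∃ u v S₁ S₂, s(u, v) = s(p, q) ∧ PathOn H S₁ a u ∧ PathOn H S₂ v b ∧
      (∀ z, z ∈ S ↔ z ∈ S₁ ∨ z ∈ S₂) ∧ ∀ z, z ∈ S₁ → z ∉ S₂ := by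
  obtain ⟨l, hc, hn, hm, h1, h2⟩ := h
  by_cases hH : l.IsChain H.Adj
  · exact .inl ⟨l, hH, hn, hm, h1, h2⟩
  right
  have : ∃ l₁ u v l₂, l = l₁ ++ u :: v :: l₂ ∧ ¬ H.Adj u v := by
    by_contra! hcon
    apply hH
    rw [List.isChain_iff_getElem]
    intro i hi
    refine hcon (l.take i) _ _ (l.drop (i + 2)) ?_
    rw [List.cons_getElem_drop_succ, List.cons_getElem_drop_succ, List.take_append_drop]
  obtain ⟨l₁, u, v, l₂, rfl, huv⟩ := this
  obtain ⟨P₁, hadj, P₂, hS, hd⟩ := splitAt_of_list hc hn hm h1 h2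
  have he : s(u, v) = s(p, q) := (hGH u v hadj).resolve_left huv
  have key : ∀ {T c d}, PathOn G T c d → (u ∉ T ∨ v ∉ T) → PathOn H T c d := by
    intro T c d hP hT
    refine hP.mono fun x y hx hy hxy => (hGH x y hxy).resolve_right ?_
    intro hxy'
    rw [← he, Sym2.eq_iff] at hxy'
    rcases hxy' with ⟨rfl, rfl⟩ | ⟨rfl, rfl⟩ <;> tauto
  exact ⟨u, v, _, _, he, key P₁ (.inr fun hv => hd v hv P₂.left_mem),
    key P₂ (.inl fun hu => hd u P₁.right_mem hu), hS, hd⟩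

/-- Removing the last vertex of a path. -/
theorem PathOn.dropLast (h : PathOn G S a b) (hab : a ≠ b) :
    ∃ c S', PathOn G S' a c ∧ G.Adj c b ∧ b ∉ S' ∧ ∀ z, z ∈ S ↔ z ∈ S' ∨ z = b := by
  obtain ⟨l, hc, hn, hm, h1, h2⟩ := h
  obtain ⟨k, rfl⟩ : ∃ k, l = k ++ [b] := by
    refine ⟨l.dropLast, ?_⟩
    exact (List.dropLast_append_getLast? b h2).symm
  rcases List.eq_nil_or_concat k with rfl | ⟨k', c, rfl⟩
  · simp_all
  · rw [List.concat_eq_append, List.append_assoc] at hc hn hm h1 h2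
    obtain ⟨P₁, hadj, P₂, hS, hd⟩ := splitAt_of_list (l₂ := []) hc hn hm h1 h2
    exact ⟨c, _, P₁, hadj, fun hb => hd b hb (by simp), fun z => by simpa using hS z⟩

theorem PathOn.exists_isHamiltonian [DecidableEq V] (h : PathOn G Set.univ a b) :
    ∃ p : G.Walk a b, p.IsHamiltonian := by
  obtain ⟨l, hc, hn, hm, h1, h2⟩ := h
  have hne : l ≠ [] := by rintro rfl; simp at h1
  have ha : l.head hne = a := by
    rw [List.head?_eq_some_head hne] at h1; simpa using h1
  have hb : l.getLast hne = b := by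
    rw [List.getLast?_eq_some_getLast hne] at h2; simpa using h2
  subst ha hb
  refine ⟨Walk.ofSupport l hne hc, ?_⟩
  intro x
  rw [Walk.support_ofSupport]
  exact List.count_eq_one_of_mem hn ((hm x).2 trivial)

end PathOn

section Cube

variable {n m : ℕ}

/-- Flip coordinate `i` of `v`. -/
def toggle (v : Fin n → Bool) (i : Fin n) : Fin n → Bool := Function.update v i (!v i)

@[simp] theorem toggle_same (v : Fin n → Bool) (i : Fin n) : toggle v i i = !v i := by
  simp [toggle]

theorem toggle_of_ne (v : Fin n → Bool) {i j : Fin n} (h : j ≠ i) : toggle v i j = v j := by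
  simp [toggle, h]

@[simp] theorem toggle_toggle (v : Fin n → Bool) (i : Fin n) : toggle (toggle v i) i = v := by
  ext j
  by_cases h : j = i
  · subst h; simp
  · simp [toggle_of_ne _ h]

theorem toggle_ne (v : Fin n → Bool) (i : Fin n) : toggle v i ≠ v := fun h => by
  simpa using congrFun h i

@[simp] theorem toggle_inj {v : Fin n → Bool} {i j : Fin n} : toggle v i = toggle v j ↔ i = j := by
  refine ⟨fun h => ?_, fun h => h ▸ rfl⟩
  by_contra hij
  have := congrFun h i
  rw [toggle_same, toggle_of_ne _ hij] at this
  simp at this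

theorem Q_adj {v w : Fin n → Bool} : (Q n).Adj v w ↔ ∃ i, w = toggle v i := by
  rw [Q, fromRel_adj]
  constructor
  · rintro ⟨-, h⟩
    have h : (univ.filter fun i => v i ≠ w i).card = 1 := by
      rcases h with h | h
      · exact h
      · rw [← h]; congr 1; ext i; simp [eq_comm]
    obtain ⟨i, hi⟩ := card_eq_one.1 h
    refine ⟨i, ?_⟩
    ext j
    have hj : (v j ≠ w j) ↔ j = i := by
      have := Finset.ext_iff.1 hi j
      simpa using this
    by_cases hji : j = i
    · subst hji
      have := hj.2 rfl
      rw [toggle_same]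
      cases h1 : v j <;> cases h2 : w j <;> simp_all
    · rw [toggle_of_ne _ hji]
      by_contra hc
      exact hji (hj.1 fun e => hc e.symm)
  · rintro ⟨i, rfl⟩
    refine ⟨(toggle_ne v i).symm, .inl ?_⟩
    rw [card_eq_one]
    refine ⟨i, ?_⟩
    ext j
    by_cases hji : j = i
    · subst hji; simp
    · simp [toggle_of_ne _ hji, hji]

theorem Q_adj_toggle (v : Fin n → Bool) (i : Fin n) : (Q n).Adj v (toggle v i) :=
  Q_adj.2 ⟨i, rfl⟩

/-- Insert the value `β` at coordinate `i`. -/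
def ins (i : Fin (m + 1)) (β : Bool) (v : Fin m → Bool) : Fin (m + 1) → Bool :=
  Fin.insertNth (α := fun _ => Bool) i β v

@[simp] theorem ins_same (i : Fin (m + 1)) (β : Bool) (v : Fin m → Bool) : ins i β v i = β :=
  Fin.insertNth_apply_same ..

@[simp] theorem ins_succAbove (i : Fin (m + 1)) (β : Bool) (v : Fin m → Bool) (j : Fin m) :
    ins i β v (i.succAbove j) = v j :=
  Fin.insertNth_apply_succAbove ..

@[simp] theorem ins_inj {i : Fin (m + 1)} {β γ : Bool} {v w : Fin m → Bool} :
    ins i β v = ins i γ w ↔ β = γ ∧ v = w :=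
  Fin.insertNth_inj

theorem ins_injective (i : Fin (m + 1)) (β : Bool) : Function.Injective (ins i β) :=
  fun _ _ h => (ins_inj.1 h).2

theorem exists_ins (i : Fin (m + 1)) (w : Fin (m + 1) → Bool) : ∃ v, w = ins i (w i) v :=
  ⟨i.removeNth w, (Fin.insertNth_self_removeNth (α := fun _ => Bool) i w).symm⟩

theorem exists_eq_ins_or (i : Fin (m + 1)) (β : Bool) (w : Fin (m + 1) → Bool) :
    ∃ v, w = ins i β v ∨ w = ins i (!β) v := by
  obtain ⟨v, hv⟩ := exists_ins i w
  refine ⟨v, ?_⟩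
  cases β <;> cases h : w i <;> simp_all

theorem exists_eq_ins (i : Fin (m + 1)) (w : Fin (m + 1) → Bool) : ∃ β v, w = ins i β v :=
  ⟨_, exists_ins i w⟩

@[simp] theorem toggle_ins_same (i : Fin (m + 1)) (β : Bool) (v : Fin m → Bool) :
    toggle (ins i β v) i = ins i (!β) v := by
  ext j
  rcases Fin.eq_self_or_eq_succAbove i j with rfl | ⟨k, rfl⟩
  · simp
  · rw [toggle_of_ne _ (Fin.succAbove_ne i k)]; simp

@[simp] theorem toggle_ins_succAbove (i : Fin (m + 1)) (β : Bool) (v : Fin m → Bool) (j : Fin m) :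
    toggle (ins i β v) (i.succAbove j) = ins i β (toggle v j) := by
  ext k
  rcases Fin.eq_self_or_eq_succAbove i k with rfl | ⟨k, rfl⟩
  · rw [toggle_of_ne _ (Fin.succAbove_ne _ _).symm]; simp
  · by_cases h : k = j
    · subst h; simp
    · rw [toggle_of_ne _ (fun e => h (Fin.succAbove_right_injective e)), ins_succAbove,
        ins_succAbove, toggle_of_ne _ h]

/-- The parity of a vertex as a Boolean. -/
noncomputable def par (v : Fin n → Bool) : Bool := decide (qparity v = 1)

theorem par_ne_iff {v w : Fin n → Bool} : par v ≠ par w ↔ qparity v ≠ qparity w := by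
  have : ∀ a b : ZMod 2, (decide (a = 1) ≠ decide (b = 1)) ↔ a ≠ b := by decide
  exact this _ _

@[simp] theorem par_ins (i : Fin (m + 1)) (β : Bool) (v : Fin m → Bool) :
    par (ins i β v) = (β ^^ par v) := by
  have h : qparity (ins i β v) = (if β then 1 else 0) + qparity v := by
    simp [qparity, Fin.sum_univ_succAbove _ i]
  have : ∀ (a : ZMod 2) (β : Bool), decide ((if β then 1 else 0) + a = 1) = (β ^^ decide (a = 1)) := by
    decide
  rw [par, h, par, this]

@[simp] theorem par_toggle (v : Fin n → Bool) (i : Fin n) : par (toggle v i) = !par v := by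
  obtain _ | m := n
  · exact i.elim0
  obtain ⟨β, w, rfl⟩ := exists_eq_ins i v
  cases β <;> simp

theorem card_par (β : Bool) : (univ.filter fun v : Fin (m + 1) → Bool => par v = β).card = 2 ^ m := by
  have h : ∀ γ, (univ.filter fun v : Fin (m + 1) → Bool => par v = γ).card ≤
      (univ.filter fun v : Fin (m + 1) → Bool => par v = !γ).card := by
    intro γ
    refine card_le_card_of_injOn (fun v => toggle v 0) ?_ ?_
    · intro v hv
      simp_all
    · intro v _ w _ h
      have := congrArg (fun v => toggle v 0) h
      simpa using this
  have h1 := h β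
  have h2 := h (!β)
  rw [Bool.not_not] at h2
  have h3 := card_filter_add_card_filter_not (s := univ) fun v : Fin (m + 1) → Bool => par v = β
  have h4 : (univ.filter fun v : Fin (m + 1) → Bool => ¬ par v = β) =
      univ.filter fun v : Fin (m + 1) → Bool => par v = !β := by
    ext v; cases β <;> simp
  rw [h4, card_univ, Fintype.card_fun, Fintype.card_bool, Fintype.card_fin, pow_succ] at h3
  omega

theorem exists_par_eq (A : Finset (Fin (m + 1) → Bool)) (hA : A.card < 2 ^ m) (β : Bool) :
    ∃ v, v ∉ A ∧ par v = β := by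
  rw [← card_par β] at hA
  obtain ⟨v, hv, hv'⟩ := exists_mem_notMem_of_card_lt_card hA
  exact ⟨v, hv', by simpa using hv⟩

theorem ncard_univ_cube (m : ℕ) : (Set.univ : Set (Fin m → Bool)).ncard = 2 ^ m := by
  simp [Set.ncard_univ, Nat.card_eq_fintype_card]

end Cube

section Faults

variable {n m : ℕ}

/-- The hypercube with the faulty edges deleted. -/
abbrev FQ (F : Finset (Sym2 (Fin n → Bool))) : SimpleGraph (Fin n → Bool) := (Q n).deleteEdges ↑F

theorem FQ_adj {F : Finset (Sym2 (Fin n → Bool))} {v w : Fin n → Bool} :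
    (FQ F).Adj v w ↔ (Q n).Adj v w ∧ s(v, w) ∉ F := by
  simp [deleteEdges_adj]

theorem FQ_adj_par {F : Finset (Sym2 (Fin n → Bool))} {v w : Fin n → Bool} (h : (FQ F).Adj v w) :
    par w = !par v := by
  obtain ⟨i, rfl⟩ := Q_adj.1 (FQ_adj.1 h).1
  simp

/-- All faults are edges of the hypercube. -/
abbrev EdgeFaults (F : Finset (Sym2 (Fin n → Bool))) : Prop :=
  (F : Set (Sym2 (Fin n → Bool))) ⊆ (Q n).edgeSet

/-- The faults inside the half `v i = β`, as faults of the smaller cube. -/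
noncomputable def half (F : Finset (Sym2 (Fin (m + 1) → Bool))) (i : Fin (m + 1)) (β : Bool) :
    Finset (Sym2 (Fin m → Bool)) :=
  univ.filter fun e => e.map (ins i β) ∈ F

/-- The faults in direction `i`, each recorded by its projection. -/
noncomputable def cross (F : Finset (Sym2 (Fin (m + 1) → Bool))) (i : Fin (m + 1)) :
    Finset (Fin m → Bool) :=
  univ.filter fun w => s(ins i false w, ins i true w) ∈ F

@[simp] theorem mk_mem_half {F : Finset (Sym2 (Fin (m + 1) → Bool))} {i : Fin (m + 1)} {β : Bool}
    {v w : Fin m → Bool} : s(v, w) ∈ half F i β ↔ s(ins i β v, ins i β w) ∈ F := by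
  simp [half]

@[simp] theorem mem_cross {F : Finset (Sym2 (Fin (m + 1) → Bool))} {i : Fin (m + 1)} (β : Bool)
    {w : Fin m → Bool} : s(ins i β w, ins i (!β) w) ∈ F ↔ w ∈ cross F i := by
  cases β
  · simp [cross]
  · rw [Sym2.eq_swap]; simp [cross]

theorem adj_ins_iff {i : Fin (m + 1)} {β : Bool} {v w : Fin m → Bool} :
    (Q (m + 1)).Adj (ins i β v) (ins i β w) ↔ (Q m).Adj v w := by
  rw [Q_adj, Q_adj]
  constructor
  · rintro ⟨j, hj⟩
    rcases Fin.eq_self_or_eq_succAbove i j with rfl | ⟨k, rfl⟩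
    · simp at hj
    · rw [toggle_ins_succAbove] at hj
      exact ⟨k, (ins_inj.1 hj).2⟩
  · rintro ⟨j, rfl⟩
    exact ⟨i.succAbove j, by simp⟩

theorem half_subset {F : Finset (Sym2 (Fin (m + 1) → Bool))}
    (hF : EdgeFaults F) (i : Fin (m + 1)) (β : Bool) :
    EdgeFaults (half F i β) := by
  intro e he
  induction e with
  | _ v w =>
    have := hF (mk_mem_half.1 he)
    rw [mem_edgeSet] at this ⊢
    exact adj_ins_iff.1 this

theorem map_ins_injective (i : Fin (m + 1)) (β : Bool) : Function.Injective (Sym2.map (ins i β)) :=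
  Sym2.map.injective (ins_injective i β)

private theorem not_map_ins_eq_cross {i : Fin (m + 1)} {β : Bool} {e : Sym2 (Fin m → Bool)}
    {w : Fin m → Bool} : e.map (ins i β) ≠ s(ins i false w, ins i true w) := by
  induction e with
  | _ u v => cases β <;> simp

private theorem map_ins_true_ne_false {i : Fin (m + 1)} {e e' : Sym2 (Fin m → Bool)} :
    e.map (ins i true) ≠ e'.map (ins i false) := by
  induction e with
  | _ u v =>
    induction e' with
    | _ u' v' => simp

theorem edge_cases {F : Finset (Sym2 (Fin (m + 1) → Bool))}
    (hF : EdgeFaults F) (i : Fin (m + 1))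
    {e : Sym2 (Fin (m + 1) → Bool)} (he : e ∈ F) :
    (∃ β, ∃ e' ∈ half F i β, e = e'.map (ins i β)) ∨
      ∃ w ∈ cross F i, e = s(ins i false w, ins i true w) := by
  induction e with
  | _ v w =>
    have h := hF he
    rw [mem_edgeSet, Q_adj] at h
    obtain ⟨j, rfl⟩ := h
    obtain ⟨β, v, rfl⟩ := exists_eq_ins i v
    rcases Fin.eq_self_or_eq_succAbove i j with rfl | ⟨k, rfl⟩
    · right
      rw [toggle_ins_same] at he ⊢
      refine ⟨v, (mem_cross β).1 he, ?_⟩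
      cases β <;> simp [Sym2.eq_swap]
    · left
      rw [toggle_ins_succAbove] at he ⊢
      exact ⟨β, s(v, toggle v k), by simpa using he, rfl⟩

theorem card_eq (F : Finset (Sym2 (Fin (m + 1) → Bool)))
    (hF : EdgeFaults F) (i : Fin (m + 1)) :
    F.card = (half F i false).card + (half F i true).card + (cross F i).card := by
  have hinj : Function.Injective fun w : Fin m → Bool => s(ins i false w, ins i true w) := by
    intro v w h
    simpa using h
  have : F = ((half F i false).image (Sym2.map (ins i false)) ∪
      (half F i true).image (Sym2.map (ins i true))) ∪
      (cross F i).image fun w => s(ins i false w, ins i true w) := by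
    ext e
    constructor
    · intro he
      rcases edge_cases hF i he with ⟨β, e', he', rfl⟩ | ⟨w, hw, rfl⟩
      · cases β
        · exact mem_union_left _ (mem_union_left _ (mem_image_of_mem _ he'))
        · exact mem_union_left _ (mem_union_right _ (mem_image_of_mem _ he'))
      · exact mem_union_right _ (mem_image_of_mem _ hw)
    · simp only [mem_union, mem_image, half, cross, mem_filter, mem_univ, true_and]
      rintro ((⟨e, h, rfl⟩ | ⟨e, h, rfl⟩) | ⟨e, h, rfl⟩) <;> exact h
  conv_lhs => rw [this]
  rw [card_union_of_disjoint, card_union_of_disjoint, card_image_of_injective _ (map_ins_injective i _),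
    card_image_of_injective _ (map_ins_injective i _), card_image_of_injective _ hinj]
  · rw [Finset.disjoint_left]
    simp only [mem_image]
    rintro _ ⟨e, -, rfl⟩ ⟨e', -, h⟩
    exact map_ins_true_ne_false h
  · rw [Finset.disjoint_left]
    simp only [mem_union, mem_image]
    rintro _ (⟨e, -, rfl⟩ | ⟨e, -, rfl⟩) ⟨e', -, h⟩
    · exact not_map_ins_eq_cross h.symm
    · exact not_map_ins_eq_cross h.symm

theorem card_eq' (F : Finset (Sym2 (Fin (m + 1) → Bool)))
    (hF : EdgeFaults F) (i : Fin (m + 1)) (β : Bool) :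
    F.card = (half F i β).card + (half F i !β).card + (cross F i).card := by
  rw [card_eq F hF i]
  cases β
  · rfl
  · simp [add_comm (half F i false).card]

/-- The directions of the faulty edges at `v`. -/
noncomputable def dirs (F : Finset (Sym2 (Fin n → Bool))) (v : Fin n → Bool) : Finset (Fin n) :=
  univ.filter fun i => s(v, toggle v i) ∈ F

@[simp] theorem mem_dirs {F : Finset (Sym2 (Fin n → Bool))} {v : Fin n → Bool} {i : Fin n} :
    i ∈ dirs F v ↔ s(v, toggle v i) ∈ F := by
  simp [dirs]

theorem faultyDeg_eq (F : Finset (Sym2 (Fin n → Bool))) (v : Fin n → Bool) :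
    faultyDeg F v + (dirs F v).card = n := by
  have h : ((FQ F).neighborSet v) = ↑((dirs F v)ᶜ.image (toggle v)) := by
    ext w
    simp only [mem_neighborSet, FQ_adj, Q_adj, coe_image, Set.mem_image, mem_coe, mem_compl,
      mem_dirs]
    constructor
    · rintro ⟨⟨i, rfl⟩, h⟩
      exact ⟨i, h, rfl⟩
    · rintro ⟨i, h, rfl⟩
      exact ⟨⟨i, rfl⟩, h⟩
  have h2 : faultyDeg F v = (dirs F v)ᶜ.card := by
    rw [faultyDeg]
    refine (congrArg Set.ncard h).trans ?_
    rw [Set.ncard_coe_finset, card_image_of_injective _ fun i j h => toggle_inj.1 h]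
  have h3 := card_add_card_compl (dirs F v)
  rw [Fintype.card_fin] at h3
  omega

theorem mem_dirs_ins_same {F : Finset (Sym2 (Fin (m + 1) → Bool))} {i : Fin (m + 1)} {β : Bool}
    {v : Fin m → Bool} : i ∈ dirs F (ins i β v) ↔ v ∈ cross F i := by
  rw [mem_dirs, toggle_ins_same, mem_cross]

theorem mem_dirs_ins_succAbove {F : Finset (Sym2 (Fin (m + 1) → Bool))} {i : Fin (m + 1)} {β : Bool}
    {v : Fin m → Bool} {j : Fin m} :
    i.succAbove j ∈ dirs F (ins i β v) ↔ j ∈ dirs (half F i β) v := by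
  rw [mem_dirs, toggle_ins_succAbove, mem_dirs, mk_mem_half]

theorem card_dirs_ins (F : Finset (Sym2 (Fin (m + 1) → Bool))) (i : Fin (m + 1)) (β : Bool)
    (v : Fin m → Bool) :
    (dirs F (ins i β v)).card = (dirs (half F i β) v).card + if v ∈ cross F i then 1 else 0 := by
  have h : dirs F (ins i β v) = (dirs (half F i β) v).map i.succAboveEmb ∪
      if v ∈ cross F i then {i} else ∅ := by
    ext j
    rcases Fin.eq_self_or_eq_succAbove i j with rfl | ⟨k, rfl⟩
    · rw [mem_dirs_ins_same]
      split_ifs with h <;> simp [h, Fin.succAbove_ne]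
    · rw [mem_dirs_ins_succAbove]
      split_ifs <;> simp [Fin.succAbove_ne, -mem_dirs]
  rw [h, card_union_of_disjoint, card_map]
  · split_ifs <;> simp
  · split_ifs <;> simp [Fin.succAbove_ne]

theorem PathOn.lift {F : Finset (Sym2 (Fin (m + 1) → Bool))} {i : Fin (m + 1)} {β : Bool}
    {S : Set (Fin m → Bool)} {a b : Fin m → Bool} (h : PathOn (FQ (half F i β)) S a b) :
    PathOn (FQ F) (ins i β '' S) (ins i β a) (ins i β b) := by
  refine h.map (ins i β) (ins_injective i β) fun u v huv => ?_
  rw [FQ_adj] at huv ⊢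
  rw [adj_ins_iff]
  rwa [mk_mem_half] at huv

theorem FQ_adj_cross {F : Finset (Sym2 (Fin (m + 1) → Bool))} {i : Fin (m + 1)} {v : Fin m → Bool}
    (h : v ∉ cross F i) (β : Bool) : (FQ F).Adj (ins i β v) (ins i (!β) v) := by
  rw [FQ_adj, mem_cross]
  refine ⟨?_, h⟩
  rw [← toggle_ins_same]
  exact Q_adj_toggle _ _

theorem FQ_adj_cross' {F : Finset (Sym2 (Fin (m + 1) → Bool))} {i : Fin (m + 1)} {v : Fin m → Bool}
    (h : v ∉ cross F i) (β : Bool) : (FQ F).Adj (ins i (!β) v) (ins i β v) :=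
  (FQ_adj_cross h β).symm

theorem PathOn.SplitAt.par_right {F : Finset (Sym2 (Fin n → Bool))} {S₁ S₂ S : Set (Fin n → Bool)}
    {a b u v : Fin n → Bool} (h : PathOn.SplitAt (FQ F) S a b u v S₁ S₂) : par v = !par u :=
  FQ_adj_par h.2.1

end Faults

section Laceable

variable {n m : ℕ}

/-- Any two vertices of opposite parity are joined by a fault-free Hamiltonian path. -/
def Laceable (F : Finset (Sym2 (Fin n → Bool))) : Prop :=
  ∀ x y, par x ≠ par y → PathOn (FQ F) Set.univ x y

/-- Any two disjoint pairs of vertices of opposite parity are joined by two disjoint fault-free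
paths which together cover the hypercube. -/
def PairedCoverable (F : Finset (Sym2 (Fin n → Bool))) : Prop :=
  ∀ a b c d, par a ≠ par b → par c ≠ par d → a ≠ c → a ≠ d → b ≠ c → b ≠ d →
    ∃ S, PathOn (FQ F) S a b ∧ PathOn (FQ F) Sᶜ c d

/-- After the removal of any vertex, any two vertices of the other parity are joined by a fault-free
Hamiltonian path. -/
def HyperLaceable (F : Finset (Sym2 (Fin n → Bool))) : Prop :=
  ∀ v a c, par a ≠ par v → par c ≠ par v → a ≠ c → PathOn (FQ F) {v}ᶜ a c

/-- A path in one half can be enlarged to cover also the other half. -/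
theorem PathOn.insert_half {F : Finset (Sym2 (Fin (m + 1) → Bool))} {i : Fin (m + 1)} {β : Bool}
    {S : Set (Fin m → Bool)} {a b : Fin m → Bool} (h : PathOn (FQ (half F i β)) S a b)
    (hL : Laceable (half F i !β)) (hC : 2 * (cross F i).card + 1 < S.ncard) :
    PathOn (FQ F) (ins i β '' S ∪ ins i (!β) '' Set.univ) (ins i β a) (ins i β b) := by
  obtain ⟨u, v, S₁, S₂, hu, hv, hsp⟩ := h.exists_split _ hC
  have hp := hsp.par_right
  obtain ⟨P₁, hadj, P₂, hS, hd⟩ := hsp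
  have Q₁ := (hL u v (by rw [hp]; simp)).lift
  refine ((P₁.lift.append (FQ_adj_cross hu β) Q₁ ?_).append (FQ_adj_cross' hv β) P₂.lift ?_).congr ?_
  all_goals
    intro w
    obtain ⟨z, rfl | rfl⟩ := exists_eq_ins_or i β w <;> have := hS z <;> have := hd z <;> simp <;>
      tauto

theorem laceable_of_halves {F : Finset (Sym2 (Fin (m + 1) → Bool))} (i : Fin (m + 1))
    (hL : ∀ β, Laceable (half F i β)) (hC : 2 * (cross F i).card + 1 < 2 ^ m) : Laceable F := by
  intro x y hxy
  obtain ⟨β, x, rfl⟩ := exists_eq_ins i x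
  obtain ⟨y, rfl | rfl⟩ := exists_eq_ins_or i β y
  · have hxy' : par x ≠ par y := by simpa using hxy
    refine ((hL β x y hxy').insert_half (hL !β) (by rwa [ncard_univ_cube])).congr fun w => ?_
    obtain ⟨z, rfl | rfl⟩ := exists_eq_ins_or i β w <;> simp
  · have hxy' : par x = par y := by
      revert hxy
      cases β <;> cases h1 : par x <;> cases h2 : par y <;> simp [h1, h2]
    have hm : (cross F i).card < 2 ^ (m - 1) ∧ 1 ≤ m := by
      obtain _ | m := m
      · omega
      · rw [pow_succ] at hC
        simp only [Nat.add_sub_cancel]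
        omega
    obtain ⟨m, rfl⟩ := Nat.exists_eq_add_of_le' hm.2
    obtain ⟨s, hs, hs'⟩ := exists_par_eq _ hm.1 (!par x)
    have P := (hL β x s (by rw [hs']; simp)).lift
    have P' := (hL (!β) s y (by rw [hs', hxy']; simp)).lift
    refine (P.append (FQ_adj_cross hs β) P' ?_).congr ?_
    all_goals
      intro w
      obtain ⟨z, rfl | rfl⟩ := exists_eq_ins_or i β w <;> simp

theorem exists_mem_cross {F : Finset (Sym2 (Fin (m + 1) → Bool))} (hF : EdgeFaults F)
    (h : F.Nonempty) : ∃ i, (cross F i).Nonempty := by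
  obtain ⟨e, he⟩ := h
  induction e with
  | _ v w =>
    have h := hF he
    rw [mem_edgeSet, Q_adj] at h
    obtain ⟨i, rfl⟩ := h
    obtain ⟨β, v, rfl⟩ := exists_eq_ins i v
    exact ⟨i, v, (mem_cross β).1 (by simpa using he)⟩

theorem card_half_add_cross_le {F : Finset (Sym2 (Fin (m + 1) → Bool))} (hF : EdgeFaults F)
    (i : Fin (m + 1)) (β : Bool) : (half F i β).card + (cross F i).card ≤ F.card := by
  rw [card_eq' F hF i β]
  omega

/-- A direction in which there is a fault, if there is any. -/
theorem exists_direction {F : Finset (Sym2 (Fin (m + 1) → Bool))} (hF : EdgeFaults F) :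
    ∃ i, ∀ β, (half F i β).card ≤ F.card - 1 := by
  by_cases h : F.Nonempty
  · obtain ⟨i, hi⟩ := exists_mem_cross hF h
    refine ⟨i, fun β => ?_⟩
    have := card_half_add_cross_le hF i β
    have := hi.card_pos
    omega
  · refine ⟨0, fun β => ?_⟩
    have := card_half_add_cross_le hF 0 β
    rw [not_nonempty_iff_eq_empty] at h
    simp_all

theorem two_mul_add_lt_two_pow (m : ℕ) (hm : 4 ≤ m) : 2 * m + 4 ≤ 2 ^ m := by
  induction m, hm using Nat.le_induction with
  | base => norm_num
  | succ m hm ih => rw [pow_succ]; omega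

theorem laceable_of_card_le (n : ℕ) (hn : 1 ≤ n) (F : Finset (Sym2 (Fin n → Bool)))
    (hF : EdgeFaults F) (hc : F.card ≤ n - 2) : Laceable F := by
  induction n, hn using Nat.le_induction with
  | base =>
    have hF0 : F = ∅ := by simpa using hc
    subst hF0
    intro x y hxy
    have hadj : (FQ (∅ : Finset (Sym2 (Fin 1 → Bool)))).Adj x y := by
      rw [FQ_adj, Q_adj]
      refine ⟨⟨0, ?_⟩, by simp⟩
      ext j
      obtain rfl := Subsingleton.elim j 0
      rw [toggle_same]
      by_contra h
      apply hxy
      congr 1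
      ext j
      obtain rfl := Subsingleton.elim j 0
      cases h1 : x 0 <;> cases h2 : y 0 <;> simp_all
    have hne : x ≠ y := fun h => hxy (h ▸ rfl)
    refine ((PathOn.single _ x).append hadj (PathOn.single _ y) (by simpa using hne)).congr ?_
    intro z
    have h0 : x 0 ≠ y 0 := by
      intro h
      apply hne
      ext j
      obtain rfl := Subsingleton.elim j 0
      exact h
    have : z 0 = x 0 ∨ z 0 = y 0 := by
      cases h1 : x 0 <;> cases h2 : y 0 <;> cases h3 : z 0 <;> simp_all
    have hz : z = x ∨ z = y := by
      rcases this with h | h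
      · left; ext j; obtain rfl := Subsingleton.elim j 0; exact h
      · right; ext j; obtain rfl := Subsingleton.elim j 0; exact h
    simpa [or_comm] using hz
  | succ m hm ih =>
    obtain ⟨i, hi⟩ := exists_direction hF
    refine laceable_of_halves i (fun β => ih _ (half_subset hF i β) ?_) ?_
    · have := hi β
      omega
    · have := card_half_add_cross_le hF i true
      have h4 := two_mul_add_lt_two_pow m
      have : m ≤ 3 ∨ 4 ≤ m := by omega
      rcases this with h | h
      · interval_cases m <;> omega
      · have := h4 h
        omega

end Laceable

section ThreeCube

/-- The vertex of the 3-cube whose coordinates are the binary digits of `k`. -/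
def decode (k : ℕ) : Fin 3 → Bool := fun i => k.testBit i

/-- Whether `k` and `l` differ in exactly one of the three lowest binary digits. -/
def codeAdj (k l : ℕ) : Bool := [1, 2, 4].contains (k ^^^ l)

/-- Whether `k` has an odd number of ones among its three lowest binary digits. -/
def codePar (k : ℕ) : Bool := k.testBit 0 ^^ (k.testBit 1 ^^ k.testBit 2)

/-- The list of all paths from `k` to `t` which avoid `vis`, for codes of vertices of the 3-cube. -/
def codePaths (t : ℕ) : ℕ → ℕ → List ℕ → List (List ℕ)
  | 0, _, _ => []
  | f + 1, k, vis =>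
    if k = t then [[k]] else
      [1, 2, 4].flatMap fun d =>
        if vis.contains (k ^^^ d) then [] else
          (codePaths t f (k ^^^ d) ((k ^^^ d) :: vis)).map (k :: ·)

/-- Whether consecutive entries of a list are codes of adjacent vertices. -/
def codeChain : List ℕ → Bool
  | [] => true
  | [_] => true
  | k :: l :: r => codeAdj k l && codeChain (l :: r)

/-- Whether the list has no repeated entries. -/
def codeNodup : List ℕ → Bool
  | [] => true
  | k :: r => !r.contains k && codeNodup r

/-- Whether `l` is a path from `a` to `b` in the 3-cube. -/
def codePath (l : List ℕ) (a b : ℕ) : Bool :=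
  l.head? == some a && (l.getLast? == some b && (codeChain l && codeNodup l))

theorem exists_decode (v : Fin 3 → Bool) : ∃ k < 8, v = decode k := by
  revert v; decide

theorem decode_inj {k l : ℕ} (hk : k < 8) (hl : l < 8) (h : decode k = decode l) : k = l := by
  have : ∀ k < 8, ∀ l < 8, decode k = decode l → k = l := by decide
  exact this k hk l hl h

theorem mem_of_decode {l : List ℕ} (hl : ∀ k ∈ l, k < 8) {k : ℕ} (hk : k < 8) :
    (∃ j ∈ l, decode k = decode j) ↔ k ∈ l := by
  refine ⟨?_, fun h => ⟨k, h, rfl⟩⟩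
  rintro ⟨j, hj, h⟩
  exact decode_inj hk (hl j hj) h ▸ hj

theorem par_decode {k : ℕ} (hk : k < 8) : par (decode k) = codePar k := by
  simp only [par, qparity, Fin.sum_univ_three]
  revert k
  decide

theorem Q_adj_decode {k l : ℕ} (hk : k < 8) (hl : l < 8) (h : codeAdj k l) :
    (Q 3).Adj (decode k) (decode l) := by
  rw [Q_adj]
  have : ∀ k < 8, ∀ l < 8, codeAdj k l = true → ∃ i, decode l = toggle (decode k) i := by decide
  exact this k hk l hl h

theorem pathOn_decode {l : List ℕ} {a b : ℕ} (hl : ∀ k ∈ l, k < 8) (h : codePath l a b) :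
    PathOn (FQ (∅ : Finset (Sym2 (Fin 3 → Bool)))) {v | ∃ k ∈ l, v = decode k} (decode a)
      (decode b) := by
  simp only [codePath, Bool.and_eq_true, beq_iff_eq] at h
  obtain ⟨h1, h2, h3, h4⟩ := h
  refine ⟨l.map decode, ?_, ?_, ?_, by simp [h1], by simp [h2]⟩
  · clear h1 h2 h4
    induction l with
    | nil => simp
    | cons k r ih =>
      cases r with
      | nil => simp
      | cons k' r =>
        simp only [codeChain, Bool.and_eq_true] at h3
        simp only [List.map_cons, List.isChain_cons_cons]
        refine ⟨FQ_adj.2 ⟨Q_adj_decode (hl k (by simp)) (hl k' (by simp)) h3.1, by simp⟩, ?_⟩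
        exact ih (fun j hj => hl j (List.mem_cons_of_mem _ hj)) h3.2
  · clear h1 h2 h3
    induction l with
    | nil => simp
    | cons k r ih =>
      simp only [codeNodup, Bool.and_eq_true, Bool.not_eq_true', List.contains_eq_mem,
        decide_eq_false_iff_not] at h4
      simp only [List.map_cons, List.nodup_cons, List.mem_map]
      refine ⟨?_, ih (fun j hj => hl j (List.mem_cons_of_mem _ hj)) h4.2⟩
      rintro ⟨j, hj, hjk⟩
      exact h4.1 (decode_inj (hl j (by simp [hj])) (hl k (by simp)) hjk ▸ hj)
  · intro v
    simp only [List.mem_map, Set.mem_ofPred_eq, eq_comm]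

/-- Exhaustive search for paired covers of the 3-cube. -/
def checkPaired : Bool :=
  (List.range 8).all fun a => (List.range 8).all fun b => codePar a == codePar b ||
    (List.range 8).all fun c => c == a || (c == b || (List.range 8).all fun d =>
      codePar c == codePar d || (d == a || (d == b ||
        (codePaths b 8 a [a, c, d]).any fun l => (codePaths d 8 c (c :: l)).any fun r =>
          (codePath l a b && codePath r c d) && ((l.all (· < 8) && r.all (· < 8)) &&
            (List.range 8).all fun k => l.contains k != r.contains k))))

/-- Exhaustive search for Hamiltonian paths in the 3-cube minus a vertex. -/
def checkHyper : Bool :=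
  (List.range 8).all fun v => (List.range 8).all fun a => codePar a == codePar v ||
    (List.range 8).all fun c => codePar c == codePar v || (c == a ||
      (codePaths c 8 a [a, v]).any fun l => codePath l a c && (l.all (· < 8) &&
        (List.range 8).all fun k => l.contains k != (k == v)))

theorem checkPaired_eq : checkPaired = true := by decide +kernel

theorem checkHyper_eq : checkHyper = true := by decide +kernel

theorem pairedCoverable_three : PairedCoverable (∅ : Finset (Sym2 (Fin 3 → Bool))) := by
  intro a b c d hab hcd hac had hbc hbd
  obtain ⟨a, ha, rfl⟩ := exists_decode a
  obtain ⟨b, hb, rfl⟩ := exists_decode b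
  obtain ⟨c, hc, rfl⟩ := exists_decode c
  obtain ⟨d, hd, rfl⟩ := exists_decode d
  rw [par_decode ha, par_decode hb] at hab
  rw [par_decode hc, par_decode hd] at hcd
  have h := checkPaired_eq
  simp only [checkPaired, List.all_eq_true, List.mem_range, Bool.or_eq_true, beq_iff_eq,
    List.any_eq_true, Bool.and_eq_true, decide_eq_true_eq, bne_iff_ne] at h
  obtain ⟨l, -, r, -, ⟨h1, h2⟩, ⟨h3, h4⟩, h5⟩ := (((((((h a ha b hb).resolve_left hab) c
    hc).resolve_left (by rintro rfl; exact hac rfl)).resolve_left (by rintro rfl; exact hbc rfl)) d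
    hd).resolve_left hcd |>.resolve_left (by rintro rfl; exact had rfl)).resolve_left
      (by rintro rfl; exact hbd rfl)
  refine ⟨_, pathOn_decode h3 h1, (pathOn_decode h4 h2).congr ?_⟩
  intro v
  obtain ⟨k, hk, rfl⟩ := exists_decode v
  have := h5 k hk
  simp only [Set.mem_ofPred_eq, Set.mem_compl_iff, mem_of_decode h3 hk, mem_of_decode h4 hk]
  simp only [List.contains_eq_mem, ne_eq, decide_eq_decide] at this
  tauto

theorem hyperLaceable_three : HyperLaceable (∅ : Finset (Sym2 (Fin 3 → Bool))) := by
  intro v a c hav hcv hac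
  obtain ⟨v, hv, rfl⟩ := exists_decode v
  obtain ⟨a, ha, rfl⟩ := exists_decode a
  obtain ⟨c, hc, rfl⟩ := exists_decode c
  rw [par_decode ha, par_decode hv] at hav
  rw [par_decode hc, par_decode hv] at hcv
  have h := checkHyper_eq
  simp only [checkHyper, List.all_eq_true, List.mem_range, Bool.or_eq_true, beq_iff_eq,
    List.any_eq_true, Bool.and_eq_true, decide_eq_true_eq, bne_iff_ne] at h
  obtain ⟨l, -, h1, h3, h5⟩ := (((h v hv a ha).resolve_left hav) c
    hc).resolve_left hcv |>.resolve_left (by rintro rfl; exact hac rfl)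
  refine (pathOn_decode h3 h1).congr ?_
  intro w
  obtain ⟨k, hk, rfl⟩ := exists_decode w
  have hkv : decode k = decode v ↔ k = v := ⟨decode_inj hk hv, fun h => h ▸ rfl⟩
  have := h5 k hk
  simp only [Set.mem_ofPred_eq, Set.mem_compl_iff, mem_of_decode h3 hk, Set.mem_singleton_iff, hkv]
  by_cases h1 : k ∈ l <;> by_cases h2 : k = v <;> simp_all

end ThreeCube

section Covers

variable {n m : ℕ}

/-- The two pairs `a, b` and `c, d` are joined by disjoint fault-free paths covering the cube. -/
def Covers (F : Finset (Sym2 (Fin n → Bool))) (a b c d : Fin n → Bool) : Prop :=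
  ∃ S, PathOn (FQ F) S a b ∧ PathOn (FQ F) Sᶜ c d

theorem Covers.swap {F : Finset (Sym2 (Fin n → Bool))} {a b c d : Fin n → Bool}
    (h : Covers F a b c d) : Covers F c d a b := by
  obtain ⟨S, h1, h2⟩ := h
  exact ⟨Sᶜ, h2, by rwa [compl_compl]⟩

theorem Covers.symm_left {F : Finset (Sym2 (Fin n → Bool))} {a b c d : Fin n → Bool}
    (h : Covers F a b c d) : Covers F b a c d := by
  obtain ⟨S, h1, h2⟩ := h
  exact ⟨S, h1.symm, h2⟩

theorem Covers.symm_right {F : Finset (Sym2 (Fin n → Bool))} {a b c d : Fin n → Bool}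
    (h : Covers F a b c d) : Covers F a b d c := by
  obtain ⟨S, h1, h2⟩ := h
  exact ⟨S, h1, h2.symm⟩

theorem bool_not_xor_ne {β x y : Bool} (h : (β ^^ x) ≠ ((!β) ^^ y)) : x = y := by
  revert h; revert β x y; decide

theorem bool_xor_ne_not {β x y : Bool} (h : ((!β) ^^ x) ≠ (β ^^ y)) : x = y := by
  revert h; revert β x y; decide

theorem bool_xor_ne {β x y : Bool} (h : (β ^^ x) ≠ (β ^^ y)) : x ≠ y := fun e => h (e ▸ rfl)

/-- Choosing a vertex of given parity outside `A` and different from two given vertices. -/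
theorem exists_par_eq_of_pair (A : Finset (Fin (m + 1) → Bool)) (hA : A.card + 2 < 2 ^ m)
    (p q : Fin (m + 1) → Bool) (β : Bool) : ∃ v, v ∉ A ∧ v ≠ p ∧ v ≠ q ∧ par v = β := by
  obtain ⟨v, hv, hp⟩ := exists_par_eq (insert p (insert q A))
    (by have := card_insert_le q A; have := card_insert_le p (insert q A); omega) β
  simp only [mem_insert, not_or] at hv
  exact ⟨v, hv.2.2, hv.1, hv.2.1, hp⟩

variable {F : Finset (Sym2 (Fin (m + 1 + 1) → Bool))} {i : Fin (m + 1 + 1)} {β : Bool}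
  {a b c d : Fin (m + 1) → Bool}

theorem covers_of_all_same (hD : PairedCoverable (half F i β)) (hL : Laceable (half F i !β))
    (hC : 2 * (cross F i).card + 1 < 2 ^ m) (hab : par a ≠ par b) (hcd : par c ≠ par d)
    (hac : a ≠ c) (had : a ≠ d) (hbc : b ≠ c) (hbd : b ≠ d) :
    Covers F (ins i β a) (ins i β b) (ins i β c) (ins i β d) := by
  obtain ⟨S, P, P'⟩ := hD a b c d hab hcd hac had hbc hbd
  have hS : S.ncard + Sᶜ.ncard = 2 ^ m * 2 := by
    rw [Set.ncard_add_ncard_compl, Nat.card_eq_fintype_card]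
    simp [pow_succ]
  rcases Nat.lt_or_ge (2 * (cross F i).card + 1) S.ncard with h | h
  · refine ⟨_, P.insert_half hL h, P'.lift.congr fun w => ?_⟩
    obtain ⟨z, rfl | rfl⟩ := exists_eq_ins_or i β w <;> simp
  · refine Covers.swap ⟨_, P'.insert_half hL (by omega), P.lift.congr fun w => ?_⟩
    obtain ⟨z, rfl | rfl⟩ := exists_eq_ins_or i β w <;> simp

theorem covers_of_three_one (hD : PairedCoverable (half F i β)) (hL : Laceable (half F i !β))
    (hC : (cross F i).card + 2 < 2 ^ m) (hab : par a ≠ par b) (hcd : par c = par d)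
    (hac : a ≠ c) (hbc : b ≠ c) :
    Covers F (ins i β a) (ins i β b) (ins i β c) (ins i (!β) d) := by
  obtain ⟨s, hs, hsa, hsb, hp⟩ := exists_par_eq_of_pair _ hC a b (!par c)
  obtain ⟨S, P, P'⟩ := hD a b c s hab (by simp [hp]) hac hsa.symm hbc hsb.symm
  have P'' := (hL s d (by simp [hp, hcd])).lift
  refine ⟨_, P.lift, (P'.lift.append (FQ_adj_cross hs β) P'' ?_).congr ?_⟩
  all_goals
    intro w
    obtain ⟨z, rfl | rfl⟩ := exists_eq_ins_or i β w <;> simp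

theorem covers_of_two_two (hL : ∀ β, Laceable (half F i β)) (hab : par a ≠ par b)
    (hcd : par c ≠ par d) : Covers F (ins i β a) (ins i β b) (ins i (!β) c) (ins i (!β) d) := by
  refine ⟨_, (hL _ a b hab).lift, (hL _ c d hcd).lift.congr fun w => ?_⟩
  obtain ⟨z, rfl | rfl⟩ := exists_eq_ins_or i β w <;> simp

theorem covers_of_split (hD : ∀ β, PairedCoverable (half F i β))
    (hC : (cross F i).card + 2 < 2 ^ m) (hab : par a = par b) (hcd : par c = par d)
    (hac : a ≠ c) (hbd : b ≠ d) :
    Covers F (ins i β a) (ins i (!β) b) (ins i β c) (ins i (!β) d) := by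
  obtain ⟨s, hs, hsc, hsd, hp⟩ := exists_par_eq_of_pair _ hC c d (!par a)
  obtain ⟨t, ht, hta, htb, hst, hp'⟩ : ∃ t, t ∉ cross F i ∧ t ≠ a ∧ t ≠ b ∧ t ≠ s ∧
      par t = !par c := by
    by_cases h : par a = par c
    · obtain ⟨t, ht, hts, -, hp'⟩ := exists_par_eq_of_pair _ hC s s (!par c)
      refine ⟨t, ht, ?_, ?_, hts, hp'⟩
      · rintro rfl; simp [← h] at hp'
      · rintro rfl; simp [← h, hab] at hp'
    · obtain ⟨t, ht, hta, htb, hp'⟩ := exists_par_eq_of_pair _ hC a b (!par c)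
      refine ⟨t, ht, hta, htb, ?_, hp'⟩
      rintro rfl
      rw [hp, Bool.not_inj_iff] at hp'
      exact h hp'
  obtain ⟨S, P₁, P₂⟩ := hD β a s c t (by simp [hp]) (by simp [hp']) hac hta.symm hsc hst.symm
  obtain ⟨T, R₁, R₂⟩ := hD (!β) s b t d (by simp [hp, hab]) (by simp [hp', hcd]) hst.symm hsd
    htb.symm hbd
  refine ⟨_, P₁.lift.append (FQ_adj_cross hs β) R₁.lift ?_,
    (P₂.lift.append (FQ_adj_cross ht β) R₂.lift ?_).congr ?_⟩
  all_goals
    intro w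
    obtain ⟨z, rfl | rfl⟩ := exists_eq_ins_or i β w <;> simp

theorem pairedCoverable_of_halves (hD : ∀ β, PairedCoverable (half F i β))
    (hL : ∀ β, Laceable (half F i β)) (hC : 2 * (cross F i).card + 1 < 2 ^ m)
    (hC' : (cross F i).card + 2 < 2 ^ m) : PairedCoverable F := by
  intro a b c d hab hcd hac had hbc hbd
  change Covers F a b c d
  obtain ⟨β, a, rfl⟩ := exists_eq_ins i a
  obtain ⟨b, rfl | rfl⟩ := exists_eq_ins_or i β b <;>
  obtain ⟨c, rfl | rfl⟩ := exists_eq_ins_or i β c <;>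
  obtain ⟨d, rfl | rfl⟩ := exists_eq_ins_or i β d <;>
  simp only [par_ins] at hab hcd <;>
  simp only [ne_eq, ins_inj, true_and, Bool.eq_not_self, Bool.not_eq_self, false_and,
    not_false_eq_true] at hac had hbc hbd
  · exact covers_of_all_same (hD β) (hL _) hC (bool_xor_ne hab) (bool_xor_ne hcd) hac had hbc hbd
  · exact covers_of_three_one (hD β) (hL _) hC' (bool_xor_ne hab) (bool_not_xor_ne hcd) hac hbc
  · exact (covers_of_three_one (hD β) (hL _) hC' (bool_xor_ne hab) (bool_xor_ne_not hcd).symm had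
      hbd).symm_right
  · exact covers_of_two_two hL (bool_xor_ne hab) (bool_xor_ne hcd)
  · exact (covers_of_three_one (hD β) (hL _) hC' (bool_xor_ne hcd) (bool_not_xor_ne hab)
      (Ne.symm hac) (Ne.symm had)).swap
  · exact covers_of_split hD hC' (bool_not_xor_ne hab) (bool_not_xor_ne hcd) hac hbd
  · exact (covers_of_split hD hC' (bool_not_xor_ne hab) (bool_xor_ne_not hcd).symm had
      hbc).symm_right
  · have := covers_of_three_one (β := !β) (hD _) (hL _) hC' (bool_xor_ne hcd)
      (bool_not_xor_ne hab).symm (Ne.symm hbc) (Ne.symm hbd)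
    rw [Bool.not_not] at this
    exact this.swap.symm_left

theorem hyperLaceable_of_halves (hH : ∀ β, HyperLaceable (half F i β))
    (hD : ∀ β, PairedCoverable (half F i β))
    (hL : ∀ β, Laceable (half F i β)) (hC : 2 * (cross F i).card + 1 < 2 ^ m)
    (hC' : (cross F i).card + 2 < 2 ^ m) : HyperLaceable F := by
  have key : ∀ β (v a c : Fin (m + 1) → Bool), par a ≠ par v → par c = par v →
      PathOn (FQ F) {ins i β v}ᶜ (ins i β a) (ins i (!β) c) := by
    intro β v a c hav hcv
    obtain ⟨s, hs, hsa, -, hp⟩ := exists_par_eq_of_pair _ hC' a a (!par v)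
    have P := (hH β v a s hav (by simp [hp]) hsa.symm).lift
    have P' := (hL (!β) s c (by simp [hp, hcv])).lift
    refine (P.append (FQ_adj_cross hs β) P' ?_).congr ?_
    all_goals
      intro w
      obtain ⟨z, rfl | rfl⟩ := exists_eq_ins_or i β w <;> simp
  intro v a c hav hcv hac
  obtain ⟨β, v, rfl⟩ := exists_eq_ins i v
  obtain ⟨a, rfl | rfl⟩ := exists_eq_ins_or i β a <;>
  obtain ⟨c, rfl | rfl⟩ := exists_eq_ins_or i β c <;>
  simp only [par_ins] at hav hcv <;>
  simp only [ne_eq, ins_inj, true_and, Bool.eq_not_self, Bool.not_eq_self, false_and,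
    not_false_eq_true] at hac
  · have hcard : ({v}ᶜ : Set (Fin (m + 1) → Bool)).ncard + 1 = 2 ^ m * 2 := by
      have := Set.ncard_add_ncard_compl ({v} : Set (Fin (m + 1) → Bool))
      rw [Set.ncard_singleton, Nat.card_eq_fintype_card] at this
      simp only [Fintype.card_pi, Fintype.card_bool, prod_const, card_univ, Fintype.card_fin,
        pow_succ] at this
      omega
    refine ((hH β v a c (bool_xor_ne hav) (bool_xor_ne hcv) hac).insert_half (hL _)
      (by omega)).congr fun w => ?_
    obtain ⟨z, rfl | rfl⟩ := exists_eq_ins_or i β w <;> simp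
  · exact key β v a c (bool_xor_ne hav) (bool_xor_ne_not hcv)
  · exact (key β v c a (bool_xor_ne hcv) (bool_xor_ne_not hav)).symm
  · have hav := bool_xor_ne_not hav
    have hcv := bool_xor_ne_not hcv
    obtain ⟨s, hs, -, -, hp⟩ := exists_par_eq_of_pair _ hC' v v (!par v)
    obtain ⟨t, ht, hts, -, hp'⟩ := exists_par_eq_of_pair _ hC' s s (!par v)
    have hne : ∀ {x y : Fin (m + 1) → Bool}, par x = par v → par y = !par v → x ≠ y := by
      rintro x _ h1 h2 rfl
      simp [h1] at h2
    obtain ⟨S, P₁, P₂⟩ := hD (!β) a s t c (by simp [hp, hav]) (by simp [hp', hcv]) (hne hav hp')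
      hac hts.symm (hne hcv hp).symm
    have R := (hH β v s t (by simp [hp]) (by simp [hp']) hts.symm).lift
    refine ((P₁.lift.append (FQ_adj_cross' hs β) R ?_).append (FQ_adj_cross ht β) P₂.lift ?_).congr ?_
    all_goals
      intro w
      obtain ⟨z, rfl | rfl⟩ := exists_eq_ins_or i β w <;> simp <;> tauto

theorem pairedCoverable_and_hyperLaceable (n : ℕ) (hn : 3 ≤ n) (F : Finset (Sym2 (Fin n → Bool)))
    (hF : EdgeFaults F) (hc : F.card ≤ n - 3) : PairedCoverable F ∧ HyperLaceable F := by
  induction n, hn using Nat.le_induction with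
  | base =>
    obtain rfl : F = ∅ := by simpa using hc
    exact ⟨pairedCoverable_three, hyperLaceable_three⟩
  | succ m hm ih =>
    obtain ⟨m, rfl⟩ := Nat.exists_eq_add_of_le' (show 1 ≤ m by omega)
    obtain ⟨i, hi⟩ := exists_direction hF
    have hI := fun β => ih _ (half_subset hF i β) (by have := hi β; omega)
    have hL : ∀ β, Laceable (half F i β) := fun β =>
      laceable_of_card_le _ (by omega) _ (half_subset hF i β) (by have := hi β; omega)
    have h1 := card_half_add_cross_le hF i true
    have h4 := two_mul_add_lt_two_pow m
    have hpow : 2 * (cross F i).card + 1 < 2 ^ m ∧ (cross F i).card + 2 < 2 ^ m := by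
      have : m ≤ 3 ∨ 4 ≤ m := by omega
      rcases this with h | h
      · interval_cases m <;> omega
      · have := h4 h
        omega
    exact ⟨pairedCoverable_of_halves (fun β => (hI β).1) hL hpow.1 hpow.2,
      hyperLaceable_of_halves (fun β => (hI β).2) (fun β => (hI β).1) hL hpow.1 hpow.2⟩

end Covers

section Heal

variable {m : ℕ}

/-- The half `β` has the faulty edge `s(a, b)` but becomes laceable when this edge is repaired,
whereas the other half satisfies all the covering properties. -/
structure Healable (F : Finset (Sym2 (Fin (m + 1 + 1) → Bool))) (i : Fin (m + 1 + 1)) (β : Bool)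
    (a b : Fin (m + 1) → Bool) : Prop where
  adj : (Q (m + 1)).Adj a b
  mem : s(a, b) ∈ half F i β
  left_notMem : a ∉ cross F i
  right_notMem : b ∉ cross F i
  erase : Laceable ((half F i β).erase s(a, b))
  laceable : Laceable (half F i !β)
  paired : PairedCoverable (half F i !β)
  hyper : HyperLaceable (half F i !β)
  cross_lt : (cross F i).card + 2 < 2 ^ m

variable {F : Finset (Sym2 (Fin (m + 1 + 1) → Bool))} {i : Fin (m + 1 + 1)} {β : Bool}
  {a b x y : Fin (m + 1) → Bool}

theorem Healable.symm (h : Healable F i β a b) : Healable F i β b a where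
  adj := h.adj.symm
  mem := by rw [Sym2.eq_swap]; exact h.mem
  left_notMem := h.right_notMem
  right_notMem := h.left_notMem
  erase := by rw [Sym2.eq_swap]; exact h.erase
  laceable := h.laceable
  paired := h.paired
  hyper := h.hyper
  cross_lt := h.cross_lt

theorem Healable.par_eq (h : Healable F i β a b) : par b = !par a := by
  obtain ⟨j, rfl⟩ := Q_adj.1 h.adj
  simp

theorem Healable.ne (h : Healable F i β a b) : a ≠ b := by
  rintro rfl
  simpa using h.par_eq

theorem PathOn.heal_erase {n : ℕ} {F : Finset (Sym2 (Fin n → Bool))} {S : Set (Fin n → Bool)}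
    {a b x y : Fin n → Bool} (h : PathOn (FQ (F.erase s(a, b))) S x y) :
    PathOn (FQ F) S x y ∨ ∃ u v S₁ S₂, s(u, v) = s(a, b) ∧ PathOn (FQ F) S₁ x u ∧
      PathOn (FQ F) S₂ v y ∧ (∀ z, z ∈ S ↔ z ∈ S₁ ∨ z ∈ S₂) ∧ ∀ z, z ∈ S₁ → z ∉ S₂ := by
  refine h.heal fun u v huv => ?_
  rw [FQ_adj] at huv ⊢
  by_cases he : s(u, v) = s(a, b)
  · exact .inr he
  · refine .inl ⟨huv.1, fun hm => huv.2 (mem_erase.2 ⟨he, hm⟩)⟩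

theorem Healable.path_same (h : Healable F i β a b) (hxy : par x ≠ par y) :
    PathOn (FQ F) Set.univ (ins i β x) (ins i β y) := by
  rcases (h.erase x y hxy).heal_erase with P | ⟨u, v, S₁, S₂, he, P₁, P₂, hS, hd⟩
  · have := h.cross_lt
    refine (P.insert_half h.laceable ?_).congr fun w => ?_
    · rw [ncard_univ_cube, pow_succ]
      omega
    · obtain ⟨z, rfl | rfl⟩ := exists_eq_ins_or i β w <;> simp
  · have huv : u ∉ cross F i ∧ v ∉ cross F i ∧ par u ≠ par v := by
      have := h.par_eq
      have := h.left_notMem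
      have := h.right_notMem
      rcases Sym2.eq_iff.1 he with ⟨rfl, rfl⟩ | ⟨rfl, rfl⟩ <;> simp_all
    refine ((P₁.lift.append (FQ_adj_cross huv.1 β) (h.laceable u v huv.2.2).lift ?_).append
      (FQ_adj_cross' huv.2.1 β) P₂.lift ?_).congr ?_
    all_goals
      intro w
      obtain ⟨z, rfl | rfl⟩ := exists_eq_ins_or i β w <;> have := hS z <;> have := hd z <;>
        simp <;> tauto

theorem Healable.path_across (h : Healable F i β a b) (hxy : par x = par y) (hya : y ≠ a)
    (hyb : y ≠ b) : PathOn (FQ F) Set.univ (ins i β x) (ins i (!β) y) := by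
  obtain ⟨s, hs, hsa, hsb, hp⟩ := exists_par_eq_of_pair _ h.cross_lt a b (!par x)
  have hsy : par s ≠ par y := by simp [hp, hxy]
  rcases (h.erase x s (by simp [hp])).heal_erase with P | ⟨u, v, S₁, S₂, he, P₁, P₂, hS, hd⟩
  · refine (P.lift.append (FQ_adj_cross hs β) (h.laceable s y hsy).lift ?_).congr ?_
    all_goals
      intro w
      obtain ⟨z, rfl | rfl⟩ := exists_eq_ins_or i β w <;> simp
  · have huv : u ∉ cross F i ∧ v ∉ cross F i ∧ par u ≠ par v ∧ u ≠ s ∧ u ≠ y ∧ v ≠ s ∧ v ≠ y := by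
      have := h.par_eq
      have := h.left_notMem
      have := h.right_notMem
      rcases Sym2.eq_iff.1 he with ⟨rfl, rfl⟩ | ⟨rfl, rfl⟩ <;> simp_all [eq_comm]
    obtain ⟨hu, hv, hp', hus, huy, hvs, hvy⟩ := huv
    obtain ⟨T, R₁, R₂⟩ := h.paired u v s y hp' hsy hus huy hvs hvy
    refine (((P₁.lift.append (FQ_adj_cross hu β) R₁.lift ?_).append
      (FQ_adj_cross' hv β) P₂.lift ?_).append (FQ_adj_cross hs β) R₂.lift ?_).congr ?_
    all_goals
      intro w
      obtain ⟨z, rfl | rfl⟩ := exists_eq_ins_or i β w <;> have := hS z <;> have := hd z <;>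
        simp <;> tauto

theorem Healable.path_across_left (h : Healable F i β a b) (hxa : par x = par a)
    (hA : (dirs (half F i β) a).card + (cross F i).card < m + 1) :
    PathOn (FQ F) Set.univ (ins i β x) (ins i (!β) a) := by
  obtain ⟨j, hj, hjC⟩ : ∃ j, j ∉ dirs (half F i β) a ∧ toggle a j ∉ cross F i := by
    by_contra! hcon
    have h1 : ((dirs (half F i β) a)ᶜ).card ≤ (cross F i).card :=
      card_le_card_of_injOn (toggle a) (fun j hj => hcon j (by simpa using hj))
        fun j _ k _ hjk => toggle_inj.1 hjk
    have h2 := card_add_card_compl (dirs (half F i β) a)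
    rw [Fintype.card_fin] at h2
    omega
  obtain ⟨s, rfl⟩ : ∃ s, s = toggle a j := ⟨_, rfl⟩
  have hadj : (FQ (half F i β)).Adj a (toggle a j) :=
    FQ_adj.2 ⟨Q_adj_toggle a j, fun hm => hj (mem_dirs.2 hm)⟩
  have hadj' : (FQ F).Adj (ins i β a) (ins i β (toggle a j)) := by
    rw [FQ_adj, adj_ins_iff, ← mk_mem_half]
    rwa [FQ_adj] at hadj
  have hsb : b ≠ toggle a j := by
    rintro rfl
    exact hj (mem_dirs.2 h.mem)
  have hpb := h.par_eq
  generalize hs : toggle a j = s at *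
  have hps : par s = !par a := by rw [← hs, par_toggle]
  rcases (h.erase x s (by simp [hps, hxa])).heal_erase with P | ⟨u, v, S₁, S₂, he, P₁, P₂, hS, hd⟩
  · refine (P.lift.append (FQ_adj_cross hjC β) (h.laceable s a (by simp [hps])).lift ?_).congr ?_
    all_goals
      intro w
      obtain ⟨z, rfl | rfl⟩ := exists_eq_ins_or i β w <;> simp
  · rcases Sym2.eq_iff.1 he with ⟨rfl, rfl⟩ | ⟨rfl, rfl⟩
    · refine ((P₁.lift.append hadj' P₂.symm.lift ?_).append (FQ_adj_cross h.right_notMem β)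
        (h.laceable v u (by simp [hpb])).lift ?_).congr ?_
      all_goals
        intro w
        obtain ⟨z, rfl | rfl⟩ := exists_eq_ins_or i β w <;> have := hS z <;> have := hd z <;>
          simp <;> tauto
    · have R := h.hyper v u s (by simp [hpb]) (by simp [hps]) hsb
      refine (((P₁.lift.append (FQ_adj_cross h.right_notMem β) R.lift ?_).append
        (FQ_adj_cross' hjC β) P₂.symm.lift ?_).append (FQ_adj_cross h.left_notMem β)
        (PathOn.single _ _) ?_).congr ?_
      all_goals
        intro w
        obtain ⟨z, rfl | rfl⟩ := exists_eq_ins_or i β w <;> have := hS z <;> have := hd z <;>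
          simp <;> tauto

theorem Healable.exists_half_path (h : Healable F i β a b) :
    PathOn (FQ (half F i β)) Set.univ a b := by
  rcases (h.erase a b (by simp [h.par_eq])).heal_erase with P | ⟨u, v, S₁, S₂, he, P₁, P₂, hS, hd⟩
  · exact P
  · exfalso
    rcases Sym2.eq_iff.1 he with ⟨rfl, rfl⟩ | ⟨rfl, rfl⟩
    · obtain ⟨z, -, hza, hzb, -⟩ :=
        exists_par_eq_of_pair ∅ (by have := h.cross_lt; simp; omega) u v true
      have h1 := P₁.eq_singleton z
      have h2 := P₂.eq_singleton z
      have := hS z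
      simp_all
    · exact hd _ P₁.left_mem P₂.left_mem

theorem Healable.path_other (h : Healable F i β a b) (hxy : par x ≠ par y)
    (hbad : ¬ (x = a ∧ y = b) ∧ ¬ (x = b ∧ y = a)) :
    PathOn (FQ F) Set.univ (ins i (!β) x) (ins i (!β) y) := by
  have P := h.exists_half_path
  have hpb := h.par_eq
  have key : ∀ {x y}, par x ≠ par y → par x ≠ par a → ¬ (x = b ∧ y = a) →
      PathOn (FQ F) Set.univ (ins i (!β) x) (ins i (!β) y) := by
    intro x y hxy hxa hbad
    have hya : par y = par a := by
      revert hxy hxa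
      cases par x <;> cases par y <;> cases par a <;> simp
    have hne : x ≠ y := fun e => hxy (e ▸ rfl)
    have hay : par b ≠ par y := by simp [hpb, hya]
    by_cases hxb : x = b
    · subst hxb
      have hy : y ≠ a := fun e => hbad ⟨rfl, e⟩
      have R := h.hyper x a y (by simp [hpb]) hxy.symm hy.symm
      refine (((PathOn.single _ _).append (FQ_adj_cross' h.right_notMem β) P.symm.lift ?_).append
        (FQ_adj_cross h.left_notMem β) R.lift ?_).congr ?_
      all_goals
        intro w
        obtain ⟨z, rfl | rfl⟩ := exists_eq_ins_or i β w <;> simp <;> tauto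
    · by_cases hy : y = a
      · subst hy
        have R := h.hyper y x b hxy hay hxb
        refine ((R.lift.append (FQ_adj_cross' h.right_notMem β) P.symm.lift ?_).append
          (FQ_adj_cross h.left_notMem β) (PathOn.single _ _) ?_).congr ?_
        all_goals
          intro w
          obtain ⟨z, rfl | rfl⟩ := exists_eq_ins_or i β w <;> simp <;> tauto
      · obtain ⟨T, R₁, R₂⟩ := h.paired x a b y hxa hay hxb hne h.ne (Ne.symm hy)
        refine ((R₁.lift.append (FQ_adj_cross' h.left_notMem β) P.lift ?_).append
          (FQ_adj_cross h.right_notMem β) R₂.lift ?_).congr ?_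
        all_goals
          intro w
          obtain ⟨z, rfl | rfl⟩ := exists_eq_ins_or i β w <;> simp <;> tauto
  by_cases hxa : par x = par a
  · refine (key hxy.symm (fun e => hxy (hxa.trans e.symm)) fun e => hbad.1 ⟨e.2, e.1⟩).symm
  · exact key hxy hxa hbad.2

theorem Healable.path (h : Healable F i β a b) {x y : Fin (m + 1 + 1) → Bool} (hxy : par x ≠ par y)
    (hA : ∀ z, z = a ∨ z = b → (x = ins i (!β) z ∨ y = ins i (!β) z) →
      (dirs (half F i β) z).card + (cross F i).card < m + 1)
    (hbad : ¬ (x = ins i (!β) a ∧ y = ins i (!β) b) ∧ ¬ (x = ins i (!β) b ∧ y = ins i (!β) a)) :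
    PathOn (FQ F) Set.univ x y := by
  have key : ∀ {x y}, par x = par y → (∀ z, z = a ∨ z = b → y = z →
      (dirs (half F i β) z).card + (cross F i).card < m + 1) →
      PathOn (FQ F) Set.univ (ins i β x) (ins i (!β) y) := by
    intro x y hxy hA
    by_cases hya : y = a
    · subst hya
      exact h.path_across_left hxy (hA y (.inl rfl) rfl)
    by_cases hyb : y = b
    · subst hyb
      exact h.symm.path_across_left hxy (hA y (.inr rfl) rfl)
    exact h.path_across hxy hya hyb
  obtain ⟨x, rfl | rfl⟩ := exists_eq_ins_or i β x <;>
  obtain ⟨y, rfl | rfl⟩ := exists_eq_ins_or i β y <;>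
  simp only [par_ins] at hxy
  · exact h.path_same (bool_xor_ne hxy)
  · exact key (bool_not_xor_ne hxy) fun z hz hyz => hA z hz (.inr (hyz ▸ rfl))
  · exact (key (bool_xor_ne_not hxy).symm fun z hz hyz => hA z hz (.inl (hyz ▸ rfl))).symm
  · simp only [ins_inj, true_and] at hbad
    exact h.path_other (bool_xor_ne hxy) hbad

end Heal

section Unhealed

variable {m : ℕ}

@[simp] theorem half_empty (i : Fin (m + 1)) (β : Bool) : half ∅ i β = ∅ := by simp [half]

@[simp] theorem cross_empty (i : Fin (m + 1)) : cross ∅ i = ∅ := by simp [cross]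

private theorem pathOn_compl_edge_aux (hm : 3 ≤ m) (d : Fin (m + 1)) (γ : Bool)
    {z g h : Fin m → Bool} (hgh : par g ≠ par h) (hg : g ≠ z) (hh : h ≠ z) (hgz : par g ≠ par z) :
    PathOn (FQ ∅) {ins d γ z, ins d (!γ) z}ᶜ (ins d γ g) (ins d γ h) := by
  obtain ⟨k, rfl⟩ := Nat.exists_eq_add_of_le' (show 1 ≤ m by omega)
  obtain ⟨hD, hH⟩ := pairedCoverable_and_hyperLaceable (k + 1) hm ∅ (by simp) (by simp)
  have hhz : par h = par z := by
    revert hgh hgz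
    cases par h <;> cases par g <;> cases par z <;> simp
  obtain ⟨t, htg, hp⟩ := exists_par_eq {g} (by rw [card_singleton]; exact Nat.one_lt_two_pow (by omega))
    (!par h)
  rw [mem_singleton] at htg
  have htz : par t ≠ par z := by simp [hp, hhz]
  obtain ⟨S, P₁, P₂⟩ := hD h t g z (by simp [hp]) hgz (fun e => hgh (e ▸ rfl)) hh htg
    (fun e => htz (e ▸ rfl))
  obtain ⟨s, S', P₃, hadj, hz, hS⟩ := P₂.dropLast hg
  have hsz : par s ≠ par z := by rw [FQ_adj_par hadj]; simp
  have hst : s ≠ t := by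
    rintro rfl
    exact ((hS s).2 (.inl P₃.right_mem)) P₁.right_mem
  have R := hH z s t hsz htz hst
  have hC : ∀ w, w ∉ cross (∅ : Finset (Sym2 (Fin (k + 1 + 1) → Bool))) d := by simp
  have L : ∀ {S : Set (Fin (k + 1) → Bool)} {a b} (β : Bool), PathOn (FQ ∅) S a b →
      PathOn (FQ ∅) (ins d β '' S) (ins d β a) (ins d β b) := by
    intro S a b β h
    rw [← half_empty d β] at h
    exact h.lift
  refine (((L γ P₃).append (FQ_adj_cross (hC s) γ) (L (!γ) R) ?_).append (FQ_adj_cross' (hC t) γ)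
    (L γ P₁.symm) ?_).congr ?_
  all_goals
    intro w
    have hz' : ∀ y, y = z → y ∉ S' := fun y e => e ▸ hz
    obtain ⟨y, rfl | rfl⟩ := exists_eq_ins_or d γ w <;> have h1 := hS y <;> have h2 := hz' y <;>
      rw [Set.mem_compl_iff] at h1 <;> simp <;> tauto

/-- In the fault-free hypercube minus an edge in direction `d`, two vertices of opposite parity on
the same side with respect to `d` are joined by a Hamiltonian path. -/
theorem pathOn_compl_edge (hm : 3 ≤ m) (d : Fin (m + 1)) (γ : Bool) {z g h : Fin m → Bool}
    (hgh : par g ≠ par h) (hg : g ≠ z) (hh : h ≠ z) :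
    PathOn (FQ ∅) {ins d γ z, ins d (!γ) z}ᶜ (ins d γ g) (ins d γ h) := by
  by_cases hgz : par g = par z
  · exact (pathOn_compl_edge_aux hm d γ hgh.symm hh hg fun e => hgh (hgz.trans e.symm)).symm
  · exact pathOn_compl_edge_aux hm d γ hgh hg hh hgz

theorem pathOn_compl_pair (hm : 3 ≤ m) {a g h : Fin (m + 1) → Bool} {d : Fin (m + 1)}
    (hgh : par g ≠ par h) (hd : g d = h d) (hga : g ≠ a) (hgb : g ≠ toggle a d) (hha : h ≠ a)
    (hhb : h ≠ toggle a d) : PathOn (FQ ∅) {a, toggle a d}ᶜ g h := by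
  obtain ⟨γ, z, rfl⟩ := exists_eq_ins d a
  simp only [toggle_ins_same] at hgb hhb ⊢
  obtain ⟨g, rfl | rfl⟩ := exists_eq_ins_or d γ g <;>
  obtain ⟨h, rfl | rfl⟩ := exists_eq_ins_or d γ h <;>
  simp at hd hga hgb hha hhb
  · exact pathOn_compl_edge hm d γ (by simpa using hgh) hga hha
  · have := pathOn_compl_edge hm d (!γ) (z := z) (g := g) (h := h) (by simpa using hgh) hgb hhb
    rw [Bool.not_not] at this
    rwa [Set.pair_comm]

variable {F : Finset (Sym2 (Fin (m + 1 + 1) → Bool))} {i : Fin (m + 1 + 1)} {β : Bool}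
  {a b : Fin (m + 1) → Bool}

theorem Healable.path_bad (h : Healable F i β a b) (hm : 3 ≤ m) (hF : half F i (!β) = ∅)
    (hC : (cross F i).card ≤ 2) :
    PathOn (FQ F) Set.univ (ins i (!β) a) (ins i (!β) b) := by
  have P := h.exists_half_path
  obtain ⟨d, rfl⟩ := Q_adj.1 h.adj
  obtain ⟨g, k, S₁, S₂, hg, hk, hgk, hsp⟩ : ∃ g k S₁ S₂, g ∉ insert a (insert (toggle a d) (cross F i)) ∧
      k ∉ insert a (insert (toggle a d) (cross F i)) ∧ g d = k d ∧
      PathOn.SplitAt (FQ (half F i β)) Set.univ a (toggle a d) g k S₁ S₂ := by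
    obtain ⟨u, v, w, hu, hv, hw, huw, ⟨S₁, S₂, h₁⟩, T₁, T₂, h₂⟩ :=
      P.exists_split_triple (insert a (insert (toggle a d) (cross F i))) (by
        have := card_insert_le (toggle a d) (cross F i)
        have := card_insert_le a (insert (toggle a d) (cross F i))
        have : 2 ^ (3 + 1) ≤ 2 ^ (m + 1) := Nat.pow_le_pow_right (by norm_num) (by omega)
        rw [ncard_univ_cube]
        omega)
    obtain ⟨j, rfl⟩ := Q_adj.1 (FQ_adj.1 h₁.2.1).1
    obtain ⟨l, rfl⟩ := Q_adj.1 (FQ_adj.1 h₂.2.1).1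
    by_cases hj : d = j
    · refine ⟨_, _, _, _, hv, hw, ?_, h₂⟩
      rw [toggle_of_ne _ (i := l)]
      rintro rfl
      subst hj
      simp at huw
    · exact ⟨_, _, _, _, hu, hv, by rw [toggle_of_ne _ hj], h₁⟩
  have hp := hsp.par_right
  obtain ⟨P₁, -, P₂, hS, hd⟩ := hsp
  simp only [mem_insert, not_or] at hg hk
  have R := pathOn_compl_pair hm (by rw [hp]; simp) hgk hg.1 hg.2.1 hk.1 hk.2.1
  rw [← hF] at R
  refine (((((PathOn.single _ _).append (FQ_adj_cross' h.left_notMem β) P₁.lift ?_).append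
    (FQ_adj_cross hg.2.2 β) R.lift ?_).append (FQ_adj_cross' hk.2.2 β) P₂.lift ?_).append
    (FQ_adj_cross h.right_notMem β) (PathOn.single _ _) ?_).congr ?_
  all_goals
    intro w
    have hne : ∀ z, z = a → z ≠ toggle a d := fun z e => e ▸ h.ne
    obtain ⟨z, rfl | rfl⟩ := exists_eq_ins_or i β w <;> have := hS z <;> have := hd z <;>
      have := hne z <;> simp <;> tauto

/-- The number of faulty edges which meet `C` is at most the sum of the faulty degrees in `C`. -/
theorem card_filter_le_sum_dirs {n : ℕ} {F : Finset (Sym2 (Fin n → Bool))} (hF : EdgeFaults F)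
    (C : Finset (Fin n → Bool)) :
    (F.filter fun e => ¬ ∀ w ∈ C, w ∉ e).card ≤ ∑ w ∈ C, (dirs F w).card := by
  have h : (F.filter fun e => ¬ ∀ w ∈ C, w ∉ e) ⊆
      C.biUnion fun w => (dirs F w).image fun j => s(w, toggle w j) := by
    intro e he
    simp only [mem_filter, not_forall, not_not] at he
    obtain ⟨he, w, hw, hwe⟩ := he
    obtain ⟨v, rfl⟩ := Sym2.mem_iff_exists.1 hwe
    have hadj := hF he
    rw [mem_edgeSet, Q_adj] at hadj
    obtain ⟨j, rfl⟩ := hadj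
    exact mem_biUnion.2 ⟨w, hw, mem_image.2 ⟨j, mem_dirs.2 he, rfl⟩⟩
  refine (card_le_card h).trans (card_biUnion_le.trans (sum_le_sum fun w _ => card_image_le))

theorem laceable_of_heavy_half (hm : 3 ≤ m) (hF : EdgeFaults F) (i : Fin (m + 1 + 1)) (β : Bool)
    (hE : ∀ e ∈ half F i β, Laceable ((half F i β).erase e))
    (h1 : (half F i !β).card ≤ 1) (hC : (cross F i).card ≤ 2)
    (hdeg : ∀ w, w ∉ cross F i → (dirs (half F i β) w).card + (cross F i).card < m + 1)
    (hsum : ∑ w ∈ cross F i, (dirs (half F i β) w).card + 1 + (half F i !β).card ≤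
      (half F i β).card) : Laceable F := by
  intro x y hxy
  have hcard : (half F i !β).card + 1 ≤
      ((half F i β).filter fun e => ∀ w ∈ cross F i, w ∉ e).card := by
    have := card_filter_le_sum_dirs (half_subset hF i β) (cross F i)
    have := card_filter_add_card_filter_not (s := half F i β) fun e => ∀ w ∈ cross F i, w ∉ e
    omega
  obtain ⟨hD, hH⟩ := pairedCoverable_and_hyperLaceable (m + 1) (by omega) _ (half_subset hF i !β)
    (by omega)
  have hL := laceable_of_card_le (m + 1) (by omega) _ (half_subset hF i !β) (by omega)
  have heal : ∀ {a b}, s(a, b) ∈ (half F i β).filter (fun e => ∀ w ∈ cross F i, w ∉ e) →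
      Healable F i β a b := by
    intro a b he
    rw [mem_filter] at he
    refine ⟨half_subset hF i β he.1, he.1, fun ha => he.2 a ha (by simp),
      fun hb => he.2 b hb (by simp), hE _ he.1, hL, hD, hH, ?_⟩
    have : 2 ^ 3 ≤ 2 ^ m := Nat.pow_le_pow_right (by norm_num) hm
    omega
  have main : ∀ {a b}, Healable F i β a b → s(x, y) ≠ s(ins i (!β) a, ins i (!β) b) →
      PathOn (FQ F) Set.univ x y := by
    intro a b h hbad
    refine h.path hxy ?_ ?_
    · rintro z (rfl | rfl) -
      · exact hdeg _ h.left_notMem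
      · exact hdeg _ h.right_notMem
    · rw [ne_eq, Sym2.eq_iff, not_or] at hbad
      exact hbad
  by_cases hF1 : half F i (!β) = ∅
  · obtain ⟨e, he⟩ : ((half F i β).filter fun e => ∀ w ∈ cross F i, w ∉ e).Nonempty :=
      card_pos.1 (by omega)
    induction e with
    | _ a b =>
      have h := heal he
      by_cases hbad : s(x, y) = s(ins i (!β) a, ins i (!β) b)
      · rcases Sym2.eq_iff.1 hbad with ⟨rfl, rfl⟩ | ⟨rfl, rfl⟩
        · exact h.path_bad hm hF1 hC
        · exact (h.path_bad hm hF1 hC).symm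
      · exact main h hbad
  · have := card_pos.2 (nonempty_iff_ne_empty.2 hF1)
    obtain ⟨e, he, e', he', hne⟩ := one_lt_card.1 (show 1 <
      ((half F i β).filter fun e => ∀ w ∈ cross F i, w ∉ e).card by omega)
    have key : ∀ e ∈ (half F i β).filter (fun e => ∀ w ∈ cross F i, w ∉ e),
        s(x, y) ≠ e.map (ins i !β) → PathOn (FQ F) Set.univ x y := by
      intro e he hbad
      induction e with
      | _ a b => exact main (heal he) hbad
    by_cases hbad : s(x, y) = e.map (ins i !β)
    · exact key e' he' fun h => hne (map_ins_injective i _ (hbad.symm.trans h))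
    · exact key e he hbad

end Unhealed

section Counting

variable {n m : ℕ}

theorem card_star {F : Finset (Sym2 (Fin n → Bool))} (hF : EdgeFaults F) (v : Fin n → Bool) :
    (F.filter (v ∈ ·)).card = (dirs F v).card := by
  have h : F.filter (v ∈ ·) = (dirs F v).image fun j => s(v, toggle v j) := by
    ext e
    simp only [mem_filter, mem_image, mem_dirs]
    constructor
    · rintro ⟨he, hv⟩
      obtain ⟨w, rfl⟩ := Sym2.mem_iff_exists.1 hv
      have hadj := hF he
      rw [mem_edgeSet, Q_adj] at hadj
      obtain ⟨j, rfl⟩ := hadj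
      exact ⟨j, he, rfl⟩
    · rintro ⟨j, hj, rfl⟩
      exact ⟨hj, by simp⟩
  rw [h, card_image_of_injective]
  intro j k hjk
  exact toggle_inj.1 (Sym2.congr_right.1 hjk)

theorem card_dirs_le {F : Finset (Sym2 (Fin n → Bool))} (hF : EdgeFaults F) (v : Fin n → Bool) :
    (dirs F v).card ≤ F.card := by
  rw [← card_star hF]
  exact card_filter_le _ _

theorem card_dirs_mono {F F' : Finset (Sym2 (Fin n → Bool))} (h : F' ⊆ F) (v : Fin n → Bool) :
    (dirs F' v).card ≤ (dirs F v).card :=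
  card_le_card fun _ hj => mem_dirs.2 (h (mem_dirs.1 hj))

theorem card_star_union {F : Finset (Sym2 (Fin n → Bool))} (hF : EdgeFaults F)
    {u v : Fin n → Bool} (huv : u ≠ v) :
    (dirs F u).card + (dirs F v).card ≤
      (F.filter fun e => u ∈ e ∨ v ∈ e).card + if s(u, v) ∈ F then 1 else 0 := by
  rw [← card_star hF, ← card_star hF, ← card_union_add_card_inter, filter_or]
  refine Nat.add_le_add_left ?_ _
  have h : F.filter (u ∈ ·) ∩ F.filter (v ∈ ·) ⊆ F.filter (· = s(u, v)) := by
    intro e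
    simp only [mem_inter, mem_filter]
    rintro ⟨⟨he, hu⟩, -, hv⟩
    exact ⟨he, (Sym2.mem_and_mem_iff huv).1 ⟨hu, hv⟩⟩
  refine (card_le_card h).trans ?_
  split_ifs with hm
  · refine (card_le_card (t := {s(u, v)}) fun e he => ?_).trans (by simp)
    simpa using (mem_filter.1 he).2
  · rw [Nat.le_zero, card_eq_zero, filter_eq_empty_iff]
    rintro e he rfl
    exact hm he

theorem card_dirs_add_le {F : Finset (Sym2 (Fin n → Bool))} (hF : EdgeFaults F)
    {u v : Fin n → Bool} (huv : u ≠ v) : (dirs F u).card + (dirs F v).card ≤ F.card + 1 := by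
  have h1 := card_star_union hF huv
  have h2 := card_filter_le F fun e => u ∈ e ∨ v ∈ e
  split_ifs at h1 <;> omega

theorem card_dirs_add_add_le {F : Finset (Sym2 (Fin n → Bool))} (hF : EdgeFaults F)
    {u v w : Fin n → Bool} (huv : u ≠ v) (huw : u ≠ w) (hvw : v ≠ w) (hs : s(u, v) ∉ F) :
    (dirs F u).card + (dirs F v).card + (dirs F w).card ≤ F.card + 2 := by
  have h1 := card_star_union hF huv
  rw [if_neg hs] at h1
  have h2 : (F.filter fun e => u ∈ e ∨ v ∈ e) ∩ F.filter (w ∈ ·) ⊆ {s(u, w), s(v, w)} := by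
    intro e
    simp only [mem_inter, mem_filter, mem_insert, mem_singleton]
    rintro ⟨⟨he, hu | hv⟩, -, hw⟩
    · exact .inl ((Sym2.mem_and_mem_iff huw).1 ⟨hu, hw⟩)
    · exact .inr ((Sym2.mem_and_mem_iff hvw).1 ⟨hv, hw⟩)
  have h3 := (card_le_card h2).trans card_le_two
  have h4 := card_union_add_card_inter (F.filter fun e => u ∈ e ∨ v ∈ e) (F.filter (w ∈ ·))
  have h5 : ((F.filter fun e => u ∈ e ∨ v ∈ e) ∪ F.filter (w ∈ ·)).card ≤ F.card :=
    card_le_card (union_subset (filter_subset _ _) (filter_subset _ _))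
  rw [card_star hF] at h4
  omega

theorem card_le_sum_cross {F : Finset (Sym2 (Fin (m + 1) → Bool))} (hF : EdgeFaults F) :
    F.card ≤ ∑ i, (cross F i).card := by
  have h : F ⊆ univ.biUnion fun i => (cross F i).image fun w => s(ins i false w, ins i true w) := by
    intro e he
    induction e with
    | _ v w =>
      have hadj := hF he
      rw [mem_edgeSet, Q_adj] at hadj
      obtain ⟨i, rfl⟩ := hadj
      obtain ⟨β, v, rfl⟩ := exists_eq_ins i v
      rw [toggle_ins_same] at he ⊢
      refine mem_biUnion.2 ⟨i, mem_univ _, mem_image.2 ⟨v, (mem_cross β).1 he, ?_⟩⟩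
      cases β <;> simp [Sym2.eq_swap]
  exact (card_le_card h).trans (card_biUnion_le.trans (sum_le_sum fun i _ => card_image_le))

theorem two_mul_add_one_lt_two_pow {c m : ℕ} (hm : 2 ≤ m) (hc : c ≤ 2) :
    2 * c + 1 < 2 ^ (m + 1) := by
  have : 2 ^ 3 ≤ 2 ^ (m + 1) := Nat.pow_le_pow_right (by norm_num) (by omega)
  omega

end Counting

section TwoStars

variable {n m : ℕ}

theorem mem_map_ins_iff {i : Fin (m + 1)} {β γ : Bool} {v : Fin m → Bool} {e : Sym2 (Fin m → Bool)} :
    ins i β v ∈ e.map (ins i γ) ↔ γ = β ∧ v ∈ e := by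
  induction e with
  | _ a b =>
    simp only [Sym2.map_mk, Sym2.mem_iff, ins_inj]
    tauto

theorem card_le_of_forall_mem {F : Finset (Sym2 (Fin n → Bool))} (hF : EdgeFaults F)
    {v : Fin n → Bool} (h : ∀ e ∈ F, v ∈ e) : F.card ≤ (dirs F v).card := by
  rw [← card_star hF, filter_true_of_mem h]

theorem card_le_of_forall_mem_or {F : Finset (Sym2 (Fin n → Bool))} (hF : EdgeFaults F)
    {u v : Fin n → Bool} (h : ∀ e ∈ F, u ∈ e ∨ v ∈ e) :
    F.card ≤ (dirs F u).card + (dirs F v).card := by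
  rw [← card_star hF, ← card_star hF]
  refine (card_le_card fun e he => ?_).trans (card_union_le _ _)
  rw [← filter_or]
  exact mem_filter.2 ⟨he, h e he⟩

theorem mem_dirs_of_toggle_mem {F : Finset (Sym2 (Fin n → Bool))} {v : Fin n → Bool} {i : Fin n}
    (h : i ∈ dirs F (toggle v i)) : i ∈ dirs F v := by
  rw [mem_dirs, toggle_toggle, Sym2.eq_swap] at h
  exact mem_dirs.2 h

variable {F : Finset (Sym2 (Fin (m + 1 + 1) → Bool))} {i : Fin (m + 1 + 1)} {β : Bool}

theorem eq_or_eq_of_mem_cross {γ : Bool} {u₀ v₀ w : Fin (m + 1) → Bool}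
    (hT : ∀ e ∈ F, ins i γ u₀ ∈ e ∨ ins i β v₀ ∈ e) (hw : w ∈ cross F i) : w = u₀ ∨ w = v₀ := by
  rw [← mem_cross true] at hw
  have := hT _ hw
  simp only [Sym2.mem_iff, ins_inj] at this
  tauto

theorem card_cross_le_two {γ : Bool} {u₀ v₀ : Fin (m + 1) → Bool}
    (hT : ∀ e ∈ F, ins i γ u₀ ∈ e ∨ ins i β v₀ ∈ e) : (cross F i).card ≤ 2 :=
  (card_le_card (t := {u₀, v₀}) fun w hw => by simpa using eq_or_eq_of_mem_cross hT hw).trans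
    card_le_two

theorem half_eq_empty_of_forall {u₀ v₀ : Fin (m + 1) → Bool}
    (hT : ∀ e ∈ F, ins i β u₀ ∈ e ∨ ins i β v₀ ∈ e) : half F i (!β) = ∅ := by
  rw [eq_empty_iff_forall_notMem]
  intro e he
  have := hT _ (mem_filter.1 he).2
  rw [mem_map_ins_iff, mem_map_ins_iff] at this
  simp at this

theorem forall_mem_half {u₀ v₀ : Fin (m + 1) → Bool}
    (hT : ∀ e ∈ F, ins i β u₀ ∈ e ∨ ins i β v₀ ∈ e) : ∀ e ∈ half F i β, u₀ ∈ e ∨ v₀ ∈ e := by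
  intro e he
  have := hT _ (mem_filter.1 he).2
  rw [mem_map_ins_iff, mem_map_ins_iff] at this
  tauto

theorem forall_mem_half_of_ne {u₀ v₀ : Fin (m + 1) → Bool}
    (hT : ∀ e ∈ F, ins i (!β) u₀ ∈ e ∨ ins i β v₀ ∈ e) : ∀ e ∈ half F i β, v₀ ∈ e := by
  intro e he
  have := hT _ (mem_filter.1 he).2
  rw [mem_map_ins_iff, mem_map_ins_iff] at this
  simpa using this

theorem Laceable.congr_half {γ : Bool} (h : Laceable (half F i β)) (h' : Laceable (half F i !β)) :
    Laceable (half F i γ) := by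
  cases β <;> cases γ <;> assumption

end TwoStars

section TwoStarsLaceable

variable {n m : ℕ}

/-- Every fault set that is a union of two stars, with centres `u` and `v` of small faulty degrees
and such that the star of `v` only uses directions in which `u` and `v` agree, is avoided by
Hamiltonian paths. -/
def StarsLaceable (n : ℕ) : Prop :=
  ∀ F : Finset (Sym2 (Fin n → Bool)), EdgeFaults F → ∀ u v, u ≠ v → (∀ e ∈ F, u ∈ e ∨ v ∈ e) →
    (dirs F v).card + 2 ≤ n → (dirs F u).card + 3 ≤ n → (∀ i ∈ dirs F v, u i = v i) → Laceable F

theorem dirs_toggle_subset {F : Finset (Sym2 (Fin n → Bool))} {a v : Fin n → Bool} (hav : a ≠ v)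
    (hT : ∀ e ∈ F, a ∈ e ∨ v ∈ e) (hagree : ∀ j ∈ dirs F v, a j = v j) {t : Fin n}
    (hb : toggle a t ≠ v) : dirs F (toggle a t) ⊆ {t} := by
  intro j hj
  rw [mem_singleton]
  by_contra hjt
  have h := hT _ (mem_dirs.1 hj)
  simp only [Sym2.mem_iff] at h
  rcases h with (h | h) | (h | h)
  · exact toggle_ne _ _ h.symm
  · apply hjt
    have := congrArg (toggle · j) h
    simp only [toggle_toggle] at this
    exact toggle_inj.1 this
  · exact hb h.symm
  · subst h
    have h' := hagree j (mem_dirs_of_toggle_mem (by rwa [toggle_toggle]))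
    rw [toggle_same, toggle_of_ne _ hjt] at h'
    simp at h'

theorem dirs_toggle_subset_of_star {F : Finset (Sym2 (Fin n → Bool))} {v : Fin n → Bool}
    (hT : ∀ e ∈ F, v ∈ e) (t : Fin n) : dirs F (toggle v t) ⊆ {t} := by
  intro j hj
  rw [mem_singleton]
  have h := hT _ (mem_dirs.1 hj)
  rw [Sym2.mem_iff] at h
  rcases h with h | h
  · exact absurd h.symm (toggle_ne _ _)
  · have := congrArg (toggle · j) h
    simp only [toggle_toggle] at this
    exact toggle_inj.1 this

variable {F : Finset (Sym2 (Fin (m + 1 + 1) → Bool))} {u v : Fin (m + 1 + 1) → Bool}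

theorem laceable_of_two_stars_of_mem (hm : 2 ≤ m) (hF : EdgeFaults F) (ih : StarsLaceable (m + 1))
    (huv : u ≠ v) (hT : ∀ e ∈ F, u ∈ e ∨ v ∈ e) (hv : (dirs F v).card + 2 ≤ m + 1 + 1)
    (hu : (dirs F u).card + 3 ≤ m + 1 + 1) (hagree : ∀ i ∈ dirs F v, u i = v i)
    {i : Fin (m + 1 + 1)} (hi : i ∈ dirs F v)
    (hi' : i ∈ dirs F u ∨ (dirs F u).card + 4 ≤ m + 1 + 1) : Laceable F := by
  have hi2 := hagree i hi
  obtain ⟨β, v, rfl⟩ := exists_eq_ins i v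
  obtain ⟨u, rfl | rfl⟩ := exists_eq_ins_or i β u
  swap
  · simp at hi2
  have hhalf : Laceable (half F i β) := by
    rw [card_dirs_ins] at hu hv
    rw [mem_dirs_ins_same] at hi hi'
    rw [card_dirs_ins] at hi'
    refine ih _ (half_subset hF i β) u v (fun h => huv (h ▸ rfl)) (forall_mem_half hT) ?_ ?_ ?_
    · simp only [hi, if_true] at hv
      omega
    · split_ifs at hu hi' <;> first | omega | simp_all
    · intro j hj
      simpa using hagree _ (mem_dirs_ins_succAbove.2 hj)
  refine laceable_of_halves i (fun γ => hhalf.congr_half ?_)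
    (two_mul_add_one_lt_two_pow hm (card_cross_le_two hT))
  rw [half_eq_empty_of_forall hT]
  exact laceable_of_card_le _ (by omega) _ (by simp) (by simp)

theorem laceable_of_two_small_stars (hm : 2 ≤ m) (hF : EdgeFaults F)
    (huv : u ≠ v) (hT : ∀ e ∈ F, u ∈ e ∨ v ∈ e) (hv : (dirs F v).card + 3 ≤ m + 1 + 1)
    (hu : (dirs F u).card + 3 ≤ m + 1 + 1) : Laceable F := by
  obtain ⟨i, hi⟩ := Function.ne_iff.1 huv
  obtain ⟨β, v, rfl⟩ := exists_eq_ins i v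
  obtain ⟨u, rfl | rfl⟩ := exists_eq_ins_or i β u
  · simp at hi
  have key : ∀ {γ u v}, (∀ e ∈ F, ins i (!γ) u ∈ e ∨ ins i γ v ∈ e) →
      (dirs F (ins i γ v)).card + 3 ≤ m + 1 + 1 → Laceable (half F i γ) := by
    intro γ u v hT hv
    refine laceable_of_card_le _ (by omega) _ (half_subset hF i γ) ?_
    have := card_le_of_forall_mem (half_subset hF i γ) (forall_mem_half_of_ne hT)
    rw [card_dirs_ins] at hv
    omega
  refine laceable_of_halves i (fun γ => (key hT hv).congr_half (key (u := v) (v := u) ?_ hu))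
    (two_mul_add_one_lt_two_pow hm (card_cross_le_two hT))
  intro e he
  rw [Bool.not_not]
  exact (hT e he).symm

theorem laceable_of_two_stars_four {F : Finset (Sym2 (Fin (2 + 1 + 1) → Bool))}
    {u v : Fin (2 + 1 + 1) → Bool} (hF : EdgeFaults F) (huv : u ≠ v)
    (hT : ∀ e ∈ F, u ∈ e ∨ v ∈ e) (hv : (dirs F v).card = 2) (hu : (dirs F u).card = 1)
    (hagree : ∀ i ∈ dirs F v, u i = v i) (hdisj : ∀ i ∈ dirs F v, i ∉ dirs F u) :
    Laceable F := by
  intro x y hxy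
  obtain ⟨t, ht⟩ := card_pos.1 (show 0 < (dirs F u).card by omega)
  obtain ⟨i, hi, hbad⟩ : ∃ i ∈ dirs F v, s(x, y) ≠ s(toggle u i, toggle (toggle u t) i) := by
    by_contra! hcon
    obtain ⟨i, hi, j, hj, hij⟩ := one_lt_card.1 (show 1 < (dirs F v).card by omega)
    have h := (hcon i hi).symm.trans (hcon j hj)
    rcases Sym2.eq_iff.1 h with ⟨h, -⟩ | ⟨h, -⟩
    · exact hij (toggle_inj.1 h)
    · simpa using congrArg par h
  have hiu := hdisj i hi
  have hi2 := hagree i hi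
  have htv : t ∉ dirs F v := fun h => hdisj t h ht
  obtain ⟨t, rfl⟩ := Fin.exists_succAbove_eq (fun h : t = i => hiu (h ▸ ht))
  obtain ⟨β, v, rfl⟩ := exists_eq_ins i v
  obtain ⟨u, rfl | rfl⟩ := exists_eq_ins_or i β u
  swap
  · simp at hi2
  rw [mem_dirs_ins_same] at hi hiu
  rw [mem_dirs_ins_succAbove] at ht htv
  rw [card_dirs_ins] at hu hv
  simp only [hi, hiu, if_true, if_false] at hu hv
  rw [toggle_ins_same, toggle_ins_succAbove, toggle_ins_same] at hbad
  have hne : u ≠ v := fun h => huv (h ▸ rfl)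
  have hC : cross F i ⊆ {v} := fun w hw => by
    rcases eq_or_eq_of_mem_cross hT hw with rfl | rfl
    · exact absurd hw hiu
    · simp
  have hb : toggle u t ≠ v := by
    rintro rfl
    exact htv (mem_dirs_of_toggle_mem (by rwa [toggle_toggle]))
  have hC1 := card_le_card hC
  rw [card_singleton] at hC1
  have hdb := card_le_card (dirs_toggle_subset hne (forall_mem_half hT)
    (fun j hj => by simpa using hagree _ (mem_dirs_ins_succAbove.2 hj)) hb)
  rw [card_singleton] at hdb
  have hmem := mem_dirs.1 ht
  have hempty := half_eq_empty_of_forall hT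
  have hhalf := card_le_of_forall_mem_or (half_subset hF i β) (forall_mem_half hT)
  have h : Healable F i β u (toggle u t) := by
    refine ⟨half_subset hF i β hmem, hmem, hiu, fun h => hb (by simpa using hC h), ?_, ?_, ?_, ?_, ?_⟩
    · refine laceable_of_card_le _ (by norm_num) _
        (fun e he => half_subset hF i β (mem_of_mem_erase he)) ?_
      rw [card_erase_of_mem hmem]
      omega
    · rw [hempty]
      exact laceable_of_card_le _ (by norm_num) _ (by simp) (by simp)
    · rw [hempty]
      exact (pairedCoverable_and_hyperLaceable _ (by norm_num) _ (by simp) (by simp)).1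
    · rw [hempty]
      exact (pairedCoverable_and_hyperLaceable _ (by norm_num) _ (by simp) (by simp)).2
    · omega
  refine h.path hxy ?_ ?_
  · rintro z (rfl | rfl) - <;> omega
  · rw [ne_eq, Sym2.eq_iff, not_or] at hbad
    exact hbad

theorem laceable_of_two_stars_five {F : Finset (Sym2 (Fin (3 + 1 + 1) → Bool))}
    {u v : Fin (3 + 1 + 1) → Bool} (hF : EdgeFaults F) (huv : u ≠ v)
    (hT : ∀ e ∈ F, u ∈ e ∨ v ∈ e) (hv : (dirs F v).card = 3) (hu : (dirs F u).card = 2)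
    (hagree : ∀ i ∈ dirs F v, u i = v i) (hdisj : ∀ i ∈ dirs F v, i ∉ dirs F u) :
    Laceable F := by
  intro x y hxy
  have hD : ∀ k, u k ≠ v k → k ∈ dirs F u := by
    intro k hk
    have huniv : dirs F u ∪ dirs F v = univ := by
      rw [← card_eq_iff_eq_univ, card_union_of_disjoint, hu, hv, Fintype.card_fin]
      rw [Finset.disjoint_left]
      exact fun i hi hi' => hdisj i hi' hi
    have := mem_univ k
    rw [← huniv, mem_union] at this
    exact this.resolve_right fun h => hk (hagree k h)
  obtain ⟨k, hk, hxk, hyk⟩ : ∃ k, u k ≠ v k ∧ x ≠ toggle v k ∧ y ≠ toggle v k := by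
    obtain ⟨p, hp⟩ := Function.ne_iff.1 huv
    obtain ⟨q, hq, hqp⟩ : ∃ q, u q ≠ v q ∧ q ≠ p := by
      by_contra! hcon
      have hu' : u = toggle v p := by
        ext j
        by_cases hj : j = p
        · subst hj
          rw [toggle_same]
          cases h1 : u j <;> cases h2 : v j <;> simp_all
        · rw [toggle_of_ne _ hj]
          by_contra h
          exact hj (hcon j h)
      refine hdisj p ?_ (hD p hp)
      have := hD p hp
      rw [hu'] at this
      exact mem_dirs_of_toggle_mem this
    by_contra! hcon
    have h1 := hcon p hp
    have h2 := hcon q hq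
    have hne : toggle v p ≠ toggle v q := fun h => hqp (toggle_inj.1 h).symm
    by_cases hx1 : x = toggle v p
    · by_cases hx2 : x = toggle v q
      · exact hne (hx1.symm.trans hx2)
      · exact hxy (by rw [hx1, h2 hx2]; simp)
    · by_cases hx2 : x = toggle v q
      · exact hxy (by rw [hx2, h1 hx1]; simp)
      · exact hne ((h1 hx1).symm.trans (h2 hx2))
  have hku := hD k hk
  have hkv : k ∉ dirs F v := fun h => hdisj k h hku
  obtain ⟨j, hj⟩ := card_pos.1 (show 0 < (dirs F v).card by omega)
  have hjagree := hagree j hj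
  obtain ⟨j, rfl⟩ := Fin.exists_succAbove_eq (fun h : j = k => hkv (h ▸ hj))
  obtain ⟨β, v, rfl⟩ := exists_eq_ins k v
  obtain ⟨u, rfl | rfl⟩ := exists_eq_ins_or k β u
  · simp at hk
  rw [mem_dirs_ins_same] at hku hkv
  rw [mem_dirs_ins_succAbove] at hj
  rw [card_dirs_ins] at hu hv
  simp only [hku, hkv, if_true, if_false] at hu hv
  rw [toggle_ins_same] at hxk hyk
  rw [ins_succAbove, ins_succAbove] at hjagree
  have hC : cross F k ⊆ {u} := fun w hw => by
    rcases eq_or_eq_of_mem_cross hT hw with rfl | rfl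
    · simp
    · exact absurd hw hkv
  have hb : toggle v j ≠ u := by
    rintro rfl
    simp at hjagree
  have hC1 := card_le_card hC
  rw [card_singleton] at hC1
  have hdb := card_le_card (dirs_toggle_subset_of_star (forall_mem_half_of_ne hT) j)
  rw [card_singleton] at hdb
  have hmem := mem_dirs.1 hj
  have hhalf := card_le_of_forall_mem (half_subset hF k β) (forall_mem_half_of_ne hT)
  have hhalf' := card_le_of_forall_mem (half_subset hF k !β) (forall_mem_half_of_ne (u₀ := v)
    (v₀ := u) fun e he => by rw [Bool.not_not]; exact (hT e he).symm)
  have hDH := pairedCoverable_and_hyperLaceable _ (by norm_num) _ (half_subset hF k !β) (by omega)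
  have h : Healable F k β v (toggle v j) := by
    refine ⟨half_subset hF k β hmem, hmem, hkv, fun h => hb (by simpa using hC h), ?_, ?_, hDH.1,
      hDH.2, by omega⟩
    · refine laceable_of_card_le _ (by norm_num) _
        (fun e he => half_subset hF k β (mem_of_mem_erase he)) ?_
      rw [card_erase_of_mem hmem]
      omega
    · exact laceable_of_card_le _ (by norm_num) _ (half_subset hF k !β) (by omega)
  refine h.path hxy ?_ ⟨fun h => hxk h.1, fun h => hyk h.2⟩
  rintro z (rfl | rfl) hz
  · tauto
  · omega

theorem starsLaceable (hn : 3 ≤ n) : StarsLaceable n := by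
  induction n, hn using Nat.le_induction with
  | base =>
    intro F hF u v huv hT hv hu hagree
    refine laceable_of_card_le _ (by norm_num) _ hF ?_
    have := card_le_of_forall_mem_or hF hT
    omega
  | succ n hn ih =>
    obtain ⟨m, rfl⟩ := Nat.exists_eq_add_of_le' (show 1 ≤ n by omega)
    intro F hF u v huv hT hv hu hagree
    by_cases hA : ∃ i ∈ dirs F v, i ∈ dirs F u ∨ (dirs F u).card + 4 ≤ m + 1 + 1
    · obtain ⟨i, hi, hi'⟩ := hA
      exact laceable_of_two_stars_of_mem (by omega) hF ih huv hT hv hu hagree hi hi'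
    by_cases hB : (dirs F v).card + 3 ≤ m + 1 + 1
    · exact laceable_of_two_small_stars (by omega) hF huv hT hB hu
    push Not at hA
    obtain ⟨i, hi⟩ := card_pos.1 (show 0 < (dirs F v).card by omega)
    have hu' := (hA i hi).2
    have hdisj : ∀ i ∈ dirs F v, i ∉ dirs F u := fun i hi => (hA i hi).1
    have hle : (dirs F v).card + (dirs F u).card ≤ m + 1 + 1 := by
      rw [← card_union_of_disjoint (Finset.disjoint_left.2 fun i hi => hdisj i hi)]
      exact card_finset_fin_le _
    obtain rfl | rfl : m = 2 ∨ m = 3 := by omega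
    · exact laceable_of_two_stars_four hF huv hT (by omega) (by omega) hagree hdisj
    · exact laceable_of_two_stars_five hF huv hT (by omega) (by omega) hagree hdisj

end TwoStarsLaceable

section Step

variable {n m : ℕ}

/-- The fault sets of the theorem, in terms of the faulty degrees. -/
structure Admissible (F : Finset (Sym2 (Fin n → Bool))) : Prop where
  faults : EdgeFaults F
  card : F.card + 11 ≤ 3 * n
  deg : ∀ v, (dirs F v).card + 2 ≤ n
  unique : ∀ v w, (dirs F v).card + 2 = n → (dirs F w).card + 2 = n → v = w

theorem cross_nonempty {F : Finset (Sym2 (Fin (m + 1) → Bool))} {i : Fin (m + 1)}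
    {v : Fin (m + 1) → Bool} (h : i ∈ dirs F v) : (cross F i).Nonempty := by
  obtain ⟨β, v, rfl⟩ := exists_eq_ins i v
  exact ⟨v, mem_dirs_ins_same.1 h⟩

theorem six_mul_le_two_pow (hm : 4 ≤ m) : 6 * m ≤ 2 ^ (m + 1) := by
  induction m, hm using Nat.le_induction with
  | base => norm_num
  | succ m hm ih => rw [pow_succ]; omega

theorem Admissible.laceable_five {F : Finset (Sym2 (Fin (3 + 1 + 1) → Bool))} (hF : Admissible F) :
    Laceable F := by
  have hc := hF.card
  by_cases h3 : F.card ≤ 3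
  · exact laceable_of_card_le _ (by norm_num) _ hF.faults (by omega)
  obtain ⟨i, hne, hi⟩ : ∃ i, (cross F i).Nonempty ∧ ∀ v, (dirs F v).card = 3 → i ∈ dirs F v := by
    by_cases hv : ∃ v, (dirs F v).card = 3
    · obtain ⟨v, hv⟩ := hv
      obtain ⟨i, hi⟩ := card_pos.1 (show 0 < (dirs F v).card by omega)
      refine ⟨i, cross_nonempty hi, fun w hw => ?_⟩
      rwa [hF.unique w v (by omega) (by omega)]
    · obtain ⟨i, hi⟩ := exists_mem_cross hF.faults (card_pos.1 (by omega))
      exact ⟨i, hi, fun v h => absurd ⟨v, h⟩ hv⟩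
  have hpos := card_pos.2 hne
  by_cases hhalf : ∀ β, (half F i β).card ≤ 2
  · refine laceable_of_halves i
      (fun β => laceable_of_card_le _ (by norm_num) _ (half_subset hF.faults i β) (hhalf β)) ?_
    have := card_half_add_cross_le hF.faults i true
    norm_num
    omega
  · push Not at hhalf
    obtain ⟨β, hβ⟩ := hhalf
    have hsplit := card_eq' F hF.faults i β
    refine laceable_of_heavy_half le_rfl hF.faults i β (fun e he => ?_) (by omega) (by omega) ?_ ?_
    · refine laceable_of_card_le _ (by norm_num) _
        (fun e he => half_subset hF.faults i β (mem_of_mem_erase he)) ?_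
      rw [card_erase_of_mem he]
      omega
    · intro w hw
      have hd := card_dirs_ins F i β w
      rw [if_neg hw] at hd
      have := hF.deg (ins i β w)
      have : (dirs F (ins i β w)).card ≠ 3 := fun h => hw (mem_dirs_ins_same.1 (hi _ h))
      omega
    · obtain ⟨w, hw⟩ := card_eq_one.1 (show (cross F i).card = 1 by omega)
      have hd := card_dirs_ins F i β w
      rw [if_pos (by simp [hw])] at hd
      have := hF.deg (ins i β w)
      rw [hw, sum_singleton]
      omega

variable {F : Finset (Sym2 (Fin (m + 1 + 1) → Bool))} {i : Fin (m + 1 + 1)}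

theorem Admissible.of_subset_half (hF : Admissible F)
    (hi : ∀ w, m + 1 + 1 ≤ (dirs F w).card + 3 → i ∈ dirs F w) {β : Bool}
    {F' : Finset (Sym2 (Fin (m + 1) → Bool))} (hF' : F' ⊆ half F i β)
    (hc : F'.card + 11 ≤ 3 * (m + 1)) : Admissible F' := by
  have key : ∀ w, (dirs F' w).card + 2 ≤ m + 1 ∧
      ((dirs F' w).card + 2 = m + 1 → (dirs F (ins i β w)).card + 2 = m + 1 + 1) := by
    intro w
    have h1 := card_dirs_mono hF' w
    have h2 := card_dirs_ins F i β w
    have h3 := hi (ins i β w)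
    have h4 := hF.deg (ins i β w)
    rw [mem_dirs_ins_same] at h3
    by_cases hw : w ∈ cross F i
    · rw [if_pos hw] at h2
      omega
    · rw [if_neg hw] at h2
      have := mt h3 hw
      omega
  exact ⟨fun e he => half_subset hF.faults i β (hF' he), hc, fun v => (key v).1, fun v w hv hw =>
    (ins_inj.1 (hF.unique _ _ ((key v).2 hv) ((key w).2 hw))).2⟩

theorem Admissible.laceable_of_direction (hF : Admissible F) (hm : 4 ≤ m)
    (ih : ∀ F' : Finset (Sym2 (Fin (m + 1) → Bool)), Admissible F' → Laceable F')
    (hi : ∀ w, m + 1 + 1 ≤ (dirs F w).card + 3 → i ∈ dirs F w)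
    (hne : (cross F i).Nonempty) (hhalf : ∀ β, (half F i β).card + 13 ≤ 3 * (m + 1 + 1))
    (h6 : 5 ≤ m ∨ ∀ v w, m + 1 + 1 ≤ (dirs F v).card + 3 → m + 1 + 1 ≤ (dirs F w).card + 3 →
      v = w) : Laceable F := by
  have hc := hF.card
  have hpos := card_pos.2 hne
  by_cases hlight : ∀ β, (half F i β).card + 14 ≤ 3 * (m + 1 + 1)
  · refine laceable_of_halves i (fun β => ih _ (hF.of_subset_half hi Subset.rfl ?_)) ?_
    · have := hlight β
      omega
    · have := card_half_add_cross_le hF.faults i true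
      have := six_mul_le_two_pow hm
      omega
  push Not at hlight
  obtain ⟨β, hβ⟩ := hlight
  have hβ' := hhalf β
  have hsplit := card_eq' F hF.faults i β
  have hdeg0 : ∀ w ∈ cross F i, (dirs F (ins i β w)).card = (dirs (half F i β) w).card + 1 := by
    intro w hw
    rw [card_dirs_ins, if_pos hw]
  refine laceable_of_heavy_half (by omega) hF.faults i β (fun e he => ?_) (by omega) (by omega) ?_ ?_
  · refine ih _ (hF.of_subset_half hi (erase_subset _ _) ?_)
    rw [card_erase_of_mem he]
    omega
  · intro w hw
    have hd := card_dirs_ins F i β w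
    rw [if_neg hw] at hd
    have := mt (hi (ins i β w)) (by rwa [mem_dirs_ins_same])
    omega
  · obtain h1 | h2 : (cross F i).card = 1 ∨ (cross F i).card = 2 := by omega
    · obtain ⟨w, hw⟩ := card_eq_one.1 h1
      have := hdeg0 w (by simp [hw])
      have := hF.deg (ins i β w)
      rw [hw, sum_singleton]
      omega
    · obtain ⟨w, w', hww, hw⟩ := card_eq_two.1 h2
      have h3 := hdeg0 w (by simp [hw])
      have h4 := hdeg0 w' (by simp [hw])
      have h5 := hF.deg (ins i β w)
      have h7 := hF.deg (ins i β w')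
      have hne : ins i β w ≠ ins i β w' := fun h => hww (ins_inj.1 h).2
      have h8 : ¬ ((dirs F (ins i β w)).card + 2 = m + 1 + 1 ∧
        (dirs F (ins i β w')).card + 2 = m + 1 + 1) := fun h => hne (hF.unique _ _ h.1 h.2)
      rw [hw, sum_pair hww]
      rcases h6 with h6 | h6
      · omega
      · have h9 : ¬ (m + 1 + 1 ≤ (dirs F (ins i β w)).card + 3 ∧
          m + 1 + 1 ≤ (dirs F (ins i β w')).card + 3) := fun h => hne (h6 _ _ h.1 h.2)
        omega

end Step

section Induction

variable {n m : ℕ}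

/-- The directions in which some end of `e` differs from `a`. -/
noncomputable def diffDirs (a : Fin n → Bool) (e : Sym2 (Fin n → Bool)) : Finset (Fin n) :=
  univ.filter fun i => ¬ ∀ w ∈ e, w i = a i

theorem mem_diffDirs {a : Fin n → Bool} {e : Sym2 (Fin n → Bool)} {i : Fin n} :
    i ∈ diffDirs a e ↔ ∃ w ∈ e, w i ≠ a i := by
  simp [diffDirs]

theorem two_le_card_diffDirs {a : Fin n → Bool} {e : Sym2 (Fin n → Bool)} (he : e ∈ (Q n).edgeSet)
    (ha : a ∉ e) : 2 ≤ (diffDirs a e).card := by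
  induction e with
  | _ v w =>
    rw [Sym2.mem_iff, not_or] at ha
    rw [mem_edgeSet] at he
    obtain ⟨i, hi⟩ := Function.ne_iff.1 ha.1
    obtain ⟨j, hj⟩ := Function.ne_iff.1 ha.2
    obtain ⟨k, hk⟩ := Function.ne_iff.1 he.ne
    have hmem : ∀ l, v l ≠ a l ∨ w l ≠ a l → l ∈ diffDirs a s(v, w) := by
      intro l hl
      rw [mem_diffDirs]
      rcases hl with hl | hl
      · exact ⟨v, by simp, hl⟩
      · exact ⟨w, by simp, hl⟩
    by_contra! hcon
    have hone := card_le_one.1 (Nat.le_of_lt_succ hcon)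
    obtain rfl := hone i (hmem i (.inl hi.symm)) j (hmem j (.inr hj.symm))
    obtain rfl : k = i := hone k (hmem k (by
      by_contra! h
      exact hk (h.1.trans h.2.symm))) i (hmem i (.inl hi.symm))
    revert hi hj hk
    cases v k <;> cases w k <;> cases a k <;> simp

theorem eq_of_agree_off_pair {a w : Fin n → Bool} {p q : Fin n} (hpq : p ≠ q)
    (h : ∀ i, i ≠ p → i ≠ q → w i = a i) :
    w = a ∨ w = toggle a p ∨ w = toggle a q ∨ w = toggle (toggle a p) q := by
  have key : ∀ z : Fin n → Bool, z p = w p → z q = w q → (∀ i, i ≠ p → i ≠ q → z i = a i) →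
      w = z := by
    intro z hp hq hz
    ext i
    by_cases h1 : i = p
    · rw [h1, hp]
    by_cases h2 : i = q
    · rw [h2, hq]
    rw [h i h1 h2, hz i h1 h2]
  have hz : ∀ i, i ≠ p → i ≠ q → toggle (toggle a p) q i = a i := fun i h1 h2 => by
    rw [toggle_of_ne _ h2, toggle_of_ne _ h1]
  by_cases h1 : w p = a p <;> by_cases h2 : w q = a q
  · exact .inl (key a h1.symm h2.symm fun _ _ _ => rfl)
  · refine .inr (.inr (.inl (key _ ?_ ?_ fun i _ h2 => toggle_of_ne _ h2)))
    · rw [toggle_of_ne _ hpq, h1]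
    · rw [toggle_same, Bool.not_eq.2 (Ne.symm h2)]
  · refine .inr (.inl (key _ ?_ ?_ fun i h1 _ => toggle_of_ne _ h1))
    · rw [toggle_same, Bool.not_eq.2 (Ne.symm h1)]
    · rw [toggle_of_ne _ hpq.symm, h2]
  · refine .inr (.inr (.inr (key _ ?_ ?_ hz)))
    · rw [toggle_of_ne _ hpq, toggle_same, Bool.not_eq.2 (Ne.symm h1)]
    · rw [toggle_same, toggle_of_ne _ hpq.symm, Bool.not_eq.2 (Ne.symm h2)]

/-- At most two edges avoid `a` and lie in the two-dimensional face spanned by `p`, `q` at `a`. -/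
theorem card_le_two_of_face {F : Finset (Sym2 (Fin n → Bool))} (hF : EdgeFaults F)
    {a : Fin n → Bool} {p q : Fin n} (hpq : p ≠ q)
    (h : ∀ e ∈ F, a ∉ e ∧ ∀ w ∈ e, ∀ i, i ≠ p → i ≠ q → w i = a i) : F.card ≤ 2 := by
  have hsub : F ⊆ {s(toggle a p, toggle (toggle a p) q), s(toggle a q, toggle (toggle a p) q)} := by
    intro e he
    have hadj := hF he
    obtain ⟨hae, hw⟩ := h e he
    induction e with
    | _ v w =>
      rw [mem_edgeSet, Q_adj] at hadj
      obtain ⟨j, hj⟩ := hadj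
      have hp : par w = !par v := by rw [hj]; simp
      rw [Sym2.mem_iff, not_or] at hae
      have hv := eq_of_agree_off_pair hpq (hw v (by simp))
      have hw' := eq_of_agree_off_pair hpq (hw w (by simp))
      clear hw hj
      rw [mem_insert, mem_singleton, Sym2.eq_iff, Sym2.eq_iff]
      rcases hv with rfl | rfl | rfl | rfl <;> rcases hw' with rfl | rfl | rfl | rfl <;> simp_all
  exact (card_le_card hsub).trans card_le_two

variable {F : Finset (Sym2 (Fin (m + 1 + 1) → Bool))}

theorem Admissible.laceable_of_light_halves (hF : Admissible F) (hm : 4 ≤ m)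
    (ih : ∀ F' : Finset (Sym2 (Fin (m + 1) → Bool)), Admissible F' → Laceable F')
    (i : Fin (m + 1 + 1)) (h : ∀ β, Admissible (half F i β)) : Laceable F := by
  refine laceable_of_halves i (fun β => ih _ (h β)) ?_
  have := card_half_add_cross_le hF.faults i true
  have := six_mul_le_two_pow hm
  have := hF.card
  omega

theorem Admissible.laceable_of_no_large_degree (hF : Admissible F) (hm : 4 ≤ m)
    (ih : ∀ F' : Finset (Sym2 (Fin (m + 1) → Bool)), Admissible F' → Laceable F')
    (h : ∀ w, (dirs F w).card + 3 < m + 1 + 1) : Laceable F := by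
  have hc := hF.card
  by_cases h0 : F = ∅
  · exact laceable_of_card_le _ (by omega) _ hF.faults (by simp [h0])
  obtain ⟨i, hi, hi'⟩ : ∃ i, (cross F i).Nonempty ∧
      F.card + 13 ≤ 3 * (m + 1 + 1) + (cross F i).card := by
    by_cases hle : F.card ≤ m + 1 + 1
    · obtain ⟨i, hi⟩ := exists_mem_cross hF.faults (nonempty_iff_ne_empty.2 h0)
      have := card_pos.2 hi
      exact ⟨i, hi, by omega⟩
    · obtain ⟨i, hi⟩ : ∃ i, 2 ≤ (cross F i).card := by
        by_contra! hcon
        have h1 := card_le_sum_cross hF.faults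
        have h2 := sum_le_card_nsmul univ (fun i => (cross F i).card) 1
          fun i _ => Nat.le_of_lt_succ (hcon i)
        simp at h2
        omega
      exact ⟨i, card_pos.1 (by omega), by omega⟩
  refine hF.laceable_of_direction hm ih (fun w hw => absurd (h w) (by omega)) hi (fun β => ?_)
    (.inr fun v _ hv => absurd (h v) (by omega))
  have := card_half_add_cross_le hF.faults i β
  omega

/-- If every split along a direction of a faulty edge at `a` leaves nearly all faults in one half,
then the faults off `a` agree with `a` in these directions. -/
theorem Admissible.agree_of_unbalanced (hF : Admissible F) (hm : 4 ≤ m)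
    {a : Fin (m + 1 + 1) → Bool} (ha : m + 1 + 1 ≤ (dirs F a).card + 3) {i : Fin (m + 1 + 1)}
    (hi : i ∈ dirs F a) (h : ∃ β, 3 * (m + 1 + 1) < (half F i β).card + 13) :
    F.card + 11 = 3 * (m + 1 + 1) ∧ ∀ e ∈ F, a ∉ e → ∀ w ∈ e, w i = a i := by
  have hc := hF.card
  obtain ⟨β, hβ⟩ := h
  have hsplit := card_eq' F hF.faults i β
  obtain ⟨a, rfl | rfl⟩ := exists_eq_ins_or i β a
  · have hai := mem_dirs_ins_same.1 hi
    have hpos := card_pos.2 ⟨a, hai⟩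
    have hempty : half F i (!β) = ∅ := card_eq_zero.1 (by omega)
    refine ⟨by omega, fun e he hae w hw => ?_⟩
    rcases edge_cases hF.faults i he with ⟨γ, e', he', rfl⟩ | ⟨w', hw', rfl⟩
    · obtain rfl : γ = β := by
        by_contra hγ
        obtain rfl : γ = !β := by
          revert hγ
          cases γ <;> cases β <;> simp
        simp [hempty] at he'
      obtain ⟨z, -, rfl⟩ := Sym2.mem_map.1 hw
      simp
    · obtain rfl := card_le_one.1 (show (cross F i).card ≤ 1 by omega) _ hw' _ hai
      exact absurd (by cases β <;> simp) hae
  · have hai := mem_dirs_ins_same.1 hi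
    have hpos := card_pos.2 ⟨a, hai⟩
    have hd := card_dirs_ins F i (!β) a
    rw [if_pos hai] at hd
    have := card_dirs_le (half_subset hF.faults i !β) a
    omega

theorem Admissible.laceable_of_unique_large_degree (hF : Admissible F) (hm : 4 ≤ m)
    (ih : ∀ F' : Finset (Sym2 (Fin (m + 1) → Bool)), Admissible F' → Laceable F')
    {a : Fin (m + 1 + 1) → Bool} (ha : m + 1 + 1 ≤ (dirs F a).card + 3)
    (huniq : ∀ w, m + 1 + 1 ≤ (dirs F w).card + 3 → w = a) : Laceable F := by
  have hc := hF.card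
  by_cases hbal : ∃ i ∈ dirs F a, ∀ β, (half F i β).card + 13 ≤ 3 * (m + 1 + 1)
  · obtain ⟨i, hi, hbal⟩ := hbal
    exact hF.laceable_of_direction hm ih (fun w hw => by rwa [huniq w hw]) (cross_nonempty hi) hbal
      (.inr fun v w hv hw => (huniq v hv).trans (huniq w hw).symm)
  push Not at hbal
  have hagree := fun i hi => hF.agree_of_unbalanced hm ha hi (hbal i hi)
  obtain ⟨i₀, hi₀⟩ := card_pos.1 (show 0 < (dirs F a).card by omega)
  have hcard := (hagree i₀ hi₀).1
  have hsplit := card_filter_add_card_filter_not (s := F) (a ∈ ·)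
  rw [card_star hF.faults] at hsplit
  have hcompl := card_add_card_compl (dirs F a)
  rw [Fintype.card_fin] at hcompl
  have hdeg := hF.deg a
  obtain h2 | h3 : (dirs F a).card + 2 = m + 1 + 1 ∨ (dirs F a).card + 3 = m + 1 + 1 := by omega
  · obtain ⟨p, q, hpq, hpq'⟩ := card_eq_two.1 (show (dirs F a)ᶜ.card = 2 by omega)
    have := card_le_two_of_face (F := F.filter (a ∉ ·))
      (fun e he => hF.faults (mem_filter.1 he).1) hpq (a := a) fun e he => by
        refine ⟨(mem_filter.1 he).2, fun w hw i hip hiq =>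
          (hagree i ?_).2 e (mem_filter.1 he).1 (mem_filter.1 he).2 w hw⟩
        by_contra hi
        rw [← mem_compl, hpq'] at hi
        simp [hip, hiq] at hi
    omega
  · obtain ⟨p, hp⟩ : ∃ p, 3 ≤ ((F.filter (a ∉ ·)).filter fun e => p ∈ diffDirs a e).card := by
      by_contra! hcon
      have h4 := sum_card_bipartiteAbove_eq_sum_card_bipartiteBelow (s := F.filter (a ∉ ·))
        (t := (dirs F a)ᶜ) fun e p => p ∈ diffDirs a e
      have h5 := sum_le_card_nsmul (dirs F a)ᶜ
        (fun p => ((F.filter (a ∉ ·)).filter fun e => p ∈ diffDirs a e).card) 2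
        fun p _ => Nat.le_of_lt_succ (hcon p)
      have h6 := card_nsmul_le_sum (F.filter (a ∉ ·))
        (fun e => ((dirs F a)ᶜ.filter fun p => p ∈ diffDirs a e).card) 2 fun e he => by
          have he := mem_filter.1 he
          refine (two_le_card_diffDirs (hF.faults he.1) he.2).trans (card_le_card fun p hp => ?_)
          rw [mem_filter, mem_compl]
          refine ⟨fun hpa => ?_, hp⟩
          obtain ⟨w, hw, hwp⟩ := mem_diffDirs.1 hp
          exact hwp ((hagree p hpa).2 e he.1 he.2 w hw)
      simp only [bipartiteAbove, bipartiteBelow, smul_eq_mul] at h4 h5 h6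
      omega
    obtain ⟨β, a, rfl⟩ := exists_eq_ins p a
    have hlarge : (half F p β).card + 3 ≤ F.card := by
      have h4 := card_filter_add_card_filter_not (s := F) fun e => p ∈ diffDirs (ins p β a) e
      have h5 : (half F p β).card ≤ (F.filter fun e => p ∉ diffDirs (ins p β a) e).card := by
        refine card_le_card_of_injOn (Sym2.map (ins p β)) (fun e he => ?_)
          (map_ins_injective p β).injOn
        rw [mem_coe, half, mem_filter] at he
        rw [mem_coe, mem_filter, mem_diffDirs]
        refine ⟨he.2, ?_⟩
        rintro ⟨w, hw, hwp⟩
        obtain ⟨z, -, rfl⟩ := Sym2.mem_map.1 hw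
        simp at hwp
      have h6 : ((F.filter (ins p β a ∉ ·)).filter fun e => p ∈ diffDirs (ins p β a) e).card ≤
          (F.filter fun e => p ∈ diffDirs (ins p β a) e).card :=
        card_le_card (filter_subset_filter _ (filter_subset _ _))
      omega
    have hsmall : (half F p !β).card ≤ (F.filter (ins p β a ∉ ·)).card := by
      refine card_le_card_of_injOn (Sym2.map (ins p !β)) (fun e he => ?_)
        (map_ins_injective p _).injOn
      rw [mem_coe, half, mem_filter] at he
      rw [mem_coe, mem_filter, mem_map_ins_iff]
      exact ⟨he.2, by simp⟩
    have key : ∀ γ, (half F p γ).card + 11 ≤ 3 * (m + 1) → Admissible (half F p γ) := by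
      intro γ hγ
      have hle : ∀ w, (dirs (half F p γ) w).card ≤ (dirs F (ins p γ w)).card := by
        intro w
        rw [card_dirs_ins]
        omega
      refine ⟨half_subset hF.faults p γ, hγ, fun w => ?_, fun v w hv hw => ?_⟩
      · by_cases hw : ins p γ w = ins p β a
        · have := hle w
          rw [hw] at this
          omega
        · have := mt (huniq (ins p γ w)) hw
          have := hle w
          omega
      · have h4 := hle v
        have h5 := hle w
        have h6 := huniq (ins p γ v) (by omega)
        have h7 := huniq (ins p γ w) (by omega)
        exact (ins_inj.1 (h6.trans h7.symm)).2
    refine hF.laceable_of_light_halves hm ih p fun γ => key γ ?_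
    obtain rfl | rfl : γ = β ∨ γ = !β := by cases γ <;> cases β <;> simp
    · omega
    · omega

theorem Admissible.laceable_of_two_large_degrees_of_ne (hF : Admissible F) (hm : 4 ≤ m)
    (ih : ∀ F' : Finset (Sym2 (Fin (m + 1) → Bool)), Admissible F' → Laceable F')
    {u v : Fin (m + 1 + 1) → Bool} (hu : (dirs F u).card + 3 = m + 1 + 1)
    (hv : m + 1 + 1 ≤ (dirs F v).card + 3) (hmax : ∀ w, w ≠ v → (dirs F w).card + 3 ≤ m + 1 + 1)
    {k : Fin (m + 1 + 1)} (hk : u k ≠ v k) (hkv : k ∈ dirs F v ∨ (dirs F v).card + 3 ≤ m + 1 + 1) :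
    Laceable F := by
  have hc := hF.card
  obtain ⟨β, v, rfl⟩ := exists_eq_ins k v
  obtain ⟨u, rfl | rfl⟩ := exists_eq_ins_or k β u
  · simp at hk
  have hle : ∀ γ w, (dirs F (ins k γ w)).card ≤ (half F k γ).card + (cross F k).card := by
    intro γ w
    rw [card_dirs_ins]
    have := card_dirs_le (half_subset hF.faults k γ) w
    split_ifs with h
    · have := card_pos.2 ⟨w, h⟩
      omega
    · omega
  have hsplit := card_eq' F hF.faults k β
  have h1 := hle β v
  have h2 := hle (!β) u
  have hhalf : ∀ γ, (half F k γ).card + 8 ≤ 2 * (m + 1 + 1) := by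
    intro γ
    obtain rfl | rfl : γ = β ∨ γ = !β := by cases γ <;> cases β <;> simp
    · omega
    · omega
  refine hF.laceable_of_light_halves hm ih k fun γ => ⟨half_subset hF.faults k γ, ?_, fun w => ?_,
    fun w w' hw hw' => ?_⟩
  · have := hhalf γ
    omega
  · have hd := card_dirs_ins F k γ w
    by_cases h : ins k γ w = ins k β v
    · obtain ⟨rfl, rfl⟩ := ins_inj.1 h
      rw [mem_dirs_ins_same] at hkv
      have := hF.deg (ins k γ w)
      split_ifs at hd <;> first | omega | simp_all
    · have := hmax _ h
      omega
  · by_contra hne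
    have := card_dirs_add_le (half_subset hF.faults k γ) hne
    have := hhalf γ
    omega

theorem Admissible.laceable_of_two_large_degrees (hF : Admissible F) (hm : 4 ≤ m)
    (ih : ∀ F' : Finset (Sym2 (Fin (m + 1) → Bool)), Admissible F' → Laceable F')
    {u v : Fin (m + 1 + 1) → Bool} (huv : u ≠ v) (hu : (dirs F u).card + 3 = m + 1 + 1)
    (hv : m + 1 + 1 ≤ (dirs F v).card + 3) (hmax : ∀ w, w ≠ v → (dirs F w).card + 3 ≤ m + 1 + 1) :
    Laceable F := by
  have hc := hF.card
  by_cases hk : ∃ k, u k ≠ v k ∧ (k ∈ dirs F v ∨ (dirs F v).card + 3 ≤ m + 1 + 1)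
  · obtain ⟨k, hk, hk'⟩ := hk
    exact hF.laceable_of_two_large_degrees_of_ne hm ih hu hv hmax hk hk'
  push Not at hk
  obtain ⟨k₀, hk₀⟩ := Function.ne_iff.1 huv
  have hv2 : (dirs F v).card + 2 = m + 1 + 1 := by
    have := (hk k₀ hk₀).2
    have := hF.deg v
    omega
  have hagree : ∀ i ∈ dirs F v, u i = v i := fun i hi => by
    by_contra h
    exact (hk i h).1 hi
  have hs : s(u, v) ∉ F := by
    intro h
    have hadj := hF.faults h
    rw [mem_edgeSet, Q_adj] at hadj
    obtain ⟨i, rfl⟩ := hadj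
    have := hagree i (mem_dirs.2 (by rwa [toggle_toggle, Sym2.eq_swap]))
    simp at this
  obtain ⟨i, hiu, hiv⟩ : ∃ i, i ∈ dirs F u ∧ i ∈ dirs F v := by
    by_contra! hcon
    have := card_finset_fin_le (dirs F u ∪ dirs F v)
    rw [card_union_of_disjoint (Finset.disjoint_left.2 hcon)] at this
    omega
  have hlarge : ∀ w, m + 1 + 1 ≤ (dirs F w).card + 3 → w = u ∨ w = v := by
    intro w hw
    by_contra! hne
    have := card_dirs_add_add_le hF.faults huv hne.1.symm hne.2.symm hs
    omega
  have hcross : 2 ≤ (cross F i).card := by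
    have hi := hagree i hiv
    obtain ⟨β, v, rfl⟩ := exists_eq_ins i v
    obtain ⟨u, rfl | rfl⟩ := exists_eq_ins_or i β u
    · exact one_lt_card.2 ⟨u, mem_dirs_ins_same.1 hiu, v, mem_dirs_ins_same.1 hiv,
        fun h => huv (h ▸ rfl)⟩
    · simp at hi
  obtain rfl | hm5 : m = 4 ∨ 5 ≤ m := by omega
  · refine starsLaceable (by norm_num) F hF.faults u v huv ?_ hv2.le hu.le hagree
    have h1 := card_star_union hF.faults huv
    rw [if_neg hs] at h1
    have h2 := eq_of_subset_of_card_le (filter_subset (fun e => u ∈ e ∨ v ∈ e) F) (by omega)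
    intro e he
    rw [← h2] at he
    exact (mem_filter.1 he).2
  · have hne : (cross F i).Nonempty := card_pos.1 (by omega)
    refine hF.laceable_of_direction hm ih (fun w hw => ?_) hne (fun β => ?_) (.inl hm5)
    · rcases hlarge w hw with rfl | rfl
      · exact hiu
      · exact hiv
    · have := card_half_add_cross_le hF.faults i β
      omega

theorem Admissible.laceable (hn : 4 ≤ n) {F : Finset (Sym2 (Fin n → Bool))} (hF : Admissible F) :
    Laceable F := by
  induction n, hn using Nat.le_induction with
  | base =>
    have := hF.card
    exact laceable_of_card_le _ (by norm_num) _ hF.faults (by omega)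
  | succ n hn ih =>
    obtain rfl | hn5 := hn.eq_or_lt
    · exact hF.laceable_five
    obtain ⟨m, rfl⟩ := Nat.exists_eq_add_of_le' (show 1 ≤ n by omega)
    have ih : ∀ F' : Finset (Sym2 (Fin (m + 1) → Bool)), Admissible F' → Laceable F' :=
      fun F' h => ih h
    have hm : 4 ≤ m := by omega
    by_cases hex : ∃ w, m + 1 + 1 ≤ (dirs F w).card + 3
    swap
    · push Not at hex
      exact hF.laceable_of_no_large_degree hm ih hex
    obtain ⟨v, hv, hmax⟩ : ∃ v, m + 1 + 1 ≤ (dirs F v).card + 3 ∧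
        ∀ w, w ≠ v → (dirs F w).card + 3 ≤ m + 1 + 1 := by
      by_cases h2 : ∃ v, (dirs F v).card + 2 = m + 1 + 1
      · obtain ⟨v, hv⟩ := h2
        refine ⟨v, by omega, fun w hw => ?_⟩
        have := mt (fun h => hF.unique w v h hv) hw
        have := hF.deg w
        omega
      · obtain ⟨v, hv⟩ := hex
        refine ⟨v, hv, fun w _ => ?_⟩
        have : (dirs F w).card + 2 ≠ m + 1 + 1 := fun h => h2 ⟨w, h⟩
        have := hF.deg w
        omega
    by_cases huniq : ∀ w, m + 1 + 1 ≤ (dirs F w).card + 3 → w = v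
    · exact hF.laceable_of_unique_large_degree hm ih hv huniq
    · push Not at huniq
      obtain ⟨u, hu, huv⟩ := huniq
      have := hmax u huv
      exact hF.laceable_of_two_large_degrees hm ih huv (by omega) hv hmax

end Induction

end Hypercube

theorem fault_tolerant_hamiltonian_laceable_3n (n : ℕ) (hn : 4 ≤ n)
    (F : Finset (Sym2 (Fin n → Bool)))
    (hFE : (F : Set (Sym2 (Fin n → Bool))) ⊆ (Q n).edgeSet)
    (hF : F.card ≤ 3 * n - 11)
    (hdeg2 : ∀ v, 2 ≤ faultyDeg F v)
    (hone : ∀ v w, faultyDeg F v = 2 → faultyDeg F w = 2 → v = w)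
    (x y : Fin n → Bool) (hxy : qparity x ≠ qparity y) :
    ∃ p : ((Q n).deleteEdges ↑F).Walk x y, p.IsHamiltonian := by
  have hadm : Hypercube.Admissible F := by
    have hsum := Hypercube.faultyDeg_eq F
    refine ⟨hFE, by omega, fun v => ?_, fun v w hv hw => hone v w ?_ ?_⟩
    · have := hsum v
      have := hdeg2 v
      omega
    · have := hsum v
      omega
    · have := hsum w
      omega
  exact (hadm.laceable hn x y (Hypercube.par_ne_iff.2 hxy)).exists_isHamiltonian
end
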